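/- arXiv:2111.07595 — 3 statements merged into one kernel-verified Lean document; each statement's English description precedes it below -/
import Mathlib

section
/- Let p be an odd prime and r a positive integer with p^r ≡ 1 (mod 4). Then the sum over k from 0 to (p^r-1)/2 of (6k+1)·(1/2)_k^3·(1/4)_k / (k!^4 · 4^k) is congruent to (p^r/16)·((1/2)_{(p^r-1)/4} / (1)_{(p^r-1)/4})·(16 − p^{2r}·H^{(2)}_{(p^r-1)/4}) modulo p^(r+3). -/
/-- The rising factorial (Pochhammer symbol) `(x)_k = x(x+1)⋯(x+k-1)`. -/
def risingFac (x : ℚ) (k : ℕ) : ℚ := ∏ i ∈ Finset.range k, (x + i)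

/-- The harmonic number of order 2, `H^(2)_m = ∑_{k=1}^m 1/k²`. -/
def harmonic2 (m : ℕ) : ℚ := ∑ k ∈ Finset.Icc 1 m, 1 / (k : ℚ) ^ 2

open Finset

/-- The interpolation nodes `(m + 1/2)²`, at which the sums `partialSum y X` terminate. -/
def node (m : ℕ) : ℚ := (m + 1 / 2) ^ 2

/-- A two-parameter deformation of `(1/2)_k³ (1/4)_k / (k!⁴ 4ᵏ)`, the value at `y = X = 0`. -/
def hyperCoeff (y X : ℚ) (k : ℕ) : ℚ :=
  ∏ i ∈ range k, ((1 / 2 + i) * (node i - X) * (1 / 4 - y + i) /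
    (4 * (i + 1) * (1 + 2 * y + i) * ((i + 1) ^ 2 - X / 4)))

/-- The truncated series `∑_{k<K} (6k+1) hyperCoeff y X k`. -/
def partialSum (y X : ℚ) (K : ℕ) : ℚ := ∑ k ∈ range K, (6 * k + 1) * hyperCoeff y X k

theorem hyperCoeff_zero (y X : ℚ) : hyperCoeff y X 0 = 1 := by simp [hyperCoeff]

theorem hyperCoeff_succ (y X : ℚ) (k : ℕ) :
    hyperCoeff y X (k + 1) = hyperCoeff y X k *
      ((1 / 2 + k) * (node k - X) * (1 / 4 - y + k) /
        (4 * (k + 1) * (1 + 2 * y + k) * ((k + 1) ^ 2 - X / 4))) :=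
  prod_range_succ _ _

theorem hyperCoeff_node_eq_zero (y : ℚ) {m k : ℕ} (h : m < k) : hyperCoeff y (node m) k = 0 :=
  prod_eq_zero (mem_range.mpr h) (by simp)

theorem partialSum_succ (y X : ℚ) (K : ℕ) :
    partialSum y X (K + 1) = partialSum y X K + (6 * K + 1) * hyperCoeff y X K :=
  sum_range_succ _ _

theorem sub_quarter_odd_ne_zero (k m : ℕ) : (k : ℚ) - (2 * m + 1) / 4 ≠ 0 := by
  intro h
  have h2 : (4 * k : ℚ) = 2 * m + 1 := by linarith
  norm_cast at h2
  omega

theorem sq_sub_node_ne_zero (k m : ℕ) : ((k : ℚ) + 1) ^ 2 - node m / 4 ≠ 0 := by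
  have h1 := sub_quarter_odd_ne_zero (k + 1) m
  have h2 : (k : ℚ) + 1 + (2 * m + 1) / 4 ≠ 0 := by positivity
  push_cast at h1
  have : ((k : ℚ) + 1) ^ 2 - node m / 4 =
      (k + 1 - (2 * m + 1) / 4) * (k + 1 + (2 * m + 1) / 4) := by
    unfold node; ring
  rw [this]
  exact mul_ne_zero h1 h2

theorem hyperCoeff_node_add_two {y : ℚ} (hy : 0 ≤ y) (m k : ℕ) :
    hyperCoeff y (node m) k = hyperCoeff y (node (m + 2)) k *
      ((m + 1 - k) * (m + 2 - k) * (2 * m + 5 + 4 * k) * (2 * m + 1) /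
        ((m + 1 + k) * (m + 2 + k) * (2 * m + 5) * (2 * m + 1 - 4 * k))) := by
  have hm : ∀ k : ℕ, (2 * m + 1 - 4 * k : ℚ) ≠ 0 := fun k h =>
    sub_quarter_odd_ne_zero k m (by linarith)
  induction k with
  | zero =>
    simp only [hyperCoeff_zero, Nat.cast_zero, mul_zero, sub_zero, add_zero]
    field_simp
  | succ k ih =>
    rw [hyperCoeff_succ, hyperCoeff_succ, ih]
    have h0 := hm k
    have h1 := hm (k + 1)
    have e1 : ((k : ℚ) + 1) ^ 2 - node m / 4 =
        -(2 * m + 1 - 4 * (k + 1)) * (2 * m + 5 + 4 * k) / 16 := by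
      unfold node; ring
    have e2 : ((k : ℚ) + 1) ^ 2 - node (m + 2) / 4 =
        -(2 * m + 1 - 4 * k) * (2 * m + 5 + 4 * (k + 1)) / 16 := by
      unfold node; push_cast; ring
    have e3 : node k - node m = (k - m) * (k + m + 1) := by unfold node; ring
    have e4 : node k - node (m + 2) = (k - m - 2) * (k + m + 3) := by
      unfold node; push_cast; ring
    rw [e1, e2, e3, e4]
    push_cast at h1 ⊢
    have h2 : (1 + 2 * y + k : ℚ) ≠ 0 := by positivity
    generalize hyperCoeff y (node (m + 2)) k = t
    field_simp
    ring

theorem partialSum_node_add_two {y : ℚ} (hy : 0 ≤ y) (m K : ℕ) :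
    partialSum y (node (m + 2)) K =
      (2 * m + 5) * (m + 1 - 2 * y) / ((2 * m + 1) * (m + 2 + 2 * y)) *
        partialSum y (node m) K -
      hyperCoeff y (node (m + 2)) K * (2 * K * (K + 2 * y) * (2 * m + 5 + 4 * K) * (2 * m + 3) /
        ((m + 1 + K) * (m + 2 + K) * (m + 2 + 2 * y))) := by
  induction K with
  | zero => simp [partialSum]
  | succ K ih =>
    rw [partialSum_succ, partialSum_succ, ih, hyperCoeff_node_add_two hy m K, hyperCoeff_succ]
    have h0 : (2 * m + 1 - 4 * K : ℚ) ≠ 0 := fun h =>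
      sub_quarter_odd_ne_zero K m (by linarith)
    have e2 : ((K : ℚ) + 1) ^ 2 - node (m + 2) / 4 =
        -(2 * m + 1 - 4 * K) * (2 * m + 5 + 4 * (K + 1)) / 16 := by
      unfold node; push_cast; ring
    have e4 : node K - node (m + 2) = (K - m - 2) * (K + m + 3) := by
      unfold node; push_cast; ring
    rw [e2, e4]
    push_cast
    rw [show (1 + 2 * y + K : ℚ) = K + 1 + 2 * y by ring]
    have h2 : (K + 1 + 2 * y : ℚ) ≠ 0 := by positivity
    have h3 : (m + 2 + 2 * y : ℚ) ≠ 0 := by positivity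
    generalize hyperCoeff y (node (m + 2)) K = t
    generalize partialSum y (node m) K = s
    clear ih e2 e4
    generalize hd : (2 * m + 1 - 4 * K : ℚ) = d at *
    field_simp
    rw [← hd]
    ring

theorem partialSum_node_zero (y : ℚ) {K : ℕ} (hK : 0 < K) : partialSum y (node 0) K = 1 := by
  obtain ⟨K, rfl⟩ := Nat.exists_eq_add_of_lt hK
  rw [partialSum, sum_eq_single_of_mem 0 (by simp)]
  · simp [hyperCoeff_zero]
  · intro k _ hk
    rw [hyperCoeff_node_eq_zero y (Nat.pos_of_ne_zero hk), mul_zero]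

theorem partialSum_node_one {y : ℚ} (hy : 0 ≤ y) {K : ℕ} (hK : 1 < K) :
    partialSum y (node 1) K = 3 * (2 * y) / (1 + 2 * y) := by
  have h : partialSum y (node 1) K = partialSum y (node 1) 2 := by
    refine (sum_subset (range_subset_range.mpr hK) fun k _ hk => ?_).symm
    rw [hyperCoeff_node_eq_zero y (by simpa [Nat.lt_iff_add_one_le] using hk), mul_zero]
  have h2 : 1 + 2 * y ≠ 0 := by positivity
  rw [h, partialSum, sum_range_succ, sum_range_one, hyperCoeff_succ, hyperCoeff_zero]
  norm_num [node]
  field_simp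
  ring

theorem partialSum_node_add_two_of_lt {y : ℚ} (hy : 0 ≤ y) {m K : ℕ} (hK : m + 2 < K) :
    partialSum y (node (m + 2)) K =
      (2 * m + 5) * (m + 1 - 2 * y) / ((2 * m + 1) * (m + 2 + 2 * y)) *
        partialSum y (node m) K := by
  rw [partialSum_node_add_two hy, hyperCoeff_node_eq_zero y hK, zero_mul, sub_zero]

theorem partialSum_node_even {y : ℚ} (hy : 0 ≤ y) (j : ℕ) {K : ℕ} (hK : 2 * j < K) :
    partialSum y (node (2 * j)) K =
      (4 * j + 1) * ∏ i ∈ range j, (1 + 2 * i - 2 * y) / (2 + 2 * i + 2 * y) := by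
  induction j with
  | zero => simpa using partialSum_node_zero y hK
  | succ j ih =>
    rw [mul_add_one, partialSum_node_add_two_of_lt hy (by omega), ih (by omega), prod_range_succ]
    have h3 : (2 + 2 * j + 2 * y : ℚ) ≠ 0 := by positivity
    generalize (∏ i ∈ range j, (1 + 2 * i - 2 * y) / (2 + 2 * i + 2 * y) : ℚ) = s
    push_cast
    rw [show (2 * j + 2 + 2 * y : ℚ) = 2 + 2 * j + 2 * y by ring]
    field_simp
    ring

theorem partialSum_node_odd {y : ℚ} (hy : 0 ≤ y) (j : ℕ) {K : ℕ} (hK : 2 * j + 1 < K) :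
    partialSum y (node (2 * j + 1)) K =
      (4 * j + 3) * (2 * y / (1 + 2 * y)) *
        ∏ i ∈ range j, (2 + 2 * i - 2 * y) / (3 + 2 * i + 2 * y) := by
  induction j with
  | zero =>
    rw [mul_zero, zero_add, partialSum_node_one hy (by omega)]
    simp [mul_div_assoc]
  | succ j ih =>
    rw [show 2 * (j + 1) + 1 = 2 * j + 1 + 2 by ring, partialSum_node_add_two_of_lt hy (by omega),
      ih (by omega), prod_range_succ]
    have h3 : (3 + 2 * j + 2 * y : ℚ) ≠ 0 := by positivity
    generalize (∏ i ∈ range j, (2 + 2 * i - 2 * y) / (3 + 2 * i + 2 * y) : ℚ) = s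
    generalize 2 * y / (1 + 2 * y) = u
    push_cast
    rw [show (2 * j + 1 + 2 + 2 * y : ℚ) = 3 + 2 * j + 2 * y by ring]
    field_simp
    ring

theorem hyperCoeff_zero_add_quarter (m k : ℕ) :
    hyperCoeff (m + 1 / 4) 0 k = hyperCoeff ((m + 1 : ℕ) + 1 / 4) 0 k *
      ((m + 1 - k) * (4 * m + 3 + 2 * k) * (4 * m + 5 + 2 * k) /
        ((m + 1) * (4 * m + 3) * (4 * m + 5))) := by
  induction k with
  | zero =>
    simp only [hyperCoeff_zero]
    push_cast
    field_simp
    ring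
  | succ k ih =>
    rw [hyperCoeff_succ, hyperCoeff_succ, ih]
    generalize hyperCoeff ((m + 1 : ℕ) + 1 / 4) 0 k = t
    push_cast
    have h1 : (1 + 2 * (m + 1 / 4) + k : ℚ) = (4 * m + 2 * k + 3) / 2 / 1 := by ring
    have h2 : (1 + 2 * (m + 1 + 1 / 4) + k : ℚ) = (4 * m + 2 * k + 7) / 2 / 1 := by ring
    rw [h1, h2]
    field_simp
    ring

theorem partialSum_zero_add_quarter (m K : ℕ) :
    partialSum ((m + 1 : ℕ) + 1 / 4) 0 K =
      (1 - 1 / (16 * (m + 1) ^ 2)) * partialSum (m + 1 / 4) 0 K -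
      hyperCoeff ((m + 1 : ℕ) + 1 / 4) 0 K *
        (K ^ 3 * (4 * m + 5 + 2 * K) / (m + 1) ^ 3) := by
  induction K with
  | zero => simp [partialSum]
  | succ K ih =>
    rw [partialSum_succ, partialSum_succ, ih, hyperCoeff_zero_add_quarter m K, hyperCoeff_succ]
    generalize hyperCoeff ((m + 1 : ℕ) + 1 / 4) 0 K = t
    generalize partialSum (m + 1 / 4) 0 K = s
    unfold node
    push_cast
    have h2 : (1 + 2 * (m + 1 + 1 / 4) + K : ℚ) = (4 * m + 2 * K + 7) / 2 / 1 := by ring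
    rw [h2]
    field_simp
    ring

theorem hyperCoeff_add_quarter_eq_zero (X : ℚ) {m k : ℕ} (h : m < k) :
    hyperCoeff (m + 1 / 4) X k = 0 :=
  prod_eq_zero (mem_range.mpr h) (by ring)

theorem partialSum_zero_quarter (m : ℕ) {K : ℕ} (hK : m < K) :
    partialSum (m + 1 / 4) 0 K = ∏ i ∈ range m, (1 - 1 / (16 * ((i : ℚ) + 1) ^ 2)) := by
  induction m with
  | zero =>
    rw [partialSum, sum_eq_single_of_mem 0 (by simpa using hK)]
    · simp [hyperCoeff_zero]
    · intro k _ hk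
      rw [hyperCoeff_add_quarter_eq_zero 0 (Nat.pos_of_ne_zero hk), mul_zero]
  | succ m ih =>
    rw [partialSum_zero_add_quarter, hyperCoeff_add_quarter_eq_zero 0 hK, ih (by omega),
      prod_range_succ]
    ring

section PadicIntegrality

variable (p : ℕ) [Fact p.Prime]

/-- The subring of `p`-integral rational numbers. -/
noncomputable def integralRat : Subring ℚ := (PadicInt.subring p).comap (Rat.castHom ℚ_[p])

variable {p}

theorem mem_integralRat {x : ℚ} : x ∈ integralRat p ↔ ‖(x : ℚ_[p])‖ ≤ 1 := Iff.rfl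

theorem inv_natCast_mem_integralRat {k : ℕ} (h : ¬ p ∣ k) : (k : ℚ)⁻¹ ∈ integralRat p := by
  have hk : ‖(k : ℚ_[p])‖ = 1 := by
    rw [Padic.norm_natCast_eq_one_iff]
    exact ((Fact.out : p.Prime).coprime_iff_not_dvd).mpr h
  rw [mem_integralRat]
  push_cast
  rw [norm_inv, hk, inv_one]

theorem inv_one_add_mem_integralRat {z : ℚ} (hz : z ∈ integralRat p) {k : ℕ} (hk : k ≠ 0) :
    1 + (p : ℚ) ^ k * z ≠ 0 ∧ (1 + (p : ℚ) ^ k * z)⁻¹ ∈ integralRat p := by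
  have hlt : ‖((p : ℚ_[p]) ^ k * z)‖ < 1 := by
    rw [norm_mul, norm_pow]
    exact mul_lt_one_of_nonneg_of_lt_one_left (by positivity)
      (pow_lt_one₀ (norm_nonneg _) Padic.norm_p_lt_one hk) hz
  have h : ‖((1 + (p : ℚ) ^ k * z : ℚ) : ℚ_[p])‖ = 1 := by
    push_cast
    rw [Padic.add_eq_max_of_ne (by rw [norm_one]; exact hlt.ne'), norm_one, max_eq_left hlt.le]
  refine ⟨fun h0 => by simp [h0] at h, ?_⟩
  rw [mem_integralRat, Rat.cast_inv, norm_inv, h, inv_one]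

/-- The congruence `x ≡ 1` modulo `p ^ k` in the ring of `p`-integral rationals. -/
def IsOneUnit (p : ℕ) [Fact p.Prime] (k : ℕ) (x : ℚ) : Prop :=
  ∃ z ∈ integralRat p, x = 1 + (p : ℚ) ^ k * z

theorem IsOneUnit.mul {k : ℕ} {x y : ℚ} (hx : IsOneUnit p k x) (hy : IsOneUnit p k y) :
    IsOneUnit p k (x * y) := by
  obtain ⟨a, ha, rfl⟩ := hx
  obtain ⟨b, hb, rfl⟩ := hy
  refine ⟨a + b + (p : ℚ) ^ k * a * b, ?_, by ring⟩
  have hp : (p : ℚ) ∈ integralRat p := natCast_mem _ p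
  exact add_mem (add_mem ha hb) (mul_mem (mul_mem (pow_mem hp k) ha) hb)

theorem IsOneUnit.inv {k : ℕ} {x : ℚ} (hx : IsOneUnit p k x) (hk : k ≠ 0) :
    IsOneUnit p k x⁻¹ := by
  obtain ⟨a, ha, rfl⟩ := hx
  obtain ⟨h0, h1⟩ := inv_one_add_mem_integralRat ha hk
  exact ⟨-(a * (1 + (p : ℚ) ^ k * a)⁻¹), neg_mem (mul_mem ha h1), by field_simp; ring⟩

theorem IsOneUnit.div {k : ℕ} {x y : ℚ} (hx : IsOneUnit p k x) (hy : IsOneUnit p k y)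
    (hk : k ≠ 0) : IsOneUnit p k (x / y) := by
  rw [div_eq_mul_inv]
  exact hx.mul (hy.inv hk)

theorem IsOneUnit.prod {ι : Type*} {k : ℕ} (s : Finset ι) {f : ι → ℚ}
    (h : ∀ i ∈ s, IsOneUnit p k (f i)) : IsOneUnit p k (∏ i ∈ s, f i) :=
  prod_induction f _ (fun _ _ => IsOneUnit.mul) ⟨0, zero_mem _, by simp⟩ h

theorem IsOneUnit.mem {k : ℕ} {x : ℚ} (hx : IsOneUnit p k x) : x ∈ integralRat p := by
  obtain ⟨a, ha, rfl⟩ := hx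
  exact add_mem (one_mem _) (mul_mem (pow_mem (natCast_mem _ p) k) ha)

theorem prime_pow_div_eq {r j : ℕ} (h0 : j ≠ 0) (hj : j < p ^ r) :
    ∃ z ∈ integralRat p, (p : ℚ) ^ r / j = p * z := by
  have hp : p.Prime := Fact.out
  obtain ⟨v, u, hu, rfl⟩ := Nat.exists_eq_pow_mul_and_not_dvd h0 p hp.ne_one
  have hu0 : 0 < u := Nat.pos_of_ne_zero (by rintro rfl; simp at hu)
  have hv : v < r := (Nat.pow_lt_pow_iff_right hp.one_lt).mp
    (lt_of_le_of_lt (Nat.le_mul_of_pos_right _ hu0) hj)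
  obtain ⟨s, rfl⟩ := Nat.exists_eq_add_of_lt hv
  refine ⟨(p : ℚ) ^ s * (u : ℚ)⁻¹, mul_mem (pow_mem (natCast_mem _ p) s)
    (inv_natCast_mem_integralRat hu), ?_⟩
  have : (p : ℚ) ≠ 0 := by exact_mod_cast hp.ne_zero
  have : (u : ℚ) ≠ 0 := by exact_mod_cast hu0.ne'
  push_cast
  field_simp
  ring

theorem inv_two_pow_mem_integralRat (hodd : Odd p) (k : ℕ) : ((2 : ℚ) ^ k)⁻¹ ∈ integralRat p := by
  have hp : p.Prime := Fact.out
  have := inv_natCast_mem_integralRat (p := p) (k := 2 ^ k) fun h => by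
    have h2 := (Nat.prime_dvd_prime_iff_eq hp Nat.prime_two).mp (hp.dvd_of_dvd_pow h)
    subst h2
    exact absurd hodd (by decide)
  simpa using this

theorem risingFac_div_factorial_mem {x : ℚ} (hx : x ∈ integralRat p) (k : ℕ) :
    risingFac x k / k.factorial ∈ integralRat p := by
  obtain ⟨y, hy⟩ : ∃ y : ℤ_[p], (y : ℚ_[p]) = x := ⟨⟨x, hx⟩, rfl⟩
  have h : (((ascPochhammer ℤ_[p] k).eval y : ℤ_[p]) : ℚ_[p]) =
      (risingFac x k : ℚ) := by
    induction k with
    | zero => simp [risingFac]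
    | succ k ih =>
      rw [ascPochhammer_succ_eval, PadicInt.coe_mul, ih]
      simp [risingFac, prod_range_succ, hy]
  have h2 := PadicInt.norm_ascPochhammer_le k y
  rw [PadicInt.norm_def, PadicInt.norm_def, h, PadicInt.coe_natCast] at h2
  rw [mem_integralRat]
  push_cast
  rw [norm_div]
  exact div_le_one_of_le₀ h2 (norm_nonneg _)

theorem prod_one_sub_eq {ι : Type*} [DecidableEq ι] (s : Finset ι) (f : ι → ℚ)
    (hf : ∀ i ∈ s, f i ∈ integralRat p) :
    ∃ z ∈ integralRat p,
      ∏ i ∈ s, (1 - (p : ℚ) ^ 2 * f i) = 1 - (p : ℚ) ^ 2 * ∑ i ∈ s, f i + (p : ℚ) ^ 4 * z := by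
  induction s using Finset.induction_on with
  | empty => exact ⟨0, zero_mem _, by simp⟩
  | insert a s ha ih =>
    obtain ⟨z, hz, h⟩ := ih fun i hi => hf i (mem_insert_of_mem hi)
    have h1 := hf a (mem_insert_self _ _)
    have h2 : ∑ i ∈ s, f i ∈ integralRat p := sum_mem fun i hi => hf i (mem_insert_of_mem hi)
    have hp : (p : ℚ) ∈ integralRat p := natCast_mem _ p
    refine ⟨z + f a * ∑ i ∈ s, f i - (p : ℚ) ^ 2 * f a * z, ?_, ?_⟩
    · exact sub_mem (add_mem hz (mul_mem h1 h2)) (mul_mem (mul_mem (pow_mem hp 2) h1) hz)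
    · rw [prod_insert ha, sum_insert ha, h]
      ring

/-- For `0 < n < p ^ r`, the number `p ^ r` times an entry of the Leibniz harmonic triangle in row
`n` is `p`-integral and divisible by `p`. -/
theorem prime_pow_div_choose_eq {r n k : ℕ} (hn : n < p ^ r) (h0 : 0 < n) (hk : k < n) :
    ∃ z ∈ integralRat p, (p : ℚ) ^ r / (n * (n - 1).choose k : ℕ) = p * z := by
  induction n generalizing k with
  | zero => omega
  | succ n ih =>
    induction k with
    | zero => simpa using prime_pow_div_eq (p := p) (r := r) (j := n + 1) (by omega) hn
    | succ k ihk =>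
      obtain ⟨a, ha, ea⟩ := ihk (by omega)
      obtain ⟨b, hb, eb⟩ := ih (k := k) (by omega) (by omega) (by omega)
      refine ⟨b - a, sub_mem hb ha, ?_⟩
      rw [mul_sub, ← ea, ← eb]
      obtain ⟨l, rfl⟩ : ∃ l, n = k + 1 + l := ⟨n - (k + 1), by omega⟩
      have e1 : k + 1 + l + 1 - 1 = k + 1 + l := rfl
      have e2 : k + 1 + l - 1 = k + l := by omega
      rw [e1, e2]
      push_cast
      rw [Nat.cast_add_choose, show k + 1 + l = k + (l + 1) by ring, Nat.cast_add_choose,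
        Nat.cast_add_choose, show k + (l + 1) = k + l + 1 by ring]
      simp only [Nat.factorial_succ]
      push_cast
      have hq : ∀ j : ℕ, (j.factorial : ℚ) ≠ 0 := fun j => by exact_mod_cast j.factorial_ne_zero
      have := hq k
      have := hq l
      have := hq (k + l)
      field_simp
      ring

end PadicIntegrality

theorem node_sub_node (i m : ℕ) : node i - node m = ((i : ℚ) - m) * (i + m + 1) := by
  unfold node; ring

theorem node_injective : Function.Injective node := by
  intro i m h
  have h1 := sub_eq_zero.mpr h
  rw [node_sub_node] at h1
  have h2 : (i + m + 1 : ℚ) ≠ 0 := by positivity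
  exact_mod_cast sub_eq_zero.mp ((mul_eq_zero.mp h1).resolve_right h2)

/-- The weights expressing `partialSum y 0 (N + 1)` through the values `partialSum y (node m) (N + 1)`
with `m ≤ N`. -/
def weight (N m : ℕ) : ℚ :=
  (∏ j ∈ (range (N + 1)).erase m, node j / (node j - node m)) *
    ∏ j ∈ range N, (1 - node m / (4 * ((j : ℚ) + 1) ^ 2))

open Polynomial in
theorem eval_zero_eq_sum_node {N : ℕ} {Q : ℚ[X]} (hQ : Q.natDegree ≤ N) :
    Q.eval 0 = ∑ m ∈ range (N + 1), Q.eval (node m) *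
      ∏ j ∈ (range (N + 1)).erase m, node j / (node j - node m) := by
  have h := Lagrange.eq_interpolate (s := range (N + 1)) (v := node) (f := Q)
    node_injective.injOn (by
      rw [card_range]
      exact lt_of_le_of_lt (degree_le_of_natDegree_le hQ) (by exact_mod_cast Nat.lt_succ_self N))
  conv_lhs => rw [h]
  rw [Lagrange.interpolate_apply, eval_finsetSum]
  refine sum_congr rfl fun m _ => ?_
  rw [eval_mul, eval_C, Lagrange.basis, eval_prod]
  congr 1
  refine prod_congr rfl fun j hj => ?_
  have hne : node j - node m ≠ 0 :=
    sub_ne_zero.mpr (node_injective.ne (ne_of_mem_erase hj))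
  have hne' : node m - node j ≠ 0 := sub_ne_zero.mpr (node_injective.ne (ne_of_mem_erase hj).symm)
  simp only [Lagrange.basisDivisor, eval_mul, eval_C, eval_sub, eval_X]
  field_simp
  ring

open Polynomial in
theorem hyperCoeff_zero_eq_sum_weight (y : ℚ) {N k : ℕ} (hk : k ≤ N) :
    hyperCoeff y 0 k = ∑ m ∈ range (N + 1), weight N m * hyperCoeff y (node m) k := by
  set c : ℚ := ∏ i ∈ range k, ((1 / 2 + i) * (1 / 4 - y + i) / (4 * (i + 1) * (1 + 2 * y + i)))
    with hc
  set Q : ℚ[X] := (∏ i ∈ range k, (C (node i) - X)) *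
    ∏ i ∈ Ico k N, (C (((i : ℚ) + 1) ^ 2) - C (1 / 4) * X) with hQ
  have hdeg : Q.natDegree ≤ N := by
    refine natDegree_mul_le.trans ?_
    have h1 : (∏ i ∈ range k, (C (node i) - X)).natDegree ≤ k := by
      refine (natDegree_prod_le _ _).trans ?_
      refine (sum_le_card_nsmul _ _ 1 fun i _ => ?_).trans (by simp)
      compute_degree
    have h2 : (∏ i ∈ Ico k N, (C (((i : ℚ) + 1) ^ 2) - C (1 / 4) * X)).natDegree ≤ N - k := by
      refine (natDegree_prod_le _ _).trans ?_
      refine (sum_le_card_nsmul _ _ 1 fun i _ => ?_).trans (by simp)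
      compute_degree
    omega
  have hev : ∀ x : ℚ, (∀ i : ℕ, ((i : ℚ) + 1) ^ 2 - x / 4 ≠ 0) →
      hyperCoeff y x k * ∏ i ∈ range N, (((i : ℚ) + 1) ^ 2 - x / 4) = c * Q.eval x := by
    intro x hx
    have hx' : ∏ i ∈ range k, (((i : ℚ) + 1) ^ 2 - x / 4) ≠ 0 := prod_ne_zero_iff.mpr fun i _ => hx i
    have e : hyperCoeff y x k = c * (∏ i ∈ range k, (node i - x)) /
        ∏ i ∈ range k, (((i : ℚ) + 1) ^ 2 - x / 4) := by
      rw [hc, hyperCoeff, ← prod_mul_distrib, ← prod_div_distrib]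
      refine prod_congr rfl fun i _ => ?_
      rw [div_mul_eq_mul_div, div_div]
      congr 1
      ring
    rw [e, ← prod_range_mul_prod_Ico _ hk, hQ, eval_mul, eval_prod, eval_prod]
    simp only [eval_sub, eval_C, eval_X, eval_mul]
    rw [show ∏ i ∈ Ico k N, (((i : ℚ) + 1) ^ 2 - 1 / 4 * x) =
      ∏ i ∈ Ico k N, (((i : ℚ) + 1) ^ 2 - x / 4) from prod_congr rfl fun i _ => by ring]
    rw [div_mul_eq_mul_div, div_eq_iff hx']
    ring
  have h0 := hev 0 fun i => by rw [zero_div, sub_zero]; positivity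
  rw [eval_zero_eq_sum_node hdeg, mul_sum] at h0
  have hE : ∏ i ∈ range N, (((i : ℚ) + 1) ^ 2) ≠ 0 :=
    prod_ne_zero_iff.mpr fun i _ => by positivity
  have h0' : ∏ i ∈ range N, (((i : ℚ) + 1) ^ 2 - 0 / 4) = ∏ i ∈ range N, (((i : ℚ) + 1) ^ 2) := by
    simp
  rw [h0'] at h0
  rw [← mul_left_inj' hE, h0, sum_mul]
  refine sum_congr rfl fun m _ => ?_
  rw [← mul_assoc, ← hev _ fun i => sq_sub_node_ne_zero i m, weight]
  have e : ∏ j ∈ range N, (1 - node m / (4 * ((j : ℚ) + 1) ^ 2)) =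
      (∏ i ∈ range N, (((i : ℚ) + 1) ^ 2 - node m / 4)) / ∏ i ∈ range N, (((i : ℚ) + 1) ^ 2) := by
    rw [← prod_div_distrib]
    refine prod_congr rfl fun i _ => ?_
    field_simp
  rw [e]
  generalize ∏ i ∈ range N, (((i : ℚ) + 1) ^ 2 - node m / 4) = a
  generalize ∏ j ∈ (range (N + 1)).erase m, node j / (node j - node m) = b
  field_simp

theorem partialSum_zero_eq_sum_weight (y : ℚ) (N : ℕ) :
    partialSum y 0 (N + 1) =
      ∑ m ∈ range (N + 1), weight N m * partialSum y (node m) (N + 1) := by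
  simp only [partialSum, mul_sum]
  rw [sum_comm]
  refine sum_congr rfl fun k hk => ?_
  rw [hyperCoeff_zero_eq_sum_weight y (Nat.lt_succ_iff.mp (mem_range.mp hk)), mul_sum]
  exact sum_congr rfl fun m _ => by ring

theorem prod_node_lt (m : ℕ) :
    ∏ j ∈ range m, node j / (node j - node m) =
      (-1) ^ m * ((2 * m).factorial / (16 ^ m * (m.factorial : ℚ) ^ 2)) := by
  have h1 : ∀ m : ℕ, ∏ j ∈ range m, node j =
      (((2 * m).factorial : ℚ) / (4 ^ m * m.factorial)) ^ 2 := by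
    intro m
    induction m with
    | zero => simp
    | succ m ih =>
      rw [prod_range_succ, ih, mul_add_one]
      simp only [Nat.factorial_succ, node]
      push_cast
      field_simp
      ring
  have h2 : ∏ j ∈ range m, ((j : ℚ) - m) = (-1) ^ m * m.factorial := by
    rw [← prod_range_reflect, ← prod_range_add_one_eq_factorial, Nat.cast_prod, ← card_range m,
      ← prod_const, card_range, ← prod_mul_distrib]
    refine prod_congr rfl fun j hj => ?_
    have : j + 1 ≤ m := mem_range.mp hj
    rw [Nat.sub_sub, Nat.add_comm 1 j, Nat.cast_sub this]
    push_cast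
    ring
  have h3 : ∏ j ∈ range m, ((j : ℚ) + m + 1) = (2 * m).factorial / m.factorial := by
    have h : ∀ k : ℕ, ∏ j ∈ range k, ((j : ℚ) + m + 1) = (m + k).factorial / m.factorial := by
      intro k
      induction k with
      | zero => simp [div_self, m.factorial_ne_zero]
      | succ k ih =>
        rw [prod_range_succ, ih, ← add_assoc]
        simp only [Nat.factorial_succ]
        push_cast
        ring
    rw [h, two_mul]
  rw [prod_div_distrib, h1]
  simp only [node_sub_node]
  rw [prod_mul_distrib, h2, h3]
  have hq : ∀ j : ℕ, (j.factorial : ℚ) ≠ 0 := fun j => by exact_mod_cast j.factorial_ne_zero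
  have := hq m
  have := hq (2 * m)
  rw [show (16 : ℚ) ^ m = 4 ^ m * 4 ^ m by rw [← mul_pow]; norm_num]
  rcases neg_one_pow_eq_or ℚ m with h | h <;> rw [h] <;> field_simp

theorem prod_node_erase (m l : ℕ) :
    ∏ j ∈ (range (m + l + 1)).erase m, node j / (node j - node m) =
      (-1) ^ m * (((2 * (m + l) + 1).factorial : ℚ) ^ 2 /
        ((2 * m + 1) * 16 ^ (m + l) * ((m + l).factorial : ℚ) ^ 2 * l.factorial *
          (2 * m + l + 1).factorial)) := by
  have hq : ∀ j : ℕ, (j.factorial : ℚ) ≠ 0 := fun j => by exact_mod_cast j.factorial_ne_zero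
  induction l with
  | zero =>
    rw [add_zero, range_add_one, erase_insert (by simp), prod_node_lt, Nat.factorial_succ]
    have := hq (2 * m)
    push_cast
    simp only [Nat.factorial_zero]
    push_cast
    field_simp
  | succ l ih =>
    rw [range_add_one, erase_insert_of_ne (by omega), prod_insert (by simp), ← add_assoc, ih,
      node_sub_node, show 2 * (m + l + 1) + 1 = 2 * (m + l) + 1 + 1 + 1 by ring,
      show 2 * m + (l + 1) + 1 = 2 * m + l + 1 + 1 by ring]
    simp only [Nat.factorial_succ, node]
    push_cast
    have h1 : (m + l + 1 - m : ℚ) = l + 1 := by ring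
    rw [h1]
    have := hq m
    have := hq l
    have := hq (m + l)
    have := hq (2 * m + l)
    have := hq (2 * (m + l))
    have h2 : (m + l + 1 + m + 1 : ℚ) = 2 * m + l + 1 + 1 := by ring
    rw [h2]
    generalize ((-1 : ℚ)) ^ m = s
    field_simp
    ring

theorem risingFac_sub_eq (x : ℚ) (N : ℕ) :
    risingFac (x - N) (2 * N + 1) = x * ∏ j ∈ range N, (x ^ 2 - ((j : ℚ) + 1) ^ 2) := by
  induction N with
  | zero => simp [risingFac]
  | succ N ih =>
    rw [prod_range_succ, ← mul_assoc, ← ih, risingFac, risingFac, mul_add_one,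
      prod_range_succ, prod_range_succ']
    push_cast
    rw [show ∏ k ∈ range (2 * N + 1), (x - ((N : ℚ) + 1) + (k + 1)) =
      ∏ k ∈ range (2 * N + 1), (x - N + k) from prod_congr rfl fun k _ => by ring]
    ring

section Congruence

variable {p : ℕ} [Fact p.Prime]

theorem factorial_div_sq_mem (N : ℕ) :
    ∃ z ∈ integralRat p,
      ((2 * N + 1).factorial : ℚ) / (N.factorial : ℚ) ^ 2 = (2 * N + 1) * z := by
  refine ⟨N.centralBinom, natCast_mem _ _, ?_⟩
  rw [Nat.centralBinom, two_mul, Nat.cast_add_choose, Nat.factorial_succ]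
  push_cast
  have : (N.factorial : ℚ) ≠ 0 := by exact_mod_cast N.factorial_ne_zero
  field_simp
  ring

theorem ballot_mem (m l : ℕ) :
    ∃ z ∈ integralRat p, (2 * m + 1) * ((2 * (m + l) + 1).factorial : ℚ) /
      (l.factorial * (2 * m + l + 1).factorial) = (2 * (m + l) + 1) * z := by
  have hq : ∀ j : ℕ, (j.factorial : ℚ) ≠ 0 := fun j => by exact_mod_cast j.factorial_ne_zero
  cases l with
  | zero =>
    refine ⟨1, one_mem _, ?_⟩
    have := hq (2 * m)
    simp only [add_zero, Nat.factorial_zero, Nat.factorial_succ]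
    push_cast
    field_simp
    ring
  | succ l =>
    refine ⟨((l + 1 + (2 * m + l + 1)).choose (l + 1) : ℕ) - ((l + (2 * m + l + 2)).choose l : ℕ),
      sub_mem (natCast_mem _ _) (natCast_mem _ _), ?_⟩
    rw [Nat.cast_add_choose, Nat.cast_add_choose,
      show l + 1 + (2 * m + l + 1) = 2 * (m + l + 1) by ring,
      show l + (2 * m + l + 2) = 2 * (m + l + 1) by ring,
      show 2 * m + (l + 1) + 1 = 2 * m + l + 1 + 1 by ring, ← add_assoc m l 1]
    simp only [Nat.factorial_succ (2 * (m + l + 1)), Nat.factorial_succ (2 * m + l + 1),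
      Nat.factorial_succ (2 * m + l), Nat.factorial_succ l]
    have := hq l
    have := hq (2 * m + l)
    generalize ((2 * (m + l + 1)).factorial) = f
    push_cast
    field_simp
    ring

theorem weight_mul_cube (hodd : Odd p) (m l : ℕ) :
    ∃ z ∈ integralRat p,
      (2 * m + 1) ^ 3 * weight (m + l) m = (2 * ((m : ℚ) + l) + 1) ^ 3 * z := by
  have hq : ∀ j : ℕ, (j.factorial : ℚ) ≠ 0 := fun j => by exact_mod_cast j.factorial_ne_zero
  set x : ℚ := (2 * m + 1) / 4 with hx
  have hxR : x - (m + l : ℕ) ∈ integralRat p := by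
    have h4 := inv_two_pow_mem_integralRat hodd 2
    have : x = (2 * m + 1 : ℕ) * ((2 : ℚ) ^ 2)⁻¹ := by rw [hx]; push_cast; ring
    rw [this]
    exact sub_mem (mul_mem (natCast_mem _ _) h4) (natCast_mem _ _)
  obtain ⟨z, hz, ez⟩ : ∃ z ∈ integralRat p, risingFac (x - (m + l : ℕ)) (2 * (m + l) + 1) /
      (2 * (m + l) + 1).factorial = z :=
    ⟨_, risingFac_div_factorial_mem hxR (2 * (m + l) + 1), rfl⟩
  obtain ⟨b, hb, eb⟩ := factorial_div_sq_mem (p := p) (m + l)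
  obtain ⟨e, he, ee⟩ := ballot_mem (p := p) m l
  have h16 := inv_two_pow_mem_integralRat hodd (4 * (m + l))
  have hD : ∏ j ∈ range (m + l), (1 - node m / (4 * ((j : ℚ) + 1) ^ 2)) =
      (-1) ^ (m + l) * (∏ j ∈ range (m + l), (x ^ 2 - ((j : ℚ) + 1) ^ 2)) /
        ((m + l).factorial : ℚ) ^ 2 := by
    rw [← prod_range_add_one_eq_factorial, Nat.cast_prod, ← prod_pow]
    nth_rw 2 [← card_range (m + l)]
    rw [← prod_const, ← prod_mul_distrib, ← prod_div_distrib]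
    refine prod_congr rfl fun j _ => ?_
    rw [hx, node]
    push_cast
    field_simp
    ring
  rw [risingFac_sub_eq, div_eq_iff (hq _)] at ez
  rw [div_eq_iff (pow_ne_zero 2 (hq _))] at eb
  rw [div_eq_iff (mul_ne_zero (hq _) (hq _))] at ee
  push_cast at eb ee
  refine ⟨(-1) ^ l * 4 * ((2 : ℚ) ^ (4 * (m + l)))⁻¹ * z * b ^ 2 * e, ?_, ?_⟩
  · refine mul_mem (mul_mem (mul_mem (mul_mem (mul_mem ?_ ?_) h16) hz) (pow_mem hb 2)) he
    · exact pow_mem (neg_mem (one_mem _)) l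
    · exact ofNat_mem _ 4
  rw [weight, prod_node_erase, hD, pow_mul (2 : ℚ) 4 (m + l)]
  norm_num only
  generalize ∏ j ∈ range (m + l), (x ^ 2 - ((j : ℚ) + 1) ^ 2) = D at *
  have h1 := hq l
  have h2 := hq (2 * m + l + 1)
  have h3 := hq (m + l)
  have h4 : (2 * m + 1 : ℚ) ≠ 0 := by positivity
  have hs : (-1 : ℚ) ^ m * (-1) ^ (m + l) = (-1) ^ l := by
    rw [← pow_add, ← add_assoc, pow_add, ← two_mul, pow_mul]
    norm_num
  rw [← hs]
  have eD : D = 4 * (z * (2 * (m + l) + 1).factorial) / (2 * m + 1) := by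
    rw [← ez, hx]; field_simp
  rw [eD]
  generalize ((2 * (m + l) + 1).factorial : ℚ) = F at *
  generalize (-1 : ℚ) ^ m = s
  generalize (-1 : ℚ) ^ (m + l) = t
  generalize (l.factorial : ℚ) = L at *
  generalize ((2 * m + l + 1).factorial : ℚ) = G at *
  generalize ((m + l).factorial : ℚ) = H at *
  field_simp
  have e3 : (2 * (m : ℚ) + 1) * F ^ 3 =
      (2 * ((m : ℚ) + l) + 1) * e * (L * G) * ((2 * ((m : ℚ) + l) + 1) * b * H ^ 2) ^ 2 := by
    rw [← ee, ← eb]; ring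
  linear_combination s * t * z * e3

variable {r : ℕ}

theorem isOneUnit_weight_self (hodd : Odd p) {N : ℕ} (hN : 2 * N + 1 = p ^ r) :
    IsOneUnit p 2 (weight N N) := by
  have hNQ : (2 * N + 1 : ℚ) = (p : ℚ) ^ r := by exact_mod_cast hN
  refine IsOneUnit.mul ?_ ?_
  · rw [range_add_one, erase_insert (by simp)]
    refine IsOneUnit.prod _ fun j hj => ?_
    have hjN := mem_range.mp hj
    obtain ⟨z, hz, e⟩ := prime_pow_div_eq (p := p) (r := r) (j := 2 * j + 1) (by omega) (by omega)
    have h : node j / (node j - node N) = (1 + (p : ℚ) ^ 2 * (-z ^ 2))⁻¹ := by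
      rw [show (1 + (p : ℚ) ^ 2 * (-z ^ 2)) = 1 - (p * z) ^ 2 by ring, ← e, ← hNQ,
        ← inv_div]
      congr 1
      unfold node
      push_cast
      field_simp
    rw [h]
    exact IsOneUnit.inv ⟨_, neg_mem (pow_mem hz 2), rfl⟩ two_ne_zero
  · refine IsOneUnit.prod _ fun j hj => ?_
    have hjN := mem_range.mp hj
    obtain ⟨z, hz, e⟩ := prime_pow_div_eq (p := p) (r := r) (j := j + 1) (by omega) (by omega)
    refine ⟨-(z ^ 2 * ((2 : ℚ) ^ 4)⁻¹), neg_mem (mul_mem (pow_mem hz 2)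
      (inv_two_pow_mem_integralRat hodd 4)), ?_⟩
    rw [show (1 + (p : ℚ) ^ 2 * -(z ^ 2 * ((2 : ℚ) ^ 4)⁻¹)) = 1 - (p * z) ^ 2 / 16 by ring, ← e,
      ← hNQ]
    unfold node
    push_cast
    field_simp
    ring

theorem isOneUnit_one_add_pow_div (hodd : Odd p) {j : ℕ} (h0 : j ≠ 0) (hj : j < p ^ r) (k : ℕ) :
    IsOneUnit p 1 (1 + (p : ℚ) ^ r / (2 ^ k * j)) := by
  obtain ⟨z, hz, e⟩ := prime_pow_div_eq h0 hj
  refine ⟨z * (2 ^ k)⁻¹, mul_mem hz (inv_two_pow_mem_integralRat hodd k), ?_⟩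
  rw [mul_comm, ← div_div, e]
  ring

theorem isOneUnit_one_sub_pow_div (hodd : Odd p) {j : ℕ} (h0 : j ≠ 0) (hj : j < p ^ r) (k : ℕ) :
    IsOneUnit p 1 (1 - (p : ℚ) ^ r / (2 ^ k * j)) := by
  obtain ⟨z, hz, e⟩ := prime_pow_div_eq h0 hj
  refine ⟨-(z * (2 ^ k)⁻¹), neg_mem (mul_mem hz (inv_two_pow_mem_integralRat hodd k)), ?_⟩
  rw [mul_comm (2 ^ k : ℚ), ← div_div, e]
  ring

/-- The ratio of `partialSum (q / 4) (node (2 * j))` to `partialSum 0 (node (2 * j))`. -/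
def evenRatio (q : ℚ) (j : ℕ) : ℚ :=
  ∏ i ∈ range j, (1 - q / (2 * (2 * i + 1))) / (1 + q / (4 * (i + 1)))

theorem isOneUnit_evenRatio (hodd : Odd p) {j : ℕ} (hj : 2 * j < p ^ r) :
    IsOneUnit p 1 (evenRatio ((p : ℚ) ^ r) j) := by
  refine IsOneUnit.prod _ fun i hi => IsOneUnit.div ?_ ?_ one_ne_zero
  · have := isOneUnit_one_sub_pow_div hodd (r := r) (j := 2 * i + 1) (by omega)
      (by have := mem_range.mp hi; omega) 1
    push_cast at this
    rwa [pow_one] at this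
  · have := isOneUnit_one_add_pow_div hodd (r := r) (j := i + 1) (by omega)
      (by have := mem_range.mp hi; omega) 2
    push_cast at this
    convert this using 3
    norm_num

theorem risingFac_half_div_factorial (j : ℕ) :
    risingFac (1 / 2) j / j.factorial = ∏ i ∈ range j, ((1 + 2 * i) / (2 + 2 * i) : ℚ) := by
  rw [risingFac, ← prod_range_add_one_eq_factorial, Nat.cast_prod, ← prod_div_distrib]
  refine prod_congr rfl fun i _ => ?_
  push_cast
  field_simp
  ring

theorem partialSum_zero_node_even (j : ℕ) {K : ℕ} (hK : 2 * j < K) :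
    partialSum 0 (node (2 * j)) K = (4 * j + 1) * (risingFac (1 / 2) j / j.factorial) := by
  rw [partialSum_node_even le_rfl j hK, risingFac_half_div_factorial]
  simp

theorem partialSum_node_even_eq {q : ℚ} (hq : 0 ≤ q) (j : ℕ) {K : ℕ} (hK : 2 * j < K) :
    partialSum (q / 4) (node (2 * j)) K =
      (4 * j + 1) * (risingFac (1 / 2) j / j.factorial) * evenRatio q j := by
  rw [partialSum_node_even (by positivity) j hK, risingFac_half_div_factorial, evenRatio, mul_assoc,
    ← prod_mul_distrib]
  congr 1
  refine prod_congr rfl fun i _ => ?_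
  have h1 : 2 + 2 * (i : ℚ) + 2 * (q / 4) ≠ 0 := by positivity
  have h2 : 1 + q / (4 * ((i : ℚ) + 1)) ≠ 0 := by positivity
  have h3 : 4 * ((i : ℚ) + 1) + q ≠ 0 := by positivity
  have h4 : 2 + 2 * (i : ℚ) + 2 * (q / 4) = (4 * (i + 1) + q) / 2 := by ring
  rw [h4]
  field_simp
  ring

theorem prod_even_div_odd (j : ℕ) :
    ∏ i ∈ range j, ((2 + 2 * i) / (3 + 2 * i) : ℚ) =
      4 ^ j / ((2 * j + 1) * (2 * j).choose j : ℕ) := by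
  induction j with
  | zero => simp
  | succ j ih =>
    rw [prod_range_succ, ih, two_mul (j + 1), two_mul j]
    push_cast
    rw [Nat.cast_add_choose, Nat.cast_add_choose, show j + 1 + (j + 1) = j + j + 1 + 1 by ring]
    simp only [Nat.factorial_succ]
    have : (j.factorial : ℚ) ≠ 0 := by exact_mod_cast j.factorial_ne_zero
    have : ((j + j).factorial : ℚ) ≠ 0 := by exact_mod_cast (j + j).factorial_ne_zero
    push_cast
    field_simp
    ring

theorem partialSum_node_odd_eq (hodd : Odd p) (j : ℕ) {K : ℕ} (hK : 2 * j + 1 < K)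
    (hj : 2 * j + 1 < p ^ r) :
    ∃ z ∈ integralRat p,
      partialSum ((p : ℚ) ^ r / 4) (node (2 * j + 1)) K = (4 * j + 3) * (p * z) := by
  set q : ℚ := (p : ℚ) ^ r with hq
  have hq0 : 0 ≤ q := by positivity
  have hU : IsOneUnit p 1 ((∏ i ∈ range j, (1 - q / (2 ^ 2 * (i + 1 : ℕ)))) /
      ∏ i ∈ range (j + 1), (1 + q / (2 ^ 1 * (2 * i + 1 : ℕ)))) := by
    refine IsOneUnit.div (IsOneUnit.prod _ fun i hi => ?_) (IsOneUnit.prod _ fun i hi => ?_)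
      one_ne_zero
    · have := mem_range.mp hi
      exact isOneUnit_one_sub_pow_div hodd (by omega) (by omega) 2
    · have := mem_range.mp hi
      exact isOneUnit_one_add_pow_div hodd (by omega) (by omega) 1
  obtain ⟨z, hz, e⟩ := prime_pow_div_choose_eq (p := p) (r := r) (n := 2 * j + 1) (k := j) hj
    (by omega) (by omega)
  rw [Nat.add_sub_cancel] at e
  have h2 := inv_two_pow_mem_integralRat hodd 1
  refine ⟨_, mul_mem (mul_mem (mul_mem hz (pow_mem (ofNat_mem _ 4) j)) h2) hU.mem, ?_⟩
  rw [partialSum_node_odd (by positivity) j hK, mul_assoc (4 * (j : ℚ) + 3), ← mul_assoc (p : ℚ),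
    ← mul_assoc (p : ℚ), ← mul_assoc (p : ℚ), ← e, prod_range_succ']
  congr 1
  have h3 : q / ((2 * j + 1) * (2 * j).choose j : ℕ) * 4 ^ j =
      q * ∏ i ∈ range j, ((2 + 2 * i) / (3 + 2 * i) : ℚ) := by
    rw [prod_even_div_odd]; ring
  rw [← hq, h3]
  have h4 : ∏ i ∈ range j, ((2 + 2 * i - 2 * (q / 4)) / (3 + 2 * i + 2 * (q / 4)) : ℚ) =
      (∏ i ∈ range j, ((2 + 2 * i) / (3 + 2 * i) : ℚ)) *
        ((∏ i ∈ range j, (1 - q / (2 ^ 2 * (i + 1 : ℕ)))) /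
          ∏ i ∈ range j, (1 + q / (2 ^ 1 * (2 * (i + 1) + 1 : ℕ)))) := by
    rw [← prod_div_distrib, ← prod_mul_distrib]
    refine prod_congr rfl fun i _ => ?_
    push_cast
    have h5 : 3 + 2 * (i : ℚ) + 2 * (q / 4) = (2 * (2 * (i + 1) + 1) + q) / 2 := by ring
    have h6 : 2 * (2 * ((i : ℚ) + 1) + 1) + q ≠ 0 := by positivity
    have h7 : 1 + q / (2 ^ 1 * (2 * ((i : ℚ) + 1) + 1)) =
      (2 * (2 * (i + 1) + 1) + q) / (2 * (2 * (i + 1) + 1)) := by field_simp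
    rw [h5, h7]
    field_simp
    ring
  rw [h4]
  push_cast
  simp only [mul_one, pow_one]
  generalize (∏ i ∈ range j, (1 + q / (2 * (2 * ((i : ℚ) + 1) + 1)))) = b
  have h8 : 1 + 2 * (q / 4) = 1 + q / 2 := by ring
  rw [h8]
  generalize 1 + q / 2 = c
  ring

theorem partialSum_node_sub_eq (hodd : Odd p) {m K : ℕ} (hK : m < K) (hm : m < p ^ r) :
    ∃ z ∈ integralRat p,
      partialSum 0 (node m) K - partialSum ((p : ℚ) ^ r / 4) (node m) K =
        (2 * m + 1) * (p * z) := by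
  obtain ⟨j, rfl | rfl⟩ := Nat.even_or_odd' m
  · obtain ⟨a, ha, e⟩ := isOneUnit_evenRatio hodd hm
    have hR : risingFac (1 / 2) j / j.factorial ∈ integralRat p := by
      refine risingFac_div_factorial_mem ?_ j
      simpa using inv_two_pow_mem_integralRat hodd 1
    refine ⟨-(a * (risingFac (1 / 2) j / j.factorial)), neg_mem (mul_mem ha hR), ?_⟩
    rw [partialSum_zero_node_even j hK, partialSum_node_even_eq (by positivity) j hK, e]
    push_cast
    ring
  · obtain ⟨z, hz, e⟩ := partialSum_node_odd_eq hodd j hK hm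
    refine ⟨-z, neg_mem hz, ?_⟩
    rw [e, partialSum_node_odd le_rfl j hK]
    push_cast
    ring

theorem weight_mul_partialSum_sub (hodd : Odd p) {N m : ℕ} (hN : 2 * N + 1 = p ^ r) (hm : m < N) :
    ∃ z ∈ integralRat p,
      weight N m * (partialSum 0 (node m) (N + 1) -
        partialSum ((p : ℚ) ^ r / 4) (node m) (N + 1)) = (p : ℚ) ^ (r + 3) * z := by
  obtain ⟨z, hz, e⟩ := partialSum_node_sub_eq (p := p) (r := r) hodd (m := m) (K := N + 1)
    (by omega) (by omega)
  obtain ⟨w, hw, e'⟩ := weight_mul_cube hodd m (N - m)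
  obtain ⟨v, hv, e''⟩ := prime_pow_div_eq (p := p) (r := r) (j := 2 * m + 1) (by omega) (by omega)
  rw [Nat.add_sub_cancel' hm.le, Nat.cast_sub hm.le, add_sub_cancel] at e'
  have hNQ : (2 * N + 1 : ℚ) = (p : ℚ) ^ r := by exact_mod_cast hN
  have h0 : (2 * m + 1 : ℚ) ≠ 0 := by positivity
  push_cast at e''
  rw [div_eq_iff h0] at e''
  rw [hNQ] at e'
  refine ⟨v ^ 2 * w * z, mul_mem (mul_mem (pow_mem hv 2) hw) hz, ?_⟩
  rw [e, ← mul_right_inj' (pow_ne_zero 2 h0)]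
  calc (2 * m + 1 : ℚ) ^ 2 * (weight N m * ((2 * m + 1) * (p * z)))
      = (2 * m + 1) ^ 3 * weight N m * (p * z) := by ring
    _ = (p : ℚ) ^ r * ((p : ℚ) ^ r) ^ 2 * w * (p * z) := by rw [e']; ring
    _ = (p : ℚ) ^ r * (p * v * (2 * m + 1)) ^ 2 * w * (p * z) := by rw [← e'']
    _ = _ := by ring

theorem prod_one_sub_eq_evenRatio (M : ℕ) :
    ∏ i ∈ range M, (1 - 1 / (16 * ((i : ℚ) + 1) ^ 2)) =
      (4 * M + 1) * (risingFac (1 / 2) M / M.factorial) * evenRatio (4 * M + 1) M *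
        ∏ i ∈ range M, (1 - ((4 * M + 1) / (4 * ((i : ℚ) + 1))) ^ 2) := by
  rw [risingFac_half_div_factorial, evenRatio, mul_assoc, mul_assoc, ← prod_mul_distrib,
    ← prod_mul_distrib]
  have h1 : ∏ i ∈ range M, (4 * (M : ℚ) + 1 - 4 * i - 2) = ∏ i ∈ range M, (4 * (i : ℚ) + 3) := by
    rw [← prod_range_reflect]
    refine prod_congr rfl fun i hi => ?_
    have : i + 1 ≤ M := mem_range.mp hi
    rw [Nat.sub_sub, Nat.add_comm 1 i, Nat.cast_sub this]
    push_cast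
    ring
  have h2 : ∏ i ∈ range M, (4 * (M : ℚ) + 1 - 4 * i - 4) = ∏ i ∈ range M, (4 * (i : ℚ) + 1) := by
    rw [← prod_range_reflect]
    refine prod_congr rfl fun i hi => ?_
    have : i + 1 ≤ M := mem_range.mp hi
    rw [Nat.sub_sub, Nat.add_comm 1 i, Nat.cast_sub this]
    push_cast
    ring
  have h3 : ∏ i ∈ range M, (4 * (i : ℚ) + 5) =
      (4 * M + 1) * ∏ i ∈ range M, (4 * (i : ℚ) + 1) := by
    have h := prod_range_succ (fun i : ℕ => 4 * (i : ℚ) + 1) M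
    rw [prod_range_succ'] at h
    rw [mul_comm, ← h]
    simp only [Nat.cast_zero, mul_zero, zero_add, mul_one]
    exact prod_congr rfl fun i _ => by push_cast; ring
  have h4 : ∏ i ∈ range M, (1 - 1 / (16 * ((i : ℚ) + 1) ^ 2)) =
      (∏ i ∈ range M, (4 * (i : ℚ) + 3)) * (∏ i ∈ range M, (4 * (i : ℚ) + 5)) /
        ∏ i ∈ range M, (16 * ((i : ℚ) + 1) ^ 2) := by
    rw [← prod_mul_distrib, ← prod_div_distrib]
    refine prod_congr rfl fun i _ => ?_
    field_simp
    ring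
  rw [h4, h3, ← h1, ← h2, mul_left_comm, mul_div_assoc, ← prod_mul_distrib, ← prod_div_distrib]
  congr 1
  refine prod_congr rfl fun i _ => ?_
  have h5 : 1 + (4 * (M : ℚ) + 1) / (4 * (i + 1)) ≠ 0 := by positivity
  have h6 : ∀ a b c : ℚ, b ≠ 0 → a / b * (b * c) = a * c := fun a b c hb => by field_simp
  rw [show 1 - ((4 * (M : ℚ) + 1) / (4 * ((i : ℚ) + 1))) ^ 2 =
    (1 + (4 * (M : ℚ) + 1) / (4 * (i + 1))) * (1 - (4 * (M : ℚ) + 1) / (4 * (i + 1))) by ring,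
    h6 _ _ _ h5]
  field_simp
  ring

theorem risingFac_one (k : ℕ) : risingFac 1 k = k.factorial := by
  rw [risingFac, ← prod_range_add_one_eq_factorial]
  push_cast
  exact prod_congr rfl fun i _ => add_comm _ _

theorem hyperCoeff_zero_zero (k : ℕ) :
    hyperCoeff 0 0 k =
      risingFac (1 / 2) k ^ 3 * risingFac (1 / 4) k / ((k.factorial : ℚ) ^ 4 * 4 ^ k) := by
  induction k with
  | zero => simp [hyperCoeff, risingFac]
  | succ k ih =>
    rw [hyperCoeff_succ, ih, risingFac, risingFac, risingFac, risingFac, prod_range_succ,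
      prod_range_succ, Nat.factorial_succ, node]
    have : (k.factorial : ℚ) ≠ 0 := by exact_mod_cast k.factorial_ne_zero
    push_cast
    field_simp
    ring

theorem exists_partialSum_sub_eq (hodd : Odd p) {M : ℕ} (hM : 4 * M + 1 = p ^ r) :
    ∃ z ∈ integralRat p,
      partialSum 0 0 (2 * M + 1) - (p : ℚ) ^ r / 16 * (risingFac (1 / 2) M / risingFac 1 M) *
        (16 - (p : ℚ) ^ (2 * r) * harmonic2 M) = (p : ℚ) ^ (r + 3) * z := by
  have hMQ : (4 * M + 1 : ℚ) = (p : ℚ) ^ r := by exact_mod_cast hM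
  have hN : 2 * (2 * M) + 1 = p ^ r := by omega
  have hp : (p : ℚ) ∈ integralRat p := natCast_mem _ p
  have hy : (p : ℚ) ^ r / 4 = M + 1 / 4 := by rw [← hMQ]; ring
  have hC' : partialSum ((p : ℚ) ^ r / 4) 0 (2 * M + 1) =
      (p : ℚ) ^ r * (risingFac (1 / 2) M / M.factorial) * evenRatio ((p : ℚ) ^ r) M *
        ∏ i ∈ range M, (1 - ((p : ℚ) ^ r / (4 * ((i : ℚ) + 1))) ^ 2) := by
    rw [hy, partialSum_zero_quarter M (by omega), prod_one_sub_eq_evenRatio, hMQ]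
  have hrest : ∃ z ∈ integralRat p, ∑ m ∈ range (2 * M), weight (2 * M) m *
      (partialSum 0 (node m) (2 * M + 1) -
        partialSum ((p : ℚ) ^ r / 4) (node m) (2 * M + 1)) = (p : ℚ) ^ (r + 3) * z := by
    choose! f hf hf' using fun m (hm : m < 2 * M) => weight_mul_partialSum_sub hodd hN hm
    refine ⟨∑ m ∈ range (2 * M), f m, sum_mem fun m hm => hf m (mem_range.mp hm), ?_⟩
    rw [mul_sum]
    exact sum_congr rfl fun m hm => hf' m (mem_range.mp hm)
  obtain ⟨z₀, hz₀, e₀⟩ := hrest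
  have hsplit := congrArg₂ (· - ·) (partialSum_zero_eq_sum_weight 0 (2 * M))
    (partialSum_zero_eq_sum_weight ((p : ℚ) ^ r / 4) (2 * M))
  simp only [← sum_sub_distrib, ← mul_sub] at hsplit
  rw [sum_range_succ, e₀, hC', partialSum_zero_node_even M (by omega),
    partialSum_node_even_eq (by positivity) M (by omega), hMQ] at hsplit
  obtain ⟨w, hw, ew⟩ := isOneUnit_weight_self hodd hN
  obtain ⟨a, ha, ea⟩ := isOneUnit_evenRatio (p := p) (r := r) hodd (j := M) (by omega)
  have hB : risingFac (1 / 2) M / M.factorial ∈ integralRat p := by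
    refine risingFac_div_factorial_mem ?_ M
    simpa using inv_two_pow_mem_integralRat hodd 1
  choose! g hg hg' using fun i (hi : i < M) =>
    prime_pow_div_eq (p := p) (r := r) (j := i + 1) (by omega) (by omega)
  have h16 := inv_two_pow_mem_integralRat hodd 4
  have hgm : ∀ i ∈ range M, g i ^ 2 * ((2 : ℚ) ^ 4)⁻¹ ∈ integralRat p := fun i hi =>
    mul_mem (pow_mem (hg i (mem_range.mp hi)) 2) h16
  obtain ⟨b, hb, eb⟩ := prod_one_sub_eq (range M) _ hgm
  have hprod : ∏ i ∈ range M, (1 - ((p : ℚ) ^ r / (4 * ((i : ℚ) + 1))) ^ 2) =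
      ∏ i ∈ range M, (1 - (p : ℚ) ^ 2 * (g i ^ 2 * ((2 : ℚ) ^ 4)⁻¹)) := by
    refine prod_congr rfl fun i hi => ?_
    have h := hg' i (mem_range.mp hi)
    push_cast at h
    rw [mul_comm (4 : ℚ), ← div_div, h]
    ring
  have hharm : (p : ℚ) ^ (2 * r) * harmonic2 M =
      16 * ((p : ℚ) ^ 2 * ∑ i ∈ range M, g i ^ 2 * ((2 : ℚ) ^ 4)⁻¹) := by
    rw [harmonic2, ← Ico_add_one_right_eq_Icc, sum_Ico_eq_sum_range, mul_sum, mul_sum, mul_sum,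
      Nat.add_sub_cancel]
    refine sum_congr rfl fun i hi => ?_
    have h := hg' i (mem_range.mp hi)
    rw [add_comm 1 i, mul_comm 2 r, pow_mul, mul_one_div, ← div_pow, h]
    ring
  rw [hprod, eb, ew, ea] at hsplit
  have hh : ∑ i ∈ range M, g i ^ 2 * ((2 : ℚ) ^ 4)⁻¹ ∈ integralRat p := sum_mem hgm
  rw [hharm, risingFac_one]
  generalize ∑ i ∈ range M, g i ^ 2 * ((2 : ℚ) ^ 4)⁻¹ = h at *
  generalize risingFac (1 / 2) M / M.factorial = B at *
  refine ⟨z₀ + B * (p * b * (1 + p * a) - a * h - a * w), ?_, ?_⟩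
  · exact add_mem hz₀ (mul_mem hB (sub_mem (sub_mem (mul_mem (mul_mem hp hb)
      (add_mem (one_mem _) (mul_mem hp ha))) (mul_mem ha hh)) (mul_mem ha hw)))
  · linear_combination hsplit

end Congruence

theorem stmt_4 (p : ℕ) [Fact p.Prime] (hodd : Odd p) (r : ℕ) (hr : 0 < r)
    (hp4 : p ^ r % 4 = 1) :
    ‖(((∑ k ∈ Finset.range ((p ^ r - 1) / 2 + 1),
        (6 * k + 1 : ℚ) * risingFac (1/2) k ^ 3 * risingFac (1/4) k /
          ((k.factorial : ℚ) ^ 4 * 4 ^ k)) -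
        ((p : ℚ) ^ r / 16) *
          (risingFac (1/2) ((p ^ r - 1) / 4) / risingFac 1 ((p ^ r - 1) / 4)) *
          (16 - (p : ℚ) ^ (2 * r) * harmonic2 ((p ^ r - 1) / 4)) : ℚ) : ℚ_[p])‖ ≤
      (p : ℝ) ^ (-(r + 3 : ℤ)) := by
  obtain ⟨M, hM⟩ : ∃ M, p ^ r = 4 * M + 1 := ⟨p ^ r / 4, by omega⟩
  have h2 : (p ^ r - 1) / 2 = 2 * M := by omega
  have h4 : (p ^ r - 1) / 4 = M := by omega
  obtain ⟨z, hz, e⟩ := exists_partialSum_sub_eq hodd hM.symm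
  have hsum : ∑ k ∈ Finset.range (2 * M + 1),
      (6 * k + 1 : ℚ) * risingFac (1/2) k ^ 3 * risingFac (1/4) k /
        ((k.factorial : ℚ) ^ 4 * 4 ^ k) = partialSum 0 0 (2 * M + 1) :=
    Finset.sum_congr rfl fun k _ => by rw [hyperCoeff_zero_zero]; ring
  rw [h2, h4, hsum, e]
  push_cast
  rw [norm_mul, Padic.norm_p_pow]
  push_cast
  exact mul_le_of_le_one_right (by positivity) hz
end

section
/- Let p be an odd prime and r a positive integer with p^r ≡ 1 (mod 4). Then the sum over k from 0 to (p^r-1)/2 of (6k+1)·(1/2)_k^3·(1/4)_k^2 / k!^5 is congruent to (p^r/8)·((1/2)_{(p^r-1)/4})^2 / ((1)_{(p^r-1)/4})^2 · (8 + 2p^{2r}·H^{(2)}_{(p^r-1)/2} − p^{2r}·H^{(2)}_{(p^r-1)/4}) modulo p^(r+4). -/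
open Finset

/-- The `k`-th term of the two-parameter deformation of the series
`∑ (6k+1) (1/2)_k^3 (1/4)_k^2 / k!^5`, which is the case `X = Y = 0`. -/
def quadTerm (X Y : ℚ) (k : ℕ) : ℚ :=
  (6 * k + 1) * ∏ j ∈ range k,
    ((1 / 2 + j) * ((1 / 2 + j) ^ 2 - X) * ((1 / 4 + j) ^ 2 - Y / 4) /
      ((j + 1) * ((j + 1) ^ 2 - X / 4) * ((j + 1) ^ 2 - Y)))

/-- The hypergeometric term through which the telescoping certificate for `x ↦ x + 2` is
expressed. -/
def certX (x Y : ℚ) (k : ℕ) : ℚ :=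
  ∏ j ∈ range k,
    ((1 / 2 + j) * (j + 1 / 2 + x) * (j - 3 / 2 - x) * ((1 / 4 + j) ^ 2 - Y / 4) /
      ((j + 1) * ((j + 1) ^ 2 - x ^ 2 / 4) * ((j + 1) ^ 2 - Y)))

lemma quadTerm_eq_certX {x : ℚ} (Y : ℚ) (hx : 0 < x) (k : ℕ) :
    quadTerm (x ^ 2) Y k =
      (6 * k + 1) * certX x Y k * ((k - x - 3 / 2) * (k - x - 1 / 2)) /
        ((x + 3 / 2) * (x + 1 / 2)) := by
  have h : ∏ j ∈ range k,
      ((1 / 2 + j) * ((1 / 2 + j) ^ 2 - x ^ 2) * ((1 / 4 + j) ^ 2 - Y / 4) /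
        ((j + 1) * ((j + 1) ^ 2 - x ^ 2 / 4) * ((j + 1) ^ 2 - Y))) =
      certX x Y k * ((k - x - 3 / 2) * (k - x - 1 / 2)) / ((x + 3 / 2) * (x + 1 / 2)) := by
    induction k with
    | zero => simp only [certX, range_zero, prod_empty]; field_simp; push_cast; ring
    | succ k ih =>
      rw [prod_range_succ, ih, certX, certX, prod_range_succ]
      push_cast
      generalize (∏ j ∈ range k, _ : ℚ) = P
      simp only [div_eq_mul_inv]
      ring
  rw [quadTerm, h]
  ring

lemma quadTerm_add_two_eq_certX {x : ℚ} (Y : ℚ) (hx : 0 < x)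
    (hk : ∀ j : ℕ, ((j : ℚ) + 1) ^ 2 - x ^ 2 / 4 ≠ 0)
    (hk2 : ∀ j : ℕ, ((j : ℚ) + 1) ^ 2 - (x + 2) ^ 2 / 4 ≠ 0) (k : ℕ) :
    quadTerm ((x + 2) ^ 2) Y k =
      (6 * k + 1) * certX x Y k * ((k + x + 1 / 2) * (k + x + 3 / 2) * (2 + x) * (x - 2 * k)) /
        ((x + 3 / 2) * (x + 1 / 2) * (2 + x + 2 * k) * x) := by
  have h : ∏ j ∈ range k,
      ((1 / 2 + j) * ((1 / 2 + j) ^ 2 - (x + 2) ^ 2) * ((1 / 4 + j) ^ 2 - Y / 4) /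
        ((j + 1) * ((j + 1) ^ 2 - (x + 2) ^ 2 / 4) * ((j + 1) ^ 2 - Y))) =
      certX x Y k * ((k + x + 1 / 2) * (k + x + 3 / 2) * (2 + x) * (x - 2 * k)) /
        ((x + 3 / 2) * (x + 1 / 2) * (2 + x + 2 * k) * x) := by
    induction k with
    | zero => simp only [certX, range_zero, prod_empty]; field_simp; push_cast; ring
    | succ k ih =>
      rw [prod_range_succ, ih, certX, certX, prod_range_succ]
      have h1 := hk k
      have h2 := hk2 k
      have h3 : (k : ℚ) + 1 - x / 2 ≠ 0 := fun h ↦ h1 (by linear_combination (k + 1 + x / 2) * h)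
      have h4 : (k : ℚ) - x / 2 ≠ 0 := fun h ↦ h2 (by linear_combination (k + 2 + x / 2) * h)
      have e1 : ((k : ℚ) + 1) ^ 2 - x ^ 2 / 4 = (k + 1 - x / 2) * (k + 1 + x / 2) := by ring
      have e2 : ((k : ℚ) + 1) ^ 2 - (x + 2) ^ 2 / 4 = (k - x / 2) * (k + 1 + x / 2 + 1) := by ring
      have e3 : x - 2 * (k : ℚ) = -2 * (k - x / 2) := by ring
      have e4 : x - 2 * ((k : ℚ) + 1) = -2 * (k + 1 - x / 2) := by ring
      have e5 : 2 + x + 2 * (k : ℚ) = 2 * (k + 1 + x / 2) := by ring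
      have e6 : 2 + x + 2 * ((k : ℚ) + 1) = 2 * (k + 1 + x / 2 + 1) := by ring
      have e7 : (1 / 2 + (k : ℚ)) ^ 2 - (x + 2) ^ 2 = (k - 3 / 2 - x) * (k + x + 5 / 2) := by ring
      have e8 : (k : ℚ) + 1 + x + 1 / 2 = k + x + 3 / 2 := by ring
      have e9 : (k : ℚ) + 1 + x + 3 / 2 = k + x + 5 / 2 := by ring
      have e10 : (k : ℚ) + 1 / 2 + x = k + x + 1 / 2 := by ring
      have h5 : (k : ℚ) + 1 + x / 2 ≠ 0 := by positivity
      have h6 : (k : ℚ) + 1 + x / 2 + 1 ≠ 0 := by positivity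
      have h7 : (k : ℚ) + 1 ≠ 0 := by positivity
      have h8 : (x + 3 / 2) * (x + 1 / 2) ≠ 0 := by positivity
      push_cast
      rw [e1, e2, e3, e4, e5, e6, e7, e8, e9, e10]
      generalize (∏ j ∈ range k, _ : ℚ) = P
      generalize (k : ℚ) + 1 + x / 2 = b at *
      generalize (k : ℚ) + 1 - x / 2 = a at *
      generalize (k : ℚ) - x / 2 = a' at *
      generalize ((x + 3 / 2) * (x + 1 / 2)) = f at *
      generalize (k : ℚ) + x + 3 / 2 = q1
      generalize (k : ℚ) + x + 1 / 2 = q2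
      generalize (k : ℚ) + x + 5 / 2 = q3
      generalize (k : ℚ) - 3 / 2 - x = q4
      generalize ((k : ℚ) + 1) ^ 2 - Y = d
      generalize (1 / 4 + (k : ℚ)) ^ 2 - Y / 4 = q5
      generalize (1 / 2 + (k : ℚ)) = q6
      generalize ((k : ℚ) + 1) = q7 at *
      rcases eq_or_ne d 0 with rfl | hd
      · simp
      field_simp
  rw [quadTerm, h]
  ring

lemma certX_aux {x e b f : ℚ} (P : ℚ) {k Y : ℚ} (hx : x ≠ 0) (he : e ≠ 0) (hb : b ≠ 0)
    (hk : k = b - 1 - x / 2) (hY : Y = (x + 3 / 2) ^ 2 - e) :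
    16 * (x + 2) / (x * e) * (k * (k ^ 2 - Y) * (k - 1 / 2) * (k - x / 2)) * P / f +
      ((6 * k + 1) * P * ((k + x + 1 / 2) * (k + x + 3 / 2) * (2 + x) * (x - 2 * k)) /
        (f * (2 * b) * x) - (x + 2) / x * (((x + 1 / 2) ^ 2 - Y) / e) *
        ((6 * k + 1) * P * ((k - x - 3 / 2) * (k - x - 1 / 2)) / f)) =
    16 * (x + 2) / (x * e) * ((k + 1 / 2) * ((1 / 2 + k) * (k + 1 / 2 + x) * (k - 3 / 2 - x) *
      ((1 / 4 + k) ^ 2 - Y / 4)) / b) * P / f := by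
  rcases eq_or_ne f 0 with rfl | hf
  · simp
  subst hk hY
  field_simp
  ring

lemma sum_quadTerm_add_two_sub {x Y : ℚ} (hx : 0 < x)
    (hk : ∀ j : ℕ, ((j : ℚ) + 1) ^ 2 - x ^ 2 / 4 ≠ 0)
    (hk2 : ∀ j : ℕ, ((j : ℚ) + 1) ^ 2 - (x + 2) ^ 2 / 4 ≠ 0)
    (hY : ∀ j : ℕ, ((j : ℚ) + 1) ^ 2 - Y ≠ 0) (hxY : (x + 3 / 2) ^ 2 - Y ≠ 0) (K : ℕ) :
    ∑ k ∈ range K, quadTerm ((x + 2) ^ 2) Y k -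
      (x + 2) / x * (((x + 1 / 2) ^ 2 - Y) / ((x + 3 / 2) ^ 2 - Y)) *
        ∑ k ∈ range K, quadTerm (x ^ 2) Y k =
      16 * (x + 2) / (x * ((x + 3 / 2) ^ 2 - Y)) *
        (K * (K ^ 2 - Y) * (K - 1 / 2) * (K - x / 2)) * certX x Y K /
          ((x + 3 / 2) * (x + 1 / 2)) := by
  induction K with
  | zero => simp
  | succ K ih =>
    rw [sum_range_succ, sum_range_succ, mul_add, add_sub_add_comm, ih,
      quadTerm_eq_certX Y hx, quadTerm_add_two_eq_certX Y hx hk hk2, certX, certX, prod_range_succ]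
    have h1 := hk K
    have h2 := hY K
    have h3 : (K : ℚ) + 1 - x / 2 ≠ 0 := fun h ↦ h1 (by linear_combination (K + 1 + x / 2) * h)
    have e1 : ((K : ℚ) + 1) ^ 2 - x ^ 2 / 4 = (K + 1 - x / 2) * (K + 1 + x / 2) := by ring
    have h4 : (K : ℚ) + 1 + x / 2 ≠ 0 := by positivity
    have h6 : (K : ℚ) + 1 ≠ 0 := by positivity
    have e5 : 2 + x + 2 * (K : ℚ) = 2 * (K + 1 + x / 2) := by ring
    push_cast
    rw [e1, e5]
    generalize (∏ j ∈ range K, _ : ℚ) = P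
    rw [certX_aux P hx.ne' hxY h4 (by ring) (by ring)]
    generalize (K : ℚ) = k at *
    congr 1
    have hcancel (s t q : ℚ) : (k + 1) * ((k + 1) ^ 2 - Y) * s * (k + 1 - x / 2) *
        (P * (t / ((k + 1) * ((k + 1 - x / 2) * q) * ((k + 1) ^ 2 - Y)))) = s * t / q * P := by
      generalize k + 1 - x / 2 = a at *
      field_simp
    rw [show k + 1 - 1 / 2 = k + 1 / 2 by ring, mul_assoc _ (_ * _) (P * _), hcancel, mul_assoc]

/-- The hypergeometric term through which the telescoping certificate for `y ↦ y + 2` is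
expressed. -/
def certY (y : ℚ) (k : ℕ) : ℚ :=
  ∏ j ∈ range k,
    ((1 / 2 + j) ^ 3 * (j + 1 / 4 + y / 2) * (j - 3 / 4 - y / 2) /
      ((j + 1) ^ 3 * ((j + 1) ^ 2 - y ^ 2)))

lemma quadTerm_eq_certY {y : ℚ} (hy : 0 < y) (k : ℕ) :
    quadTerm 0 (y ^ 2) k =
      (6 * k + 1) * certY y k * (3 / 4 + y / 2 - k) / (3 / 4 + y / 2) := by
  have h : ∏ j ∈ range k,
      ((1 / 2 + j) * ((1 / 2 + j) ^ 2 - 0) * ((1 / 4 + j) ^ 2 - y ^ 2 / 4) /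
        ((j + 1) * ((j + 1) ^ 2 - 0 / 4) * ((j + 1) ^ 2 - y ^ 2))) =
      certY y k * (3 / 4 + y / 2 - k) / (3 / 4 + y / 2) := by
    induction k with
    | zero =>
      have : 3 / 4 + y / 2 ≠ 0 := by positivity
      simp [certY, this]
    | succ k ih =>
      rw [prod_range_succ, ih, certY, certY, prod_range_succ]
      push_cast
      generalize (∏ j ∈ range k, _ : ℚ) = P
      simp only [div_eq_mul_inv, zero_mul, sub_zero]
      ring
  rw [quadTerm, h]
  ring

lemma quadTerm_add_two_eq_certY {y : ℚ} (hy : 0 < y)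
    (hk : ∀ j : ℕ, (j : ℚ) + 1 - y ≠ 0)
    (hk2 : ∀ j : ℕ, (j : ℚ) - 1 - y ≠ 0) (k : ℕ) :
    quadTerm 0 ((y + 2) ^ 2) k =
      (6 * k + 1) * certY y k *
        ((k + 1 / 4 + y / 2) * (1 + y) * (2 + y) * ((k - 1 - y) * (k - y))) /
        ((1 / 4 + y / 2) * ((k + 1 + y) * (k + 2 + y)) * ((1 + y) * y)) := by
  have h : ∏ j ∈ range k,
      ((1 / 2 + j) * ((1 / 2 + j) ^ 2 - 0) * ((1 / 4 + j) ^ 2 - (y + 2) ^ 2 / 4) /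
        ((j + 1) * ((j + 1) ^ 2 - 0 / 4) * ((j + 1) ^ 2 - (y + 2) ^ 2))) =
      certY y k * ((k + 1 / 4 + y / 2) * (1 + y) * (2 + y) * ((k - 1 - y) * (k - y))) /
        ((1 / 4 + y / 2) * ((k + 1 + y) * (k + 2 + y)) * ((1 + y) * y)) := by
    induction k with
    | zero =>
      have : 1 / 4 + y / 2 ≠ 0 := by positivity
      simp only [certY, range_zero, prod_empty]
      field_simp
      push_cast
      ring
    | succ k ih =>
      rw [prod_range_succ, ih, certY, certY, prod_range_succ]
      have h1 := hk k
      have h2 := hk2 k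
      have e1 : ((k : ℚ) + 1) ^ 2 - y ^ 2 = (k + 1 - y) * (k + 1 + y) := by ring
      have e2 : ((k : ℚ) + 1) ^ 2 - (y + 2) ^ 2 = (k - 1 - y) * (k + 3 + y) := by ring
      have e3 : (1 / 4 + (k : ℚ)) ^ 2 - (y + 2) ^ 2 / 4 =
          (k - 3 / 4 - y / 2) * (k + 5 / 4 + y / 2) := by ring
      have e4 : (k : ℚ) + 1 + 1 / 4 + y / 2 = k + 5 / 4 + y / 2 := by ring
      have e5 : (k : ℚ) + 1 - 1 - y = k - y := by ring
      have e6 : (k : ℚ) + 1 + 1 + y = k + 2 + y := by ring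
      have e7 : (k : ℚ) + 1 + 2 + y = k + 3 + y := by ring
      have h3 : (k : ℚ) + 1 + y ≠ 0 := by positivity
      have h4 : (k : ℚ) + 2 + y ≠ 0 := by positivity
      have h5 : (k : ℚ) + 3 + y ≠ 0 := by positivity
      have h6 : (k : ℚ) + 1 ≠ 0 := by positivity
      have h7 : (1 / 4 + y / 2) * ((1 + y) * y) ≠ 0 := by positivity
      push_cast
      rw [e1, e2, e3, e4, e5, e6, e7, mul_right_comm (1 / 4 + y / 2),
        mul_right_comm (1 / 4 + y / 2)]
      simp only [zero_div, sub_zero]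
      generalize (∏ j ∈ range k, _ : ℚ) = P
      generalize (k : ℚ) + 1 + y = q1 at *
      generalize (k : ℚ) + 2 + y = q2 at *
      generalize (k : ℚ) + 3 + y = q3 at *
      generalize (k : ℚ) + 1 - y = q4 at *
      generalize (k : ℚ) - 1 - y = q5 at *
      generalize (k : ℚ) - y = q6 at *
      generalize (k : ℚ) - 3 / 4 - y / 2 = q7
      generalize (k : ℚ) + 5 / 4 + y / 2 = q8
      generalize (k : ℚ) + 1 / 4 + y / 2 = q9
      generalize (1 / 2 + (k : ℚ)) = q10
      generalize ((k : ℚ) + 1) = q11 at *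
      generalize (1 / 4 + y / 2) * ((1 + y) * y) = q12 at *
      field_simp
  rw [quadTerm, h]
  ring

lemma certY_aux {y k : ℚ} (P : ℚ) (hy : 0 < y) (hb : k + 1 + y ≠ 0) (hb2 : k + 2 + y ≠ 0) :
    32 * (y + 1) * (y + 2) / (y * (y + 3 / 2) ^ 3 * (y + 1 / 2)) *
        (k ^ 3 * (k - 1 / 2) * (k - y)) * P / (k + 1 + y) +
      ((6 * k + 1) * P * ((k + 1 / 4 + y / 2) * (1 + y) * (2 + y) * ((k - 1 - y) * (k - y))) /
        ((1 / 4 + y / 2) * ((k + 1 + y) * (k + 2 + y)) * ((1 + y) * y)) -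
        (y + 2) / y * ((y + 1 / 2) / (y + 3 / 2)) ^ 2 *
        ((6 * k + 1) * P * (3 / 4 + y / 2 - k) / (3 / 4 + y / 2))) =
    32 * (y + 1) * (y + 2) / (y * (y + 3 / 2) ^ 3 * (y + 1 / 2)) *
      ((k + 1 / 2) * ((1 / 2 + k) ^ 3 * (k + 1 / 4 + y / 2) * (k - 3 / 4 - y / 2)) /
        (k + 1 + y)) * P / (k + 2 + y) := by
  have h1 : 1 / 4 + y / 2 = (y + 1 / 2) / 2 := by ring
  have h2 : 3 / 4 + y / 2 = (y + 3 / 2) / 2 := by ring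
  rw [h1, h2]
  obtain ⟨a, ha⟩ : ∃ a, y = a - 1 / 2 := ⟨y + 1 / 2, by ring⟩
  have ha0 : 2 * a - 1 ≠ 0 := by rw [ha] at hy; linarith
  have ha1 : a ≠ 0 := by rw [ha] at hy; linarith
  have ha2 : a + 1 ≠ 0 := by rw [ha] at hy; linarith
  have e1 : y + 1 / 2 = a := by rw [ha]; ring
  have e2 : y + 3 / 2 = a + 1 := by rw [ha]; ring
  have e3 : 1 + y ≠ 0 := by positivity
  rw [e1, e2]
  field_simp
  subst ha
  ring

lemma sum_quadTerm_add_two_sub' {y : ℚ} (hy : 0 < y)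
    (hk : ∀ j : ℕ, (j : ℚ) + 1 - y ≠ 0) (hk2 : ∀ j : ℕ, (j : ℚ) - 1 - y ≠ 0) (K : ℕ) :
    ∑ k ∈ range K, quadTerm 0 ((y + 2) ^ 2) k -
      (y + 2) / y * ((y + 1 / 2) / (y + 3 / 2)) ^ 2 * ∑ k ∈ range K, quadTerm 0 (y ^ 2) k =
      32 * (y + 1) * (y + 2) / (y * (y + 3 / 2) ^ 3 * (y + 1 / 2)) *
        (K ^ 3 * (K - 1 / 2) * (K - y)) * certY y K / (K + 1 + y) := by
  induction K with
  | zero => simp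
  | succ K ih =>
    have h1 := hk K
    have h3 : (K : ℚ) + 1 + y ≠ 0 := by positivity
    have h4 : (K : ℚ) + 2 + y ≠ 0 := by positivity
    have h6 : (K : ℚ) + 1 ≠ 0 := by positivity
    have e1 : ((K : ℚ) + 1) ^ 2 - y ^ 2 = (K + 1 - y) * (K + 1 + y) := by ring
    rw [sum_range_succ, sum_range_succ, mul_add, add_sub_add_comm, ih,
      quadTerm_eq_certY hy, quadTerm_add_two_eq_certY hy hk hk2, certY, certY, prod_range_succ]
    push_cast
    rw [e1]
    generalize (∏ j ∈ range K, _ : ℚ) = P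
    rw [certY_aux P hy h3 h4]
    generalize (K : ℚ) = k at *
    rw [show k + 1 + 1 + y = k + 2 + y by ring]
    congr 1
    have hcancel (s t q : ℚ) : (k + 1) ^ 3 * s * (k + 1 - y) *
        (P * (t / ((k + 1) ^ 3 * ((k + 1 - y) * q)))) = s * t / q * P := by
      generalize k + 1 - y = a at *
      generalize k + 1 = b at *
      field_simp
    rw [show k + 1 - 1 / 2 = k + 1 / 2 by ring, mul_assoc _ (_ * _) (P * _), hcancel, mul_assoc]

lemma quadTerm_half_eq_zero (Y : ℚ) {i k : ℕ} (h : i < k) :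
    quadTerm ((i + 1 / 2) ^ 2) Y k = 0 := by
  rw [quadTerm, prod_eq_zero (mem_range.2 h), mul_zero]
  simp only [add_comm, sub_self, mul_zero, zero_mul, zero_div]

lemma sq_sub_half_sq_ne_zero (a b : ℕ) :
    ((a : ℚ) + 1) ^ 2 - (b + 1 / 2) ^ 2 / 4 ≠ 0 := by
  intro h
  have h0 : (4 * (a + 1) - (2 * b + 1) : ℚ) * (4 * (a + 1) + (2 * b + 1)) = 0 := by
    linear_combination 16 * h
  rcases mul_eq_zero.1 h0 with h1 | h1
  · have : (4 * (a + 1) - (2 * b + 1) : ℤ) = 0 := by exact_mod_cast h1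
    omega
  · have : (0 : ℚ) < 4 * (a + 1) + (2 * b + 1) := by positivity
    exact this.ne' h1

lemma sum_quadTerm_half_step {Y : ℚ} (hY : ∀ j : ℕ, ((j : ℚ) + 1) ^ 2 - Y ≠ 0) {i K : ℕ}
    (hi : i + 2 < K) :
    ∑ k ∈ range K, quadTerm (((i + 2 : ℕ) + 1 / 2) ^ 2) Y k =
      (2 * i + 5) / (2 * i + 1) * (((i + 1) ^ 2 - Y) / ((i + 2) ^ 2 - Y)) *
        ∑ k ∈ range K, quadTerm ((i + 1 / 2) ^ 2) Y k := by
  have h := sum_quadTerm_add_two_sub (x := i + 1 / 2) (Y := Y) (by positivity)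
    (fun j ↦ sq_sub_half_sq_ne_zero j i) (fun j ↦ by
      have := sq_sub_half_sq_ne_zero j (i + 2)
      push_cast at this
      rwa [add_right_comm]) hY (by
      have := hY (i + 1)
      push_cast at this
      convert this using 2
      ring) K
  have h0 : certX (i + 1 / 2) Y K = 0 := by
    refine prod_eq_zero (mem_range.2 hi) ?_
    push_cast
    ring
  rw [h0, mul_zero, zero_div, sub_eq_zero] at h
  convert h using 2
  · push_cast
    ring_nf
  · congr 1
    · field_simp
      ring
    · ring_nf

lemma sum_quadTerm_even_half {Y : ℚ} (hY : ∀ j : ℕ, ((j : ℚ) + 1) ^ 2 - Y ≠ 0) {l K : ℕ}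
    (hl : 2 * l < K) :
    ∑ k ∈ range K, quadTerm (((2 * l : ℕ) + 1 / 2) ^ 2) Y k =
      (4 * l + 1) * ∏ j ∈ range l, ((2 * j + 1) ^ 2 - Y) / ((2 * j + 2) ^ 2 - Y) := by
  induction l with
  | zero =>
    rw [sum_eq_single_of_mem 0 (mem_range.2 (by omega))
      fun k _ hk ↦ quadTerm_half_eq_zero Y (by omega)]
    simp [quadTerm]
  | succ l ih =>
    rw [mul_add_one, sum_quadTerm_half_step hY (by omega), ih (by omega), prod_range_succ]
    push_cast
    field_simp
    ring

lemma sum_quadTerm_odd_half {Y : ℚ} (hY : ∀ j : ℕ, ((j : ℚ) + 1) ^ 2 - Y ≠ 0) {l K : ℕ}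
    (hl : 2 * l + 1 < K) :
    ∑ k ∈ range K, quadTerm (((2 * l + 1 : ℕ) + 1 / 2) ^ 2) Y k =
      (4 * l + 3) * (Y / (1 - Y)) *
        ∏ j ∈ range l, ((2 * j + 2) ^ 2 - Y) / ((2 * j + 3) ^ 2 - Y) := by
  induction l with
  | zero =>
    have h1 : 1 - Y ≠ 0 := by simpa using hY 0
    rw [← sum_subset (range_subset_range.2 (show 2 ≤ K by omega))
      fun k _ hk ↦ quadTerm_half_eq_zero Y (by simp at hk; omega)]
    simp [quadTerm, sum_range_succ]
    field_simp
    ring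
  | succ l ih =>
    have h3 : (2 * (l : ℚ) + 3) ^ 2 - Y ≠ 0 := by
      have := hY (2 * l + 2)
      push_cast at this
      convert this using 2
      ring
    rw [show 2 * (l + 1) + 1 = 2 * l + 1 + 2 by ring, sum_quadTerm_half_step hY (by omega),
      ih (by omega), prod_range_succ]
    push_cast
    rw [show (2 * (l : ℚ) + 1 + 1) = 2 * l + 2 by ring,
      show (2 * (l : ℚ) + 1 + 2) = 2 * l + 3 by ring]
    field_simp
    ring

lemma sum_quadTerm_zero_half {i K : ℕ} (hi : i < K) :
    ∑ k ∈ range K, quadTerm 0 ((2 * i + 1 / 2) ^ 2) k =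
      (4 * i + 1) * ∏ j ∈ range i, ((2 * j + 1) / (2 * j + 2) : ℚ) ^ 2 := by
  induction i with
  | zero =>
    rw [sum_eq_single_of_mem 0 (mem_range.2 hi)]
    · simp [quadTerm]
    · intro k _ hk
      rw [quadTerm, prod_eq_zero (mem_range.2 (Nat.pos_of_ne_zero hk)), mul_zero]
      norm_num
  | succ i ih =>
    have hne (a : ℤ) : (a : ℚ) - (2 * i + 1 / 2) ≠ 0 := by
      intro h
      have : (2 * a - (4 * i + 1) : ℤ) = 0 := by
        have : (2 * a - (4 * i + 1) : ℚ) = 0 := by linear_combination 2 * h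
        exact_mod_cast this
      omega
    have h := sum_quadTerm_add_two_sub' (y := 2 * i + 1 / 2) (by positivity)
      (fun j ↦ by simpa using hne (j + 1)) (fun j ↦ by simpa using hne (j - 1)) K
    have h0 : certY (2 * i + 1 / 2) K = 0 := by
      refine prod_eq_zero (mem_range.2 hi) ?_
      push_cast
      ring
    rw [h0, mul_zero, zero_div, sub_eq_zero, ih (by omega)] at h
    rw [prod_range_succ]
    push_cast
    rw [show 2 * ((i : ℚ) + 1) + 1 / 2 = 2 * i + 1 / 2 + 2 by ring, h]
    field_simp
    ring

/-- A polynomial version in `X` of the truncated sum of `quadTerm X Y`. -/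
noncomputable def quadPoly (M : ℕ) (Y : ℚ) : Polynomial ℚ :=
  ∑ k ∈ range (M + 1),
    Polynomial.C ((6 * k + 1) * ∏ j ∈ range k,
      ((1 / 2 + j) * ((1 / 4 + j) ^ 2 - Y / 4) / ((j + 1) * ((j + 1) ^ 2 - Y))) : ℚ) *
    ((∏ j ∈ range k, (Polynomial.C ((1 / 2 + j : ℚ) ^ 2) - Polynomial.X)) *
      ∏ j ∈ Ico k M, (Polynomial.C ((j + 1 : ℚ) ^ 2) - Polynomial.C (1 / 4) * Polynomial.X))

lemma natDegree_quadPoly_le (M : ℕ) (Y : ℚ) : (quadPoly M Y).natDegree ≤ M := by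
  refine Polynomial.natDegree_sum_le_of_forall_le _ _ fun k hk ↦ ?_
  refine (Polynomial.natDegree_C_mul_le _ _).trans (Polynomial.natDegree_mul_le.trans ?_)
  have h1 : (∏ j ∈ range k,
      (Polynomial.C ((1 / 2 + j : ℚ) ^ 2) - Polynomial.X)).natDegree ≤ k := by
    refine (Polynomial.natDegree_prod_le _ _).trans ?_
    refine (sum_le_card_nsmul _ _ 1 fun j _ ↦ ?_).trans (by simp)
    compute_degree
  have h2 : (∏ j ∈ Ico k M, (Polynomial.C ((j + 1 : ℚ) ^ 2) -
      Polynomial.C (1 / 4) * Polynomial.X)).natDegree ≤ M - k := by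
    refine (Polynomial.natDegree_prod_le _ _).trans ?_
    refine (sum_le_card_nsmul _ _ 1 fun j _ ↦ ?_).trans (by simp)
    compute_degree
  have := mem_range.1 hk
  omega

lemma eval_quadPoly {M : ℕ} {x : ℚ} (Y : ℚ) (hx : ∀ j : ℕ, ((j : ℚ) + 1) ^ 2 - x / 4 ≠ 0) :
    (quadPoly M Y).eval x =
      (∏ j ∈ range M, (((j : ℚ) + 1) ^ 2 - x / 4)) * ∑ k ∈ range (M + 1), quadTerm x Y k := by
  rw [quadPoly, Polynomial.eval_finsetSum, mul_sum]
  refine sum_congr rfl fun k hk ↦ ?_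
  have hkM : k ≤ M := by have := mem_range.1 hk; omega
  have h0 : ∏ j ∈ range k, (((j : ℚ) + 1) ^ 2 - x / 4) ≠ 0 := prod_ne_zero_iff.2 fun j _ ↦ hx j
  rw [← prod_range_mul_prod_Ico _ hkM, quadTerm]
  simp only [Polynomial.eval_mul, Polynomial.eval_C, Polynomial.eval_prod, Polynomial.eval_sub,
    Polynomial.eval_X]
  have h1 : (∏ j ∈ range k,
      ((1 / 2 + j) * ((1 / 2 + j) ^ 2 - x) * ((1 / 4 + j) ^ 2 - Y / 4) /
        ((j + 1) * ((j + 1) ^ 2 - x / 4) * ((j + 1) ^ 2 - Y)))) *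
      ∏ j ∈ range k, (((j : ℚ) + 1) ^ 2 - x / 4) =
      (∏ j ∈ range k, ((1 / 2 + j) * ((1 / 4 + j) ^ 2 - Y / 4) / ((j + 1) * ((j + 1) ^ 2 - Y)))) *
        ∏ j ∈ range k, ((1 / 2 + j : ℚ) ^ 2 - x) := by
    rw [← prod_mul_distrib, ← prod_mul_distrib]
    refine prod_congr rfl fun j _ ↦ ?_
    have ha := hx j
    generalize ((j : ℚ) + 1) ^ 2 - x / 4 = a at ha ⊢
    generalize ((j : ℚ) + 1) ^ 2 - Y = b
    field_simp
  have h2 : ∏ j ∈ Ico k M, (((j : ℚ) + 1) ^ 2 - 1 / 4 * x) =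
      ∏ j ∈ Ico k M, (((j : ℚ) + 1) ^ 2 - x / 4) :=
    prod_congr rfl fun j _ ↦ by ring
  rw [h2]
  linear_combination (-(6 * (k : ℚ) + 1) * ∏ j ∈ Ico k M, (((j : ℚ) + 1) ^ 2 - x / 4)) * h1

/-- The coefficients in the Lagrange interpolation of the truncated series from its values at
`X = (i + 1/2)^2`, `i ≤ M`, to its value at `X = 0`. -/
def interpCoeff (M i : ℕ) : ℚ :=
  (∏ j ∈ range M, (1 - ((2 * i + 1 : ℕ) / (4 * (j + 1) : ℕ) : ℚ) ^ 2)) *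
    ∏ j ∈ (range (M + 1)).erase i,
      (1 - ((2 * i + 1 : ℕ) / (2 * j + 1 : ℕ) : ℚ) ^ 2)⁻¹

lemma sum_quadTerm_zero_eq (M : ℕ) (Y : ℚ) :
    ∑ k ∈ range (M + 1), quadTerm 0 Y k =
      ∑ i ∈ range (M + 1),
        interpCoeff M i * ∑ k ∈ range (M + 1), quadTerm ((i + 1 / 2) ^ 2) Y k := by
  have hinj : Set.InjOn (fun i : ℕ ↦ ((i : ℚ) + 1 / 2) ^ 2) (range (M + 1)) := by
    intro a _ b _ h
    have h' : (a : ℚ) + 1 / 2 = b + 1 / 2 :=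
      (pow_left_inj₀ (by positivity) (by positivity) two_ne_zero).1 h
    exact_mod_cast add_right_cancel h'
  have hdeg : (quadPoly M Y).degree < #(range (M + 1)) := by
    rw [card_range]
    exact (Polynomial.degree_le_of_natDegree_le (natDegree_quadPoly_le M Y)).trans_lt
      (by exact_mod_cast Nat.lt_succ_self M)
  have h := congrArg (Polynomial.eval 0) (Lagrange.eq_interpolate hinj hdeg)
  rw [eval_quadPoly Y fun j ↦ by rw [zero_div, sub_zero]; positivity, Lagrange.interpolate_apply,
    Polynomial.eval_finsetSum] at h
  have hD : ∏ j ∈ range M, (((j : ℚ) + 1) ^ 2 - 0 / 4) ≠ 0 :=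
    prod_ne_zero_iff.2 fun j _ ↦ by rw [zero_div, sub_zero]; positivity
  refine mul_left_cancel₀ hD (h.trans ?_)
  rw [mul_sum]
  refine sum_congr rfl fun i _ ↦ ?_
  rw [Polynomial.eval_mul, Polynomial.eval_C, eval_quadPoly Y fun j ↦ sq_sub_half_sq_ne_zero j i,
    Lagrange.basis, Polynomial.eval_prod, interpCoeff]
  have h1 : ∏ j ∈ range M, (((j : ℚ) + 1) ^ 2 - ((i : ℚ) + 1 / 2) ^ 2 / 4) =
      (∏ j ∈ range M, (((j : ℚ) + 1) ^ 2 - 0 / 4)) *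
        ∏ j ∈ range M, (1 - ((2 * i + 1 : ℕ) / (4 * (j + 1) : ℕ) : ℚ) ^ 2) := by
    rw [← prod_mul_distrib]
    refine prod_congr rfl fun j _ ↦ ?_
    push_cast
    field_simp
    ring
  have h2 : ∏ j ∈ (range (M + 1)).erase i,
      (Lagrange.basisDivisor (((i : ℚ) + 1 / 2) ^ 2) (((j : ℚ) + 1 / 2) ^ 2)).eval 0 =
      ∏ j ∈ (range (M + 1)).erase i,
        (1 - ((2 * i + 1 : ℕ) / (2 * j + 1 : ℕ) : ℚ) ^ 2)⁻¹ := by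
    refine prod_congr rfl fun j hj ↦ ?_
    rw [Lagrange.basisDivisor]
    simp only [Polynomial.eval_mul, Polynomial.eval_C, Polynomial.eval_sub, Polynomial.eval_X]
    have e : (1 - ((2 * i + 1 : ℕ) / (2 * j + 1 : ℕ) : ℚ) ^ 2) =
      (((i : ℚ) + 1 / 2) ^ 2 - ((j : ℚ) + 1 / 2) ^ 2) * (0 - ((j : ℚ) + 1 / 2) ^ 2)⁻¹ := by
      have : (0 - ((j : ℚ) + 1 / 2) ^ 2) ≠ 0 := by
        rw [zero_sub]; exact neg_ne_zero.2 (by positivity)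
      push_cast
      field_simp
      ring
    rw [e, mul_inv, inv_inv]
  rw [h1, h2]
  ring

section Nonarchimedean

variable {p : ℕ} [Fact p.Prime]

lemma padicNorm_pow (x : ℚ) (k : ℕ) : padicNorm p (x ^ k) = padicNorm p x ^ k :=
  IsAbsoluteValue.abv_pow (padicNorm p) x k

lemma padicNorm_sub_le {x y δ : ℚ} (hx : padicNorm p x ≤ δ) (hy : padicNorm p y ≤ δ) :
    padicNorm p (x - y) ≤ δ :=
  padicNorm.sub.trans (max_le hx hy)

lemma padicNorm_add_le {x y δ : ℚ} (hx : padicNorm p x ≤ δ) (hy : padicNorm p y ≤ δ) :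
    padicNorm p (x + y) ≤ δ :=
  padicNorm.nonarchimedean.trans (max_le hx hy)

lemma padicNorm_mul_le {x y δ ε : ℚ} (hx : padicNorm p x ≤ δ) (hy : padicNorm p y ≤ ε) :
    padicNorm p (x * y) ≤ δ * ε := by
  rw [padicNorm.mul]
  exact mul_le_mul hx hy (padicNorm.nonneg _) ((padicNorm.nonneg _).trans hx)

lemma padicNorm_eq_one_of_sub_one_le {x δ : ℚ} (hδ : δ < 1) (hx : padicNorm p (x - 1) ≤ δ) :
    padicNorm p x = 1 := by
  have h : padicNorm p (x - 1) ≠ padicNorm p 1 := by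
    rw [padicNorm.one]
    exact (hx.trans_lt hδ).ne
  have := padicNorm.add_eq_max_of_ne h
  rw [sub_add_cancel, padicNorm.one, max_eq_right (hx.trans hδ.le)] at this
  exact this

lemma padicNorm_mul_sub_one_le {x y δ : ℚ} (hδ : δ < 1) (hx : padicNorm p (x - 1) ≤ δ)
    (hy : padicNorm p (y - 1) ≤ δ) : padicNorm p (x * y - 1) ≤ δ := by
  rw [show x * y - 1 = x * (y - 1) + (x - 1) by ring]
  refine padicNorm_add_le ?_ hx
  rwa [padicNorm.mul, padicNorm_eq_one_of_sub_one_le hδ hx, one_mul]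

lemma padicNorm_prod_sub_one_le {ι : Type*} {s : Finset ι} {g : ι → ℚ} {δ : ℚ} (hδ0 : 0 ≤ δ)
    (hδ : δ < 1) (hg : ∀ j ∈ s, padicNorm p (g j - 1) ≤ δ) :
    padicNorm p (∏ j ∈ s, g j - 1) ≤ δ := by
  refine prod_induction g (fun x ↦ padicNorm p (x - 1) ≤ δ)
    (fun a b ha hb ↦ padicNorm_mul_sub_one_le hδ ha hb) ?_ hg
  simpa using hδ0

lemma padicNorm_inv_sub_one_le {x δ : ℚ} (hδ : δ < 1) (hx : padicNorm p (x - 1) ≤ δ) :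
    padicNorm p (x⁻¹ - 1) ≤ δ := by
  have h1 := padicNorm_eq_one_of_sub_one_le hδ hx
  have h0 : x ≠ 0 := fun h ↦ by simp [h] at h1
  rw [show x⁻¹ - 1 = -((x - 1) / x) by field_simp; ring, padicNorm.neg, padicNorm.div, h1, div_one]
  exact hx

lemma padicNorm_one_sub_div_sub_one_le {e f δ : ℚ} (hδ : δ < 1) (he : padicNorm p e ≤ δ)
    (hf : padicNorm p f ≤ δ) :
    padicNorm p ((1 - e) / (1 - f) - 1) ≤ δ ∧
      padicNorm p ((1 - e) / (1 - f) - 1 + (e - f)) ≤ δ ^ 2 := by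
  have h1 : padicNorm p (1 - f) = 1 :=
    padicNorm_eq_one_of_sub_one_le hδ (by rwa [sub_sub_cancel_left, padicNorm.neg])
  have h0 : 1 - f ≠ 0 := fun h ↦ by simp [h] at h1
  constructor
  · rw [show (1 - e) / (1 - f) - 1 = (f - e) / (1 - f) by field_simp; ring, padicNorm.div, h1,
      div_one]
    exact padicNorm_sub_le hf he
  · rw [show (1 - e) / (1 - f) - 1 + (e - f) = f * (f - e) / (1 - f) by field_simp; ring,
      padicNorm.div, h1, div_one, sq]
    exact padicNorm_mul_le hf (padicNorm_sub_le hf he)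

lemma padicNorm_prod_ratio_le {e f : ℕ → ℚ} {δ : ℚ} {l : ℕ} (hδ0 : 0 ≤ δ) (hδ : δ < 1)
    (he : ∀ j < l, padicNorm p (e j) ≤ δ) (hf : ∀ j < l, padicNorm p (f j) ≤ δ) :
    padicNorm p (∏ j ∈ range l, (1 - e j) / (1 - f j) - 1) ≤ δ ∧
      padicNorm p (∏ j ∈ range l, (1 - e j) / (1 - f j) - 1 + ∑ j ∈ range l, (e j - f j)) ≤
        δ ^ 2 := by
  refine ⟨padicNorm_prod_sub_one_le hδ0 hδ fun j hj ↦
    (padicNorm_one_sub_div_sub_one_le hδ (he j (mem_range.1 hj)) (hf j (mem_range.1 hj))).1, ?_⟩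
  induction l with
  | zero => simpa using sq_nonneg δ
  | succ l ih =>
    have h1 := padicNorm_one_sub_div_sub_one_le hδ (he l l.lt_succ_self) (hf l l.lt_succ_self)
    have h2 := ih (fun j hj ↦ he j (hj.trans l.lt_succ_self))
      fun j hj ↦ hf j (hj.trans l.lt_succ_self)
    have h3 := padicNorm_prod_sub_one_le hδ0 hδ fun j (hj : j ∈ range l) ↦
      (padicNorm_one_sub_div_sub_one_le hδ (he j ((mem_range.1 hj).trans l.lt_succ_self))
        (hf j ((mem_range.1 hj).trans l.lt_succ_self))).1
    rw [prod_range_succ, sum_range_succ]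
    generalize ∏ j ∈ range l, (1 - e j) / (1 - f j) = P at *
    generalize ∑ j ∈ range l, (e j - f j) = S at *
    generalize (1 - e l) / (1 - f l) = g at *
    rw [show P * g - 1 + (S + (e l - f l)) =
      (P - 1) * (g - 1) + ((P - 1 + S) + (g - 1 + (e l - f l))) by ring]
    exact padicNorm_add_le (sq δ ▸ padicNorm_mul_le h3 h1.1) (padicNorm_add_le h2 h1.2)

lemma padicNorm_pow_div_le {r c : ℕ} (hc : 0 < c) (hcr : c < p ^ r) :
    padicNorm p ((p ^ r : ℕ) / (c : ℚ)) ≤ (p : ℚ)⁻¹ := by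
  have hp := (Fact.out : p.Prime)
  have hp0 : (0 : ℚ) < p := by exact_mod_cast hp.pos
  have hv : padicValNat p c < r :=
    (Nat.pow_lt_pow_iff_right hp.one_lt).1
      ((Nat.le_of_dvd hc pow_padicValNat_dvd).trans_lt hcr)
  have h0 : ((p ^ r : ℕ) / (c : ℚ)) ≠ 0 := by have := hp.pos; positivity
  rw [padicNorm.eq_zpow_of_nonzero h0, ← zpow_neg_one]
  refine zpow_le_zpow_right₀ (by exact_mod_cast hp.one_lt.le) ?_
  rw [padicValRat.div (by have := hp.pos; positivity) (by positivity), padicValRat.of_nat,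
    padicValRat.of_nat, padicValNat.prime_pow]
  omega

lemma padicNorm_pow_div_sq_le {r c : ℕ} (hc : 0 < c) (hcr : c < p ^ r) :
    padicNorm p (((p ^ r : ℕ) / (c : ℚ)) ^ 2) ≤ (p : ℚ)⁻¹ ^ 2 := by
  rw [sq, sq]
  exact padicNorm_mul_le (padicNorm_pow_div_le hc hcr) (padicNorm_pow_div_le hc hcr)

lemma padicNorm_pow_mul_beta_le {r : ℕ} (b : ℕ) : ∀ {a : ℕ}, a + b + 1 < p ^ r →
    padicNorm p ((p ^ r : ℕ) * ((a.factorial * b.factorial : ℚ) / (a + b + 1).factorial)) ≤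
      (p : ℚ)⁻¹ := by
  induction b with
  | zero =>
    intro a h
    convert padicNorm_pow_div_le (Nat.succ_pos a) h using 2
    rw [add_zero, Nat.factorial_succ]
    push_cast
    field_simp
    simp
  | succ b ih =>
    intro a h
    have h1 := ih (a := a) (by omega)
    have h2 := ih (a := a + 1) (by omega)
    convert padicNorm_sub_le h1 h2 using 2
    rw [← mul_sub]
    congr 1
    rw [show a + 1 + b + 1 = a + b + 1 + 1 by ring, show a + (b + 1) + 1 = a + b + 1 + 1 by ring,
      Nat.factorial_succ (a + b + 1), Nat.factorial_succ a, Nat.factorial_succ b]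
    push_cast
    field_simp
    ring

lemma padicNorm_two (hp : Odd p) : padicNorm p 2 = 1 := by
  have h := (padicNorm.nat_eq_one_iff (p := p) 2).2 fun h ↦ by
    have := (Nat.prime_dvd_prime_iff_eq Fact.out Nat.prime_two).1 h
    rw [this] at hp
    exact absurd hp (by decide)
  exact_mod_cast h

lemma padicNorm_four (hp : Odd p) : padicNorm p 4 = 1 := by
  rw [show (4 : ℚ) = 2 * 2 by norm_num, padicNorm.mul, padicNorm_two hp, one_mul]

lemma padicNorm_prod_four_mul_add_le (hp : Odd p) (n : ℕ) (c : ℤ) :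
    padicNorm p ((∏ t ∈ range n, (4 * t + c) : ℤ) : ℚ) ≤ padicNorm p (n.factorial : ℚ) := by
  have h0 : (n.factorial : ℚ) ≠ 0 := by exact_mod_cast n.factorial_ne_zero
  set v := padicValNat p n.factorial
  rw [padicNorm.eq_zpow_of_nonzero h0, padicValRat.of_nat, ← padicNorm.dvd_iff_norm_le]
  have hcop : IsCoprime (4 : ℤ) ((p ^ v : ℕ) : ℤ) := by
    rw [show (4 : ℤ) = (4 : ℕ) by rfl, Nat.isCoprime_iff_coprime]
    exact Nat.Coprime.pow_right _ (Nat.Coprime.pow_left 2 hp.coprime_two_left)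
  obtain ⟨a, b, hab⟩ := hcop
  have hmod : ∏ t ∈ range n, (4 * t + c) ≡ ∏ t ∈ range n, (4 * (a * c + t)) [ZMOD (p ^ v : ℕ)] := by
    refine Int.ModEq.prod fun t _ ↦ ?_
    refine Int.modEq_iff_dvd.2 ⟨-(b * c), ?_⟩
    linear_combination c * hab
  refine (Int.ModEq.dvd_iff hmod).2 ?_
  rw [prod_mul_distrib]
  refine Dvd.dvd.mul_left (dvd_trans ?_ (Nat.factorial_coe_dvd_prod n (a * c))) _
  exact_mod_cast pow_padicValNat_dvd

end Nonarchimedean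

lemma prod_range_sq_sub_sq_mul (i : ℕ) :
    (∏ j ∈ range i, (((2 * j + 1 : ℕ) : ℚ) ^ 2 - (2 * i + 1 : ℕ) ^ 2)) * (2 * i + 1 : ℕ) =
      (-1) ^ i * 4 ^ i * (2 * i + 1).factorial := by
  have h1 : ∏ j ∈ range i, ((i : ℚ) - j) = i.factorial := by
    rw [← prod_range_reflect, ← prod_range_add_one_eq_factorial, Nat.cast_prod]
    refine prod_congr rfl fun j hj ↦ ?_
    have hj := mem_range.1 hj
    rw [show i - 1 - j = i - (j + 1) by omega, Nat.cast_sub hj]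
    push_cast
    ring
  have h2 : (∏ j ∈ range i, ((i : ℚ) + j + 1)) * i.factorial = (2 * i).factorial := by
    rw [two_mul, ← Nat.factorial_mul_ascFactorial, Nat.ascFactorial_eq_prod_range]
    push_cast
    rw [mul_comm]
    congr 1
    exact prod_congr rfl fun j _ ↦ by ring
  have h3 : ∏ j ∈ range i, (((2 * j + 1 : ℕ) : ℚ) ^ 2 - (2 * i + 1 : ℕ) ^ 2) =
      (-1) ^ i * 4 ^ i * ((∏ j ∈ range i, ((i : ℚ) - j)) * ∏ j ∈ range i, ((i : ℚ) + j + 1)) := by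
    rw [← prod_mul_distrib, ← mul_pow, pow_eq_prod_const (-1 * 4 : ℚ), ← prod_mul_distrib]
    refine prod_congr rfl fun j _ ↦ ?_
    push_cast
    ring
  rw [h3, h1, Nat.factorial_succ, Nat.cast_mul, ← h2]
  push_cast
  ring

lemma prod_erase_sq_sub_sq_mul (i d : ℕ) :
    (∏ j ∈ (range (i + d + 1)).erase i, (((2 * j + 1 : ℕ) : ℚ) ^ 2 - (2 * i + 1 : ℕ) ^ 2)) *
      (2 * i + 1 : ℕ) =
      (-1) ^ i * 4 ^ (i + d) * (d.factorial * (2 * i + d + 1).factorial) := by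
  induction d with
  | zero =>
    rw [add_zero, range_add_one, erase_insert notMem_range_self, prod_range_sq_sub_sq_mul]
    simp
  | succ d ih =>
    rw [range_add_one, erase_insert_of_ne (by omega), prod_insert (by simp), mul_assoc,
      ← add_assoc, ih, Nat.factorial_succ d, ← add_assoc (2 * i) d 1,
      Nat.factorial_succ (2 * i + d + 1)]
    push_cast
    ring

lemma prod_odd_mul_factorial (M : ℕ) :
    (∏ j ∈ range (M + 1), ((2 * j + 1 : ℕ) : ℚ)) * (2 ^ M * M.factorial) =
      (2 * M + 1).factorial := by
  induction M with
  | zero => simp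
  | succ M ih =>
    rw [prod_range_succ, show 2 * (M + 1) + 1 = 2 * M + 1 + 1 + 1 by ring,
      Nat.factorial_succ (2 * M + 1 + 1), Nat.factorial_succ (2 * M + 1), Nat.cast_mul,
      Nat.cast_mul, ← ih, Nat.factorial_succ M]
    push_cast
    ring

lemma prod_four_mul_sub (M : ℕ) (m : ℚ) :
    ∏ t ∈ range (2 * M + 1), (4 * (t : ℚ) + (-4 * M - m)) =
      -m * ∏ j ∈ range M, (m ^ 2 - (4 * (j + 1)) ^ 2) := by
  induction M with
  | zero => simp
  | succ M ih =>
    rw [prod_range_succ (fun j : ℕ ↦ (m ^ 2 - (4 * ((j : ℚ) + 1)) ^ 2)), ← mul_assoc, ← ih,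
      show 2 * (M + 1) + 1 = 2 * M + 1 + 1 + 1 by ring, prod_range_succ, prod_range_succ']
    have : ∀ t ∈ range (2 * M + 1), (4 * ((t + 1 : ℕ) : ℚ) + (-4 * (M + 1 : ℕ) - m)) =
        4 * (t : ℚ) + (-4 * M - m) := fun t _ ↦ by push_cast; ring
    rw [prod_congr rfl this]
    push_cast
    ring

lemma interpCoeff_mul_eq (i d : ℕ) :
    interpCoeff (i + d) i * (4 ^ (4 * (i + d)) * ((i + d).factorial : ℚ) ^ 4 *
      (2 * i + 1 : ℕ) ^ 2 * (d.factorial * (2 * i + d + 1).factorial)) =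
      (-1) ^ (d + 1) * (∏ t ∈ range (2 * (i + d) + 1),
        (4 * (t : ℚ) + (-4 * (i + d : ℕ) - (2 * i + 1 : ℕ)))) *
        ((2 * (i + d) + 1).factorial : ℚ) ^ 2 := by
  have ha := prod_erase_sq_sub_sq_mul i d
  have hb := prod_odd_mul_factorial (i + d)
  rw [← mul_prod_erase _ _ (mem_range.2 (show i < i + d + 1 by omega))] at hb
  rw [prod_four_mul_sub]
  have hC : (∏ j ∈ range (i + d), (1 - ((2 * i + 1 : ℕ) / (4 * (j + 1) : ℕ) : ℚ) ^ 2)) *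
      (4 ^ (2 * (i + d)) * ((i + d).factorial : ℚ) ^ 2) =
      (-1) ^ (i + d) * ∏ j ∈ range (i + d), (((2 * i + 1 : ℕ) : ℚ) ^ 2 - (4 * (j + 1)) ^ 2) := by
    rw [← prod_range_add_one_eq_factorial, Nat.cast_prod, ← prod_pow, pow_mul]
    rw [pow_eq_prod_const (_ ^ 2), pow_eq_prod_const (-1 : ℚ), ← prod_mul_distrib,
      ← prod_mul_distrib, ← prod_mul_distrib]
    refine prod_congr rfl fun j _ ↦ ?_
    push_cast
    field_simp
    ring
  have hD : (∏ j ∈ (range (i + d + 1)).erase i,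
      (1 - ((2 * i + 1 : ℕ) / (2 * j + 1 : ℕ) : ℚ) ^ 2)⁻¹) *
      (∏ j ∈ (range (i + d + 1)).erase i, (((2 * j + 1 : ℕ) : ℚ) ^ 2 - (2 * i + 1 : ℕ) ^ 2)) =
      (∏ j ∈ (range (i + d + 1)).erase i, ((2 * j + 1 : ℕ) : ℚ)) ^ 2 := by
    rw [← prod_mul_distrib, ← prod_pow]
    refine prod_congr rfl fun j hj ↦ ?_
    have hne : ((2 * j + 1 : ℕ) : ℚ) ^ 2 - (2 * i + 1 : ℕ) ^ 2 ≠ 0 := by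
      rw [sub_ne_zero, Ne, sq_eq_sq₀ (by positivity) (by positivity), Nat.cast_inj]
      have := (mem_erase.1 hj).1
      omega
    have h0 : ((2 * j + 1 : ℕ) : ℚ) ≠ 0 := by positivity
    generalize ((2 * j + 1 : ℕ) : ℚ) = u at *
    generalize ((2 * i + 1 : ℕ) : ℚ) = v at *
    rw [div_pow, one_sub_div (pow_ne_zero 2 h0), inv_div, div_mul_cancel₀ _ hne]
  rw [interpCoeff]
  have hpow : ((-1 : ℚ) ^ i) ^ 2 = 1 := by rw [← pow_mul, mul_comm, pow_mul]; simp
  rw [pow_succ (-1 : ℚ) d]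
  rw [pow_add (-1 : ℚ) i d] at hC
  rw [show 4 * (i + d) = 2 * (i + d) + (i + d) + (i + d) by ring, pow_add, pow_add]
  have h4 : (4 : ℚ) ^ (i + d) = (2 ^ (i + d)) ^ 2 := by rw [← pow_mul, mul_comm, pow_mul]; norm_num
  generalize ∏ j ∈ (range (i + d + 1)).erase i,
    (((2 * j + 1 : ℕ) : ℚ) ^ 2 - (2 * i + 1 : ℕ) ^ 2) = E at *
  generalize ∏ j ∈ (range (i + d + 1)).erase i, ((2 * j + 1 : ℕ) : ℚ) = O at *
  generalize ∏ j ∈ (range (i + d + 1)).erase i,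
    (1 - ((2 * i + 1 : ℕ) / (2 * j + 1 : ℕ) : ℚ) ^ 2)⁻¹ = D at *
  generalize ∏ j ∈ range (i + d), (1 - ((2 * i + 1 : ℕ) / (4 * (j + 1) : ℕ) : ℚ) ^ 2) = C at *
  generalize ∏ j ∈ range (i + d), (((2 * i + 1 : ℕ) : ℚ) ^ 2 - (4 * (j + 1)) ^ 2) = B at *
  generalize (((2 * (i + d) + 1).factorial : ℕ) : ℚ) = n at *
  generalize ((d.factorial : ℚ) * ((2 * i + d + 1).factorial : ℚ)) = f at *
  generalize (((i + d).factorial : ℕ) : ℚ) = w at *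
  generalize ((2 * i + 1 : ℕ) : ℚ) = m at *
  generalize (-1 : ℚ) ^ i = s at *
  generalize (-1 : ℚ) ^ d = s' at *
  generalize (4 : ℚ) ^ (2 * (i + d)) = g at *
  rw [h4] at ha ⊢
  generalize (2 : ℚ) ^ (i + d) = h at *
  rw [← hb]
  calc C * D * (g * h ^ 2 * h ^ 2 * w ^ 4 * m ^ 2 * f)
      = (C * (g * w ^ 2)) * D * (s * (s * h ^ 2 * f)) * (h ^ 2 * w ^ 2 * m ^ 2) := by
        linear_combination (-(C * D * (g * h ^ 2 * h ^ 2 * w ^ 4 * m ^ 2 * f))) * hpow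
    _ = s ^ 2 * s' * B * (D * E) * m * (h ^ 2 * w ^ 2 * m ^ 2) := by rw [hC, ← ha]; ring
    _ = _ := by rw [hpow, hD]; ring

section InterpCoeff

variable {p : ℕ} [Fact p.Prime]

lemma padicNorm_natCast_pos {a : ℕ} (ha : a ≠ 0) : 0 < padicNorm p (a : ℚ) :=
  (padicNorm.nonneg _).lt_of_ne' (padicNorm.nonzero (Nat.cast_ne_zero.2 ha))

lemma padicNorm_factorial_le (M : ℕ) :
    padicNorm p ((2 * M + 1).factorial : ℚ) ≤
      padicNorm p (2 * M + 1 : ℕ) * padicNorm p (M.factorial : ℚ) ^ 2 := by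
  have h := Nat.add_choose_mul_factorial_mul_factorial M M
  rw [Nat.factorial_succ, two_mul, ← h, Nat.cast_mul, padicNorm.mul, Nat.cast_mul, Nat.cast_mul,
    padicNorm.mul, padicNorm.mul, mul_assoc, ← sq]
  refine mul_le_mul_of_nonneg_left ?_ (padicNorm.nonneg _)
  exact mul_le_of_le_one_left (sq_nonneg _) (padicNorm.of_nat _)

lemma padicNorm_choose_mul_le {n d : ℕ} (hd : 0 < d) (hdn : d ≤ n) :
    padicNorm p (n.choose d : ℚ) * padicNorm p (d : ℚ) ≤ padicNorm p (n : ℚ) := by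
  obtain ⟨d, rfl⟩ := Nat.exists_eq_succ_of_ne_zero hd.ne'
  obtain ⟨n, rfl⟩ := Nat.exists_eq_succ_of_ne_zero (hd.trans_le hdn).ne'
  have h := Nat.add_one_mul_choose_eq n d
  rw [← padicNorm.mul, ← Nat.cast_mul, Nat.succ_eq_add_one, Nat.succ_eq_add_one, ← h, Nat.cast_mul,
    padicNorm.mul]
  exact mul_le_of_le_one_right (padicNorm.nonneg _) (padicNorm.of_nat _)

lemma padicNorm_interpCoeff_mul_le (hp : Odd p) {r i d : ℕ} (h : 2 * (i + d) + 1 = p ^ r)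
    (hd : 0 < d) :
    padicNorm p (interpCoeff (i + d) i) * padicNorm p (2 * i + 1 : ℕ) ≤
      padicNorm p (p ^ r : ℕ) * (p : ℚ)⁻¹ ^ 2 := by
  have hlt : padicNorm p (p ^ r : ℕ) ≤ (p : ℚ)⁻¹ * padicNorm p (2 * i + 1 : ℕ) := by
    have h1 := padicNorm_pow_div_le (p := p) (r := r) (c := 2 * i + 1) (by omega) (by omega)
    rwa [padicNorm.div, div_le_iff₀ (padicNorm_natCast_pos (by omega))] at h1
  have hμ : 0 < padicNorm p (2 * i + 1 : ℕ) := padicNorm_natCast_pos (by omega)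
  have hp1 : (p : ℚ)⁻¹ < 1 := inv_lt_one_of_one_lt₀ (by exact_mod_cast (Fact.out : p.Prime).one_lt)
  have hμd : padicNorm p (2 * i + 1 : ℕ) ≤ padicNorm p (d : ℚ) := by
    have h1 : padicNorm p (2 * i + 1 : ℕ) ≤ max (padicNorm p (p ^ r : ℕ)) (padicNorm p (d : ℚ)) := by
      have h2 : ((2 * i + 1 : ℕ) : ℚ) = (p ^ r : ℕ) - 2 * d := by rw [← h]; push_cast; ring
      rw [h2]
      refine padicNorm.sub.trans_eq ?_
      rw [padicNorm.mul, padicNorm_two hp, one_mul]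
    refine (le_max_iff.1 h1).resolve_left (not_le.2 (hlt.trans_lt ?_))
    exact mul_lt_of_lt_one_left hμ hp1
  have hB := padicNorm_prod_four_mul_add_le hp (2 * (i + d) + 1)
    (-4 * (i + d : ℕ) - (2 * i + 1 : ℕ))
  have hF := padicNorm_factorial_le (p := p) (i + d)
  have hc := padicNorm_choose_mul_le (p := p) hd (show d ≤ 2 * (i + d) + 1 by omega)
  have hcF : padicNorm p (((2 * (i + d) + 1).factorial : ℕ) : ℚ) =
      padicNorm p ((2 * (i + d) + 1).choose d : ℕ) *
        padicNorm p (d.factorial * (2 * i + d + 1).factorial) := by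
    rw [← Nat.choose_mul_factorial_mul_factorial (show d ≤ 2 * (i + d) + 1 by omega),
      show 2 * (i + d) + 1 - d = 2 * i + d + 1 by omega, ← padicNorm.mul]
    push_cast
    ring_nf
  have hL := congrArg (padicNorm p) (interpCoeff_mul_eq i d)
  have hF0 : 0 < padicNorm p (((2 * (i + d) + 1).factorial : ℕ) : ℚ) :=
    padicNorm_natCast_pos (Nat.factorial_ne_zero _)
  have hw : 0 < padicNorm p (((i + d).factorial : ℕ) : ℚ) :=
    padicNorm_natCast_pos (Nat.factorial_ne_zero _)
  have hL0 := padicNorm.nonneg (p := p) (interpCoeff (i + d) i)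
  have hN0 := padicNorm.nonneg (p := p) (p ^ r : ℕ)
  have hc0 := padicNorm.nonneg (p := p) ((2 * (i + d) + 1).choose d : ℕ)
  push_cast at hB hL
  rw [h] at *
  simp only [padicNorm.mul, padicNorm_pow, padicNorm_four hp, padicNorm.neg, padicNorm.one, one_pow,
    one_mul] at hL hcF
  rw [show 2 * (i : ℚ) + 1 = (2 * i + 1 : ℕ) by push_cast; rfl] at hL hB
  generalize padicNorm p (∏ x ∈ range (p ^ r), _) = B at *
  generalize padicNorm p (d.factorial : ℚ) * padicNorm p ((2 * i + d + 1).factorial : ℚ) = f at *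
  generalize padicNorm p ((p ^ r).factorial : ℚ) = F at *
  generalize padicNorm p ((i + d).factorial : ℚ) = w at *
  generalize padicNorm p ((p ^ r).choose d : ℚ) = c at *
  generalize padicNorm p (p ^ r : ℕ) = N at *
  generalize padicNorm p (2 * i + 1 : ℕ) = m at *
  generalize padicNorm p (interpCoeff (i + d) i) = L at *
  generalize (p : ℚ)⁻¹ = q at *
  have h1 : L * (w ^ 4 * m ^ 2) ≤ c * (N ^ 2 * w ^ 4) := by
    refine le_of_mul_le_mul_right ?_ hF0
    calc L * (w ^ 4 * m ^ 2) * F = c * (B * F ^ 2) := by rw [← hL, hcF]; ring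
      _ ≤ c * (F * (N * w ^ 2) ^ 2) := by gcongr
      _ = _ := by ring
  have h2 : L * m ^ 2 ≤ c * N ^ 2 :=
    le_of_mul_le_mul_right (by linarith) (pow_pos hw 4)
  refine le_of_mul_le_mul_right ?_ (pow_pos hμ 2)
  calc L * m * m ^ 2 = L * m ^ 2 * m := by ring
    _ ≤ c * N ^ 2 * m := by gcongr
    _ = c * m * N ^ 2 := by ring
    _ ≤ N * (q * m) ^ 2 := by
      gcongr
      exact (mul_le_mul_of_nonneg_left hμd hc0).trans hc
    _ = _ := by ring

end InterpCoeff

lemma sq_sub_div_sq_sub {a b : ℚ} (x : ℚ) (ha : a ≠ 0) (hb : b ≠ 0) :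
    (a ^ 2 - (x / 2) ^ 2) / (b ^ 2 - (x / 2) ^ 2) =
      (a / b) ^ 2 * ((1 - (x / (2 * a)) ^ 2) / (1 - (x / (2 * b)) ^ 2)) := by
  have h {c : ℚ} (hc : c ≠ 0) : c ^ 2 - (x / 2) ^ 2 = c ^ 2 * (1 - (x / (2 * c)) ^ 2) := by
    field_simp
  rw [h ha, h hb, mul_div_mul_comm, div_pow a b]

lemma sq_sub_half_natCast_sq_ne_zero {n : ℕ} (hn : Odd n) (j : ℕ) :
    ((j : ℚ) + 1) ^ 2 - (n / 2) ^ 2 ≠ 0 := by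
  rw [sub_ne_zero, Ne, sq_eq_sq₀ (by positivity) (by positivity), eq_div_iff two_ne_zero]
  intro h
  have h' : (j + 1) * 2 = n := by exact_mod_cast h
  obtain ⟨k, rfl⟩ := hn
  omega

lemma prod_odd_div_even_mul_pow (l : ℕ) :
    (∏ j ∈ range l, ((2 * j + 1) / (2 * j + 2) : ℚ)) * 4 ^ l = l.centralBinom := by
  induction l with
  | zero => simp
  | succ l ih =>
    have h : ((l + 1 : ℕ) * (l + 1).centralBinom : ℚ) = (2 * (2 * l + 1) * l.centralBinom : ℕ) := by
      exact_mod_cast Nat.succ_mul_centralBinom_succ l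
    have h0 : ((l + 1 : ℕ) : ℚ) ≠ 0 := by positivity
    rw [← mul_right_inj' h0, h, Nat.cast_mul, ← ih, prod_range_succ]
    push_cast
    field_simp
    ring

lemma prod_even_div_odd_eq (l : ℕ) :
    ∏ j ∈ range l, ((2 * j + 2) / (2 * j + 3) : ℚ) =
      4 ^ l * ((l.factorial * l.factorial : ℚ) / (l + l + 1).factorial) := by
  induction l with
  | zero => simp
  | succ l ih =>
    rw [prod_range_succ, ih, show l + 1 + (l + 1) + 1 = l + l + 1 + 1 + 1 by ring,
      Nat.factorial_succ (l + l + 1 + 1), Nat.factorial_succ (l + l + 1), Nat.factorial_succ l]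
    push_cast
    field_simp
    ring

section HalfSums

variable {p : ℕ} [Fact p.Prime]

lemma padicNorm_prod_odd_div_even_le (hp : Odd p) (l : ℕ) :
    padicNorm p (∏ j ∈ range l, ((2 * j + 1) / (2 * j + 2) : ℚ)) ≤ 1 := by
  have h := congrArg (padicNorm p) (prod_odd_div_even_mul_pow l)
  rw [padicNorm.mul, padicNorm_pow, padicNorm_four hp, one_pow, mul_one] at h
  exact h.trans_le (padicNorm.of_nat _)

lemma padicNorm_pow_mul_prod_even_div_odd_le (hp : Odd p) {r l : ℕ} (hl : l + l + 1 < p ^ r) :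
    padicNorm p ((p ^ r : ℕ) * ∏ j ∈ range l, ((2 * j + 2) / (2 * j + 3) : ℚ)) ≤ (p : ℚ)⁻¹ := by
  rw [prod_even_div_odd_eq, mul_left_comm, padicNorm.mul, padicNorm_pow, padicNorm_four hp, one_pow,
    one_mul]
  exact padicNorm_pow_mul_beta_le l hl

lemma inv_sq_lt_one_of_prime : (p : ℚ)⁻¹ ^ 2 < 1 :=
  pow_lt_one₀ (by positivity)
    (inv_lt_one_of_one_lt₀ (by exact_mod_cast (Fact.out : p.Prime).one_lt)) two_ne_zero

lemma padicNorm_interpCoeff_self_sub_one_le (hp : Odd p) {r M : ℕ} (h : 2 * M + 1 = p ^ r) :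
    padicNorm p (interpCoeff M M - 1) ≤ (p : ℚ)⁻¹ ^ 2 := by
  have hδ := inv_sq_lt_one_of_prime (p := p)
  refine padicNorm_mul_sub_one_le hδ ?_ ?_
  · refine padicNorm_prod_sub_one_le (by positivity) hδ fun j hj ↦ ?_
    rw [sub_sub_cancel_left, padicNorm.neg, h]
    have := padicNorm_pow_div_sq_le (p := p) (r := r) (c := j + 1) (by omega)
      (by have := mem_range.1 hj; omega)
    rwa [Nat.cast_mul, mul_comm, ← div_div, div_pow, Nat.cast_ofNat,
      padicNorm.div, padicNorm_pow 4, padicNorm_four hp, one_pow, div_one]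
  · refine padicNorm_prod_sub_one_le (by positivity) hδ fun j hj ↦ ?_
    refine padicNorm_inv_sub_one_le hδ ?_
    rw [sub_sub_cancel_left, padicNorm.neg, h]
    have := mem_range.1 (mem_erase.1 hj).2
    have := (mem_erase.1 hj).1
    exact padicNorm_pow_div_sq_le (by omega) (by omega)

lemma prod_sq_sub_div_sq_sub (x : ℚ) (l c : ℕ) :
    ∏ j ∈ range l, ((2 * j + (c + 1)) ^ 2 - (x / 2) ^ 2) / ((2 * j + (c + 2)) ^ 2 - (x / 2) ^ 2) =
      (∏ j ∈ range l, ((2 * j + (c + 1)) / (2 * j + (c + 2)) : ℚ)) ^ 2 *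
        ∏ j ∈ range l, (1 - (x / (2 * (2 * j + (c + 1)) : ℕ)) ^ 2) /
          (1 - (x / (2 * (2 * j + (c + 2)) : ℕ)) ^ 2) := by
  rw [← prod_pow, ← prod_mul_distrib]
  refine prod_congr rfl fun j _ ↦ ?_
  rw [sq_sub_div_sq_sub x (by positivity) (by positivity)]
  push_cast
  rfl

lemma padicNorm_sum_quadTerm_sub_le (hp : Odd p) {r N i : ℕ} (h : 4 * N + 1 = p ^ r)
    (hi : i ≤ 2 * N) :
    padicNorm p (∑ k ∈ range (2 * N + 1), quadTerm ((i + 1 / 2) ^ 2) 0 k -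
      ∑ k ∈ range (2 * N + 1), quadTerm ((i + 1 / 2) ^ 2) (((p ^ r : ℕ) / 2) ^ 2) k) ≤
      padicNorm p (2 * i + 1 : ℕ) * (p : ℚ)⁻¹ ^ 2 := by
  have hδ := inv_sq_lt_one_of_prime (p := p)
  have hY0 (j : ℕ) : ((j : ℚ) + 1) ^ 2 - 0 ≠ 0 := by rw [sub_zero]; positivity
  have hYA := sq_sub_half_natCast_sq_ne_zero (n := p ^ r) ⟨2 * N, by omega⟩
  obtain ⟨l, rfl | rfl⟩ := Nat.even_or_odd' i
  · have hR := prod_sq_sub_div_sq_sub (p ^ r : ℕ) l 0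
    have hR0 := prod_sq_sub_div_sq_sub 0 l 0
    have hQ := (padicNorm_prod_ratio_le (l := l) (p := p)
      (e := fun j ↦ ((p ^ r : ℕ) / (2 * (2 * j + (0 + 1)) : ℕ)) ^ 2)
      (f := fun j ↦ ((p ^ r : ℕ) / (2 * (2 * j + (0 + 2)) : ℕ)) ^ 2) (by positivity) hδ
      (fun j hj ↦ padicNorm_pow_div_sq_le (by omega) (by omega))
      (fun j hj ↦ padicNorm_pow_div_sq_le (by omega) (by omega))).1
    have hc := padicNorm_prod_odd_div_even_le hp l
    simp only [zero_div, ne_eq, OfNat.ofNat_ne_zero, not_false_eq_true, zero_pow, sub_zero, div_one,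
      prod_const_one, mul_one, CharP.cast_eq_zero, zero_add] at hR hR0 hQ
    rw [sum_quadTerm_even_half hY0 (by omega), sum_quadTerm_even_half hYA (by omega), hR]
    simp only [sub_zero, ← div_pow, prod_pow]
    generalize ∏ j ∈ range l, ((2 * j + 1) / (2 * j + 2) : ℚ) = c at *
    generalize ∏ j ∈ range l, (_ : ℚ) = R at *
    rw [show (4 * l + 1) * c ^ 2 - (4 * l + 1) * (c ^ 2 * R) =
      -((2 * (2 * l) + 1 : ℕ) * (c ^ 2 * (R - 1))) by push_cast; ring, padicNorm.neg, padicNorm.mul,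
      padicNorm.mul, padicNorm_pow]
    refine mul_le_mul_of_nonneg_left ?_ (padicNorm.nonneg _)
    exact (mul_le_of_le_one_left (padicNorm.nonneg _)
      (pow_le_one₀ (padicNorm.nonneg _) hc)).trans hQ
  · have hR := prod_sq_sub_div_sq_sub (p ^ r : ℕ) l 1
    have hQ := padicNorm_eq_one_of_sub_one_le hδ (padicNorm_prod_ratio_le (l := l) (p := p)
      (e := fun j ↦ ((p ^ r : ℕ) / (2 * (2 * j + (1 + 1)) : ℕ)) ^ 2)
      (f := fun j ↦ ((p ^ r : ℕ) / (2 * (2 * j + (1 + 2)) : ℕ)) ^ 2) (by positivity) hδ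
      (fun j hj ↦ padicNorm_pow_div_sq_le (by omega) (by omega))
      (fun j hj ↦ padicNorm_pow_div_sq_le (by omega) (by omega))).1
    have hd := padicNorm_pow_mul_prod_even_div_odd_le hp (show l + l + 1 < p ^ r by omega)
    have hA : padicNorm p (1 - ((p ^ r : ℕ) / 2) ^ 2) = 1 := by
      refine padicNorm_eq_one_of_sub_one_le hδ ?_
      rw [sub_sub_cancel_left, padicNorm.neg]
      exact padicNorm_pow_div_sq_le (c := 2) (by omega) (by omega)
    simp only [Nat.cast_one, one_add_one_eq_two, show (1 + 2 : ℚ) = 3 by norm_num] at hR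
    rw [sum_quadTerm_odd_half hY0 (by omega), sum_quadTerm_odd_half hYA (by omega), hR]
    simp only [one_add_one_eq_two] at hQ
    generalize ∏ j ∈ range l, ((2 * j + 2) / (2 * j + 3) : ℚ) = c at *
    generalize ∏ j ∈ range l, (_ : ℚ) = R at hQ ⊢
    rw [zero_div, mul_zero, zero_mul, zero_sub, padicNorm.neg,
      show (4 * l + 3) * (((p ^ r : ℕ) / 2) ^ 2 / (1 - ((p ^ r : ℕ) / 2) ^ 2)) * (c ^ 2 * R) =
      (2 * (2 * l + 1) + 1 : ℕ) * (((p ^ r : ℕ) * c) ^ 2 / 4 / (1 - ((p ^ r : ℕ) / 2) ^ 2) * R) by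
        push_cast; ring, padicNorm.mul, padicNorm.mul, padicNorm.div, padicNorm.div, hA, hQ,
      padicNorm_four hp, div_one, div_one, mul_one, padicNorm_pow]
    gcongr
    · exact padicNorm.nonneg _
    · exact padicNorm.nonneg _

end HalfSums

lemma padicNorm_sum_quadTerm_zero_sub_le {p : ℕ} [Fact p.Prime] (hp : Odd p) {r N : ℕ}
    (h : 4 * N + 1 = p ^ r) :
    padicNorm p (∑ k ∈ range (2 * N + 1), quadTerm 0 0 k -
      (p ^ r : ℕ) * (∏ j ∈ range N, ((2 * j + 1) / (2 * j + 2) : ℚ)) ^ 2 *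
        (1 + ∑ j ∈ range N, (((p ^ r : ℕ) / (2 * (2 * j + 1) : ℕ) : ℚ) ^ 2 -
          ((p ^ r : ℕ) / (2 * (2 * j + 2) : ℕ) : ℚ) ^ 2))) ≤
      padicNorm p (p ^ r : ℕ) * ((p : ℚ)⁻¹ ^ 2) ^ 2 := by
  have hδ := inv_sq_lt_one_of_prime (p := p)
  have hn : (4 * N + 1 : ℚ) = (p ^ r : ℕ) := by exact_mod_cast h
  have hY0 (j : ℕ) : ((j : ℚ) + 1) ^ 2 - 0 ≠ 0 := by rw [sub_zero]; positivity
  have hYA := sq_sub_half_natCast_sq_ne_zero (n := p ^ r) ⟨2 * N, by omega⟩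
  have hTA := sum_quadTerm_zero_half (show N < 2 * N + 1 by omega)
  rw [show (2 * N + 1 / 2 : ℚ) = (p ^ r : ℕ) / 2 by rw [← hn]; ring, sum_quadTerm_zero_eq,
    prod_pow, hn, sum_range_succ] at hTA
  have hS := sum_quadTerm_even_half hYA (show 2 * N < 2 * N + 1 by omega)
  have hS0 := sum_quadTerm_even_half hY0 (show 2 * N < 2 * N + 1 by omega)
  have hR := prod_sq_sub_div_sq_sub (p ^ r : ℕ) N 0
  have hQ := (padicNorm_prod_ratio_le (l := N) (p := p)
    (e := fun j ↦ ((p ^ r : ℕ) / (2 * (2 * j + 1) : ℕ)) ^ 2)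
    (f := fun j ↦ ((p ^ r : ℕ) / (2 * (2 * j + 2) : ℕ)) ^ 2) (by positivity) hδ
    (fun j hj ↦ padicNorm_pow_div_sq_le (by omega) (by omega))
    (fun j hj ↦ padicNorm_pow_div_sq_le (by omega) (by omega))).2
  have hc := padicNorm_prod_odd_div_even_le hp N
  have hL := padicNorm_interpCoeff_self_sub_one_le hp (M := 2 * N) (r := r) (by omega)
  have hD := padicNorm_sum_quadTerm_sub_le hp h le_rfl
  simp only [CharP.cast_eq_zero, zero_add] at hR
  rw [hR, hn] at hS
  simp only [sub_zero, ← div_pow, prod_pow, hn] at hS0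
  have hsum : padicNorm p (∑ i ∈ range (2 * N), interpCoeff (2 * N) i *
      (∑ k ∈ range (2 * N + 1), quadTerm ((i + 1 / 2) ^ 2) 0 k -
        ∑ k ∈ range (2 * N + 1), quadTerm ((i + 1 / 2) ^ 2) (((p ^ r : ℕ) / 2) ^ 2) k)) ≤
      padicNorm p (p ^ r : ℕ) * ((p : ℚ)⁻¹ ^ 2) ^ 2 := by
    refine padicNorm.sum_le' (fun i hi ↦ ?_)
      (mul_nonneg (padicNorm.nonneg _) (by positivity))
    obtain ⟨d, hd⟩ := Nat.exists_eq_add_of_lt (mem_range.1 hi)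
    have h1 := padicNorm_interpCoeff_mul_le hp (r := r) (i := i) (d := d + 1) (by omega) d.succ_pos
    rw [← add_assoc, ← hd] at h1
    refine (padicNorm_mul_le le_rfl
      (padicNorm_sum_quadTerm_sub_le hp h (mem_range.1 hi).le)).trans ?_
    rw [← mul_assoc, sq (_ ^ 2), ← mul_assoc]
    exact mul_le_mul_of_nonneg_right h1 (by positivity)
  rw [sum_quadTerm_zero_eq, sum_range_succ]
  simp only [mul_sub, sum_sub_distrib] at hsum
  rw [hS, hS0] at hD
  rw [hS] at hTA
  rw [hS0]
  have hm : 2 * (2 * N) + 1 = p ^ r := by omega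
  rw [hm] at hD
  generalize ∑ j ∈ range N, (_ : ℚ) = s at hQ ⊢
  generalize ∏ j ∈ range N, ((2 * j + 1) / (2 * j + 2) : ℚ) = c at *
  generalize ∏ j ∈ range N, (_ : ℚ) = R at *
  generalize interpCoeff (2 * N) (2 * N) = L at *
  generalize ∑ i ∈ range (2 * N), (_ : ℚ) = T₀ at hsum ⊢
  generalize ∑ i ∈ range (2 * N), (_ : ℚ) = T at hsum hTA
  have key : T₀ + L * ((p ^ r : ℕ) * c ^ 2) - (p ^ r : ℕ) * c ^ 2 * (1 + s) =
      T₀ - T + (L - 1) * ((p ^ r : ℕ) * c ^ 2 - (p ^ r : ℕ) * (c ^ 2 * R)) -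
        (p ^ r : ℕ) * (c ^ 2 * (R - 1 + s)) := by
    linear_combination hTA
  rw [key]
  refine padicNorm_sub_le (padicNorm_add_le hsum ?_) ?_
  · refine (padicNorm_mul_le hL hD).trans_eq (by ring)
  · refine padicNorm_mul_le le_rfl (mul_comm (c ^ 2) _ ▸ ?_)
    refine (padicNorm_mul_le hQ ?_).trans_eq (mul_one _)
    rw [padicNorm_pow]
    exact pow_le_one₀ (padicNorm.nonneg _) hc

lemma quadTerm_zero_zero (k : ℕ) :
    quadTerm 0 0 k =
      (6 * k + 1) * risingFac (1 / 2) k ^ 3 * risingFac (1 / 4) k ^ 2 / (k.factorial : ℚ) ^ 5 := by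
  rw [quadTerm, risingFac, risingFac, ← prod_range_add_one_eq_factorial, Nat.cast_prod,
    ← prod_pow, ← prod_pow, ← prod_pow, mul_assoc, ← prod_mul_distrib, mul_div_assoc,
    ← prod_div_distrib]
  congr 1
  refine prod_congr rfl fun j _ ↦ ?_
  push_cast
  congr 1 <;> ring

lemma risingFac_half_div_risingFac_one (N : ℕ) :
    risingFac (1 / 2) N / risingFac 1 N = ∏ j ∈ range N, ((2 * j + 1) / (2 * j + 2) : ℚ) := by
  rw [risingFac, risingFac, ← prod_div_distrib]
  refine prod_congr rfl fun j _ ↦ ?_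
  field_simp
  ring

lemma sum_inv_sq_sub_eq_harmonic2 (x : ℚ) (N : ℕ) :
    ∑ j ∈ range N, ((x / (2 * (2 * j + 1) : ℕ)) ^ 2 - (x / (2 * (2 * j + 2) : ℕ)) ^ 2) =
      x ^ 2 * (harmonic2 (2 * N) / 4 - harmonic2 N / 8) := by
  have hsucc (m : ℕ) : harmonic2 (m + 1) = harmonic2 m + 1 / ((m + 1 : ℕ) : ℚ) ^ 2 :=
    sum_Icc_succ_top (by omega) _
  induction N with
  | zero => simp [harmonic2]
  | succ N ih =>
    rw [sum_range_succ, ih, show 2 * (N + 1) = 2 * N + 1 + 1 by ring, hsucc N, hsucc (2 * N + 1),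
      hsucc (2 * N)]
    push_cast
    field_simp
    ring

theorem stmt_5 (p : ℕ) [Fact p.Prime] (hodd : Odd p) (r : ℕ) (hr : 0 < r)
    (hp4 : p ^ r % 4 = 1) :
    ‖(((∑ k ∈ Finset.range ((p ^ r - 1) / 2 + 1),
        (6 * k + 1 : ℚ) * risingFac (1/2) k ^ 3 * risingFac (1/4) k ^ 2 /
          (k.factorial : ℚ) ^ 5) -
        ((p : ℚ) ^ r / 8) *
          (risingFac (1/2) ((p ^ r - 1) / 4) ^ 2 / risingFac 1 ((p ^ r - 1) / 4) ^ 2) *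
          (8 + 2 * (p : ℚ) ^ (2 * r) * harmonic2 ((p ^ r - 1) / 2) -
            (p : ℚ) ^ (2 * r) * harmonic2 ((p ^ r - 1) / 4)) : ℚ) : ℚ_[p])‖ ≤
      (p : ℝ) ^ (-(r + 4 : ℤ)) := by
  have h : 4 * ((p ^ r - 1) / 4) + 1 = p ^ r := by omega
  have h2 : (p ^ r - 1) / 2 = 2 * ((p ^ r - 1) / 4) := by omega
  rw [h2]
  generalize (p ^ r - 1) / 4 = N at *
  have key := padicNorm_sum_quadTerm_zero_sub_le hodd h
  rw [sum_inv_sq_sub_eq_harmonic2, ← risingFac_half_div_risingFac_one, div_pow,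
    sum_congr rfl fun k _ ↦ quadTerm_zero_zero k] at key
  have hbound : padicNorm p (p ^ r : ℕ) * ((p : ℚ)⁻¹ ^ 2) ^ 2 = (p : ℚ) ^ (-(r + 4 : ℤ)) := by
    have hp0 : (p : ℚ) ≠ 0 := by exact_mod_cast (Fact.out : p.Prime).ne_zero
    rw [Nat.cast_pow, padicNorm_pow, padicNorm.padicNorm_p_of_prime, neg_add, zpow_add₀ hp0,
      zpow_neg, zpow_natCast, inv_pow, ← pow_mul, zpow_neg]
    norm_num
  rw [hbound] at key
  rw [Padic.eq_padicNorm]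
  have key' : ((padicNorm p _ : ℚ) : ℝ) ≤ ((p : ℚ) ^ (-(r + 4 : ℤ)) : ℚ) := Rat.cast_le.2 key
  rw [Rat.cast_zpow, Rat.cast_natCast] at key'
  convert key' using 4
  push_cast
  ring
end

section
/- Let n be a positive integer with n ≡ 3 (mod 4). Then, as polynomials in q (after clearing denominators), the sum over k from 0 to n-1 of [6k+1]·(q;q²)_k³·(q;q⁴)_k / ((q²;q²)_k·(q⁴;q⁴)_k³) · q^{k²+k} is divisible by [n]·Φ_n(q)³ in the polynomial ring, i.e., the rational function is congruent to 0 modulo [n]·Φ_n(q)³. -/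
/-- The q-shifted factorial `(x;q)_k = (1-x)(1-xq)⋯(1-xq^{k-1})`. -/
def qPoch {K : Type*} [Field K] (x q : K) (k : ℕ) : K :=
  ∏ i ∈ Finset.range k, (1 - x * q ^ i)

/-- The q-integer `[r] = 1 + q + ⋯ + q^{r-1}`. -/
def qint {K : Type*} [Field K] (q : K) (r : ℕ) : K :=
  ∑ i ∈ Finset.range r, q ^ i

section Recurrence

/-- `(1-q^{6k+1}) q^{k²+k}`. -/
def coeffTerm {R : Type*} [CommRing R] (q : R) (k : ℕ) : R :=
  (1 - q ^ (6 * k + 1)) * q ^ (k ^ 2 + k)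

/-- The numerator of the term ratio; for `u = x + 1/x - 2` the middle factor is
`(1 - q^{2i+1} x) (1 - q^{2i+1} / x)`. -/
def ratioNum {R : Type*} [CommRing R] (q u w : R) (i : ℕ) : R :=
  (1 - q ^ (2 * i + 1)) * ((1 - q ^ (2 * i + 1)) ^ 2 - q ^ (2 * i + 1) * u) *
    (w - q ^ (4 * i + 1))

/-- The denominator of the term ratio. -/
def ratioDen {R : Type*} [CommRing R] (q u w : R) (i : ℕ) : R :=
  (1 - q ^ (4 * i + 4)) * ((1 - q ^ (4 * i + 4)) ^ 2 - q ^ (4 * i + 4) * u) *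
    (1 - q ^ (2 * i + 2) * w)

/-- The sum `∑_{k<n} c_k ∏_{i<k} N_i / D_i`. -/
def ratioSum {K : Type*} [Field K] (n : ℕ) (c N D : ℕ → K) : K :=
  ∑ k ∈ Finset.range n, c k * ∏ i ∈ Finset.range k, (N i / D i)

/-- The sum `∑_{k<n} c_k ∏_{i<k} N_i / D_i` multiplied by `∏_{i<n-1} D_i`. -/
def clearedSum {R : Type*} [CommRing R] (n : ℕ) (c N D : ℕ → R) : R :=
  ∑ k ∈ Finset.range n, c k * (∏ i ∈ Finset.range k, N i) * ∏ i ∈ Finset.Ico k (n - 1), D i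

/-- The two-parameter deformation of the sum, with upper limit `n - 1`. -/
def paramSum {K : Type*} [Field K] (n : ℕ) (q u w : K) : K :=
  ratioSum n (coeffTerm q) (ratioNum q u w) (ratioDen q u w)

/-- The two-parameter deformation of the sum with its denominators cleared. -/
def paramPoly {R : Type*} [CommRing R] (n : ℕ) (q u w : R) : R :=
  clearedSum n (coeffTerm q) (ratioNum q u w) (ratioDen q u w)

theorem clearedSum_eq {K : Type*} [Field K] (n : ℕ) (c N D : ℕ → K)
    (hD : ∀ i < n - 1, D i ≠ 0) :
    clearedSum n c N D = ratioSum n c N D * ∏ i ∈ Finset.range (n - 1), D i := by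
  unfold clearedSum ratioSum
  rw [Finset.sum_mul]
  refine Finset.sum_congr rfl fun k hk => ?_
  have hk' : k ≤ n - 1 := by have := Finset.mem_range.1 hk; omega
  rw [← Finset.prod_range_mul_prod_Ico D hk', Finset.prod_div_distrib]
  have : ∏ i ∈ Finset.range k, D i ≠ 0 :=
    Finset.prod_ne_zero_iff.2 fun i hi => hD i (by have := Finset.mem_range.1 hi; omega)
  field_simp

theorem map_clearedSum {R S : Type*} [CommRing R] [CommRing S] (f : R →+* S) (n : ℕ)
    (c N D : ℕ → R) :
    f (clearedSum n c N D) = clearedSum n (f ∘ c) (f ∘ N) (f ∘ D) := by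
  simp [clearedSum]

theorem map_paramPoly {R S : Type*} [CommRing R] [CommRing S] (f : R →+* S) (n : ℕ)
    (q u w : R) : f (paramPoly n q u w) = paramPoly n (f q) (f u) (f w) := by
  simp [paramPoly, clearedSum, coeffTerm, ratioNum, ratioDen]

theorem prod_ratio_shift {K : Type*} [Field K] (q u w : K) (k : ℕ)
    (hw : ∀ i < k + 3, 1 - q ^ (2 * i + 2) * w ≠ 0) :
    ∏ i ∈ Finset.range (k + 1), (ratioNum q u (q ^ 4 * w) i / ratioDen q u (q ^ 4 * w) i) =
      (∏ i ∈ Finset.range k, (ratioNum q u w i / ratioDen q u w i)) *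
      ((1 - q ^ (2 * k + 1)) * ((1 - q ^ (2 * k + 1)) ^ 2 - q ^ (2 * k + 1) * u) /
        ((1 - q ^ (4 * k + 4)) * ((1 - q ^ (4 * k + 4)) ^ 2 - q ^ (4 * k + 4) * u))) *
      ((q ^ 4 * w - q) * q ^ (4 * k) * (1 - q ^ 2 * w) * (1 - q ^ 4 * w) /
        ((1 - q ^ (2 * k + 2) * w) * (1 - q ^ (2 * k + 4) * w) * (1 - q ^ (2 * k + 6) * w))) := by
  induction k with
  | zero =>
    have h0 := hw 0 (by omega)
    have h1 := hw 1 (by omega)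
    have h2 := hw 2 (by omega)
    simp only [ratioNum, ratioDen, mul_zero, zero_add, mul_one, Nat.reduceMul, Nat.reduceAdd,
      Finset.prod_range_one, Finset.prod_range_zero] at *
    rw [one_mul, mul_div_mul_comm _ _ _ (1 - q ^ 2 * (q ^ 4 * w)), pow_one, pow_zero]
    congr 1
    rw [show q ^ 2 * (q ^ 4 * w) = q ^ 6 * w by ring]
    field_simp
  | succ k ih =>
    rw [Finset.prod_range_succ, ih fun i hi => hw i (by omega), Finset.prod_range_succ _ k]
    have h0 := hw k (by omega)
    have h1 := hw (k + 1) (by omega)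
    have h2 := hw (k + 2) (by omega)
    have h3 := hw (k + 3) (by omega)
    simp only [ratioNum, ratioDen]
    generalize ∏ i ∈ Finset.range k, (_ : K) = σ
    rw [mul_div_mul_comm _ _ _ (1 - q ^ (2 * (k + 1) + 2) * (q ^ 4 * w)),
      mul_div_mul_comm _ _ _ (1 - q ^ (2 * k + 2) * w)]
    generalize (1 - q ^ (2 * k + 1)) * _ / _ = A
    generalize (1 - q ^ (2 * (k + 1) + 1)) * _ / _ = B
    have e : σ * A * ((q ^ 4 * w - q) * q ^ (4 * k) * (1 - q ^ 2 * w) * (1 - q ^ 4 * w) /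
        ((1 - q ^ (2 * k + 2) * w) * (1 - q ^ (2 * k + 4) * w) * (1 - q ^ (2 * k + 6) * w))) *
        (B * ((q ^ 4 * w - q ^ (4 * (k + 1) + 1)) / (1 - q ^ (2 * (k + 1) + 2) * (q ^ 4 * w)))) =
        σ * A * B * (((q ^ 4 * w - q) * q ^ (4 * k) * (1 - q ^ 2 * w) * (1 - q ^ 4 * w) /
        ((1 - q ^ (2 * k + 2) * w) * (1 - q ^ (2 * k + 4) * w) * (1 - q ^ (2 * k + 6) * w))) *
        ((q ^ 4 * w - q ^ (4 * (k + 1) + 1)) / (1 - q ^ (2 * (k + 1) + 2) * (q ^ 4 * w)))) := by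
      ring
    have e' : ∀ Z Y : K, σ * (A * Y) * B * Z = σ * A * B * (Y * Z) := fun Z Y => by ring
    rw [e, e']
    congr 1
    have e1 : q ^ (2 * (k + 1) + 2) * (q ^ 4 * w) = q ^ (2 * (k + 3) + 2) * w := by ring
    have e2 : q ^ (2 * (k + 1) + 2) * w = q ^ (2 * k + 4) * w := by ring
    have e3 : q ^ (2 * (k + 1) + 4) * w = q ^ (2 * k + 6) * w := by ring
    have e4 : q ^ (2 * (k + 1) + 6) * w = q ^ (2 * (k + 3) + 2) * w := by ring
    rw [e1, e2, e3, e4]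
    have h1' : 1 - q ^ (2 * k + 4) * w ≠ 0 := by rwa [← e2]
    have h2' : 1 - q ^ (2 * k + 6) * w ≠ 0 := by rwa [← e3]
    field_simp
    ring

theorem paramSum_recurrence {K : Type*} [Field K] (q u w : K) (m : ℕ)
    (hq : ∀ i < m, 1 - q ^ (4 * i + 4) ≠ 0)
    (hu : ∀ i < m, (1 - q ^ (4 * i + 4)) ^ 2 - q ^ (4 * i + 4) * u ≠ 0)
    (hw : ∀ i < m + 2, 1 - q ^ (2 * i + 2) * w ≠ 0) :
    ((1 - q ^ 3 * w) ^ 2 - q ^ 3 * w * u) * paramSum (m + 1) q u (q ^ 4 * w) -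
      (1 - q ^ 2 * w) * (1 - q ^ 4 * w) * paramSum (m + 1) q u w =
    q ^ (m ^ 2 + m) * (∏ i ∈ Finset.range m, (ratioNum q u w i / ratioDen q u w i)) *
      ((1 - q ^ 2 * w) * (1 - q ^ 4 * w) * w * q ^ (2 * m + 2) * (1 - q ^ (2 * m + 1)) *
        ((1 - q ^ (2 * m + 1)) ^ 2 - q ^ (2 * m + 1) * u) /
      ((1 - q ^ (2 * m + 2) * w) * (1 - q ^ (2 * m + 4) * w))) := by
  induction m with
  | zero =>
    have h0 := hw 0 (by omega)
    have h1 := hw 1 (by omega)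
    simp [paramSum, ratioSum, coeffTerm] at *
    field_simp
    ring
  | succ m ih =>
    have ih := ih (fun i hi => hq i (by omega)) (fun i hi => hu i (by omega))
      fun i hi => hw i (by omega)
    have hs : ∀ w : K, paramSum (m + 1 + 1) q u w = paramSum (m + 1) q u w +
        coeffTerm q (m + 1) *
          ∏ i ∈ Finset.range (m + 1), (ratioNum q u w i / ratioDen q u w i) := fun w => by
      simp only [paramSum, ratioSum, Finset.sum_range_succ _ (m + 1)]
    rw [hs, hs, mul_add, mul_add, add_sub_add_comm, ih, prod_ratio_shift q u w m hw,
      Finset.prod_range_succ]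
    have h0 := hw m (by omega)
    have h1 := hw (m + 1) (by omega)
    have h2 := hw (m + 2) (by omega)
    have h3 := hq m (by omega)
    have h4 := hu m (by omega)
    simp only [ratioNum, ratioDen, coeffTerm]
    generalize ∏ i ∈ Finset.range m, (_ : K) = σ
    have p1 : q ^ ((m + 1) ^ 2 + (m + 1)) = q ^ (m ^ 2 + m) * (q ^ m) ^ 2 * q ^ 2 := by ring
    rw [p1]
    generalize q ^ (m ^ 2 + m) = τ
    have e1 : q ^ (2 * m + 1) = (q ^ m) ^ 2 * q := by ring
    have e2 : q ^ (2 * m + 2) = (q ^ m) ^ 2 * q ^ 2 := by ring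
    have e4 : q ^ (2 * m + 4) = (q ^ m) ^ 2 * q ^ 4 := by ring
    have e6 : q ^ (2 * m + 6) = (q ^ m) ^ 2 * q ^ 6 := by ring
    have f0 : q ^ (4 * m) = (q ^ m) ^ 4 := by ring
    have f1 : q ^ (4 * m + 1) = (q ^ m) ^ 4 * q := by ring
    have f4 : q ^ (4 * m + 4) = (q ^ m) ^ 4 * q ^ 4 := by ring
    have g1 : q ^ (6 * (m + 1) + 1) = (q ^ m) ^ 6 * q ^ 7 := by ring
    have g2 : q ^ (2 * (m + 1) + 1) = (q ^ m) ^ 2 * q ^ 3 := by ring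
    have g3 : q ^ (2 * (m + 1) + 2) = (q ^ m) ^ 2 * q ^ 4 := by ring
    have g4 : q ^ (2 * (m + 1) + 4) = (q ^ m) ^ 2 * q ^ 6 := by ring
    have g5 : q ^ (2 * (m + 2) + 2) = (q ^ m) ^ 2 * q ^ 6 := by ring
    rw [e2] at h0
    rw [g3] at h1
    rw [g5] at h2
    rw [f4] at h3 h4
    rw [e1, e2, e4, e6, f0, f1, f4, g1, g2, g3, g4]
    clear hs ih hq hu hw p1 e1 e2 e4 e6 f0 f1 f4 g1 g2 g3 g4 g5
    generalize q ^ m = Q at *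
    have core : w * (1 - Q ^ 2 * q ^ 6 * w) * (1 - Q ^ 4 * q ^ 4) *
          ((1 - Q ^ 4 * q ^ 4) ^ 2 - Q ^ 4 * q ^ 4 * u) +
        ((1 - q ^ 3 * w) ^ 2 - q ^ 3 * w * u) * (1 - Q ^ 6 * q ^ 7) * (q ^ 4 * w - q) * Q ^ 4 -
        (1 - Q ^ 6 * q ^ 7) * (w - Q ^ 4 * q) * (1 - Q ^ 2 * q ^ 4 * w) *
          (1 - Q ^ 2 * q ^ 6 * w) =
        (w - Q ^ 4 * q) * w * (Q ^ 2 * q ^ 4) * (1 - Q ^ 2 * q ^ 3) *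
          ((1 - Q ^ 2 * q ^ 3) ^ 2 - Q ^ 2 * q ^ 3 * u) := by ring
    generalize (1 - q ^ 3 * w) ^ 2 - q ^ 3 * w * u = b at *
    generalize (1 - Q ^ 2 * q ^ 3) ^ 2 - Q ^ 2 * q ^ 3 * u = a' at *
    generalize (1 - Q ^ 2 * q) ^ 2 - Q ^ 2 * q * u = a at *
    generalize (1 - Q ^ 4 * q ^ 4) ^ 2 - Q ^ 4 * q ^ 4 * u = ε at *
    generalize 1 - Q ^ 4 * q ^ 4 = δ at *
    generalize 1 - Q ^ 2 * q ^ 2 * w = α at *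
    generalize 1 - Q ^ 2 * q ^ 4 * w = β at *
    generalize 1 - Q ^ 2 * q ^ 6 * w = γ at *
    generalize 1 - Q ^ 6 * q ^ 7 = κ at *
    generalize 1 - Q ^ 2 * q ^ 3 = t at *
    generalize 1 - Q ^ 2 * q = t' at *
    generalize 1 - q ^ 2 * w = s at *
    generalize 1 - q ^ 4 * w = s' at *
    have hd : α * β * γ * δ * ε ≠ 0 := by simp [h0, h1, h2, h3, h4]
    have hC := congrArg
      (fun z => τ * σ * Q ^ 2 * q ^ 2 * s * s' * t' * a * z / (α * β * γ * δ * ε)) core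
    clear core
    refine Eq.trans ?_ (hC.trans ?_) <;> clear hC
    · field_simp
      ring
    · rw [← mul_div_assoc σ, ← mul_div_assoc (τ * Q ^ 2 * q ^ 2), div_mul_div_comm]
      congr 1 <;> ring

end Recurrence

section SpecialValues

theorem ratioDen_ne_zero {K : Type*} [Field K] {q u w : K} {i : ℕ}
    (hq : 1 - q ^ (4 * i + 4) ≠ 0)
    (hu : (1 - q ^ (4 * i + 4)) ^ 2 - q ^ (4 * i + 4) * u ≠ 0)
    (hw : 1 - q ^ (2 * i + 2) * w ≠ 0) : ratioDen q u w i ≠ 0 :=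
  mul_ne_zero (mul_ne_zero hq hu) hw

/-- The recurrence without its boundary term, when some numerator factor vanishes. -/
theorem paramSum_recurrence_of_eq_zero {K : Type*} [Field K] (q u w : K) {m j : ℕ}
    (hq : ∀ i < m, 1 - q ^ (4 * i + 4) ≠ 0)
    (hu : ∀ i < m, (1 - q ^ (4 * i + 4)) ^ 2 - q ^ (4 * i + 4) * u ≠ 0)
    (hw : ∀ i < m + 2, 1 - q ^ (2 * i + 2) * w ≠ 0) (hj : j < m) (h0 : ratioNum q u w j = 0) :
    ((1 - q ^ 3 * w) ^ 2 - q ^ 3 * w * u) * paramSum (m + 1) q u (q ^ 4 * w) =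
      (1 - q ^ 2 * w) * (1 - q ^ 4 * w) * paramSum (m + 1) q u w := by
  have hprod : ∏ i ∈ Finset.range m, (ratioNum q u w i / ratioDen q u w i) = 0 :=
    Finset.prod_eq_zero (Finset.mem_range.2 hj) (by rw [h0, zero_div])
  have h := paramSum_recurrence q u w m hq hu hw
  rw [hprod] at h
  linear_combination h

/-- The evaluation at `w = q^{4M+1}`, where the sum terminates after `M + 1` terms. -/
theorem paramSum_pow_four_mul_add_one {K : Type*} [Field K] (q u : K) (m : ℕ)
    (hq : ∀ j, 0 < j → q ^ j ≠ 1)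
    (hu : ∀ i < m, (1 - q ^ (4 * i + 4)) ^ 2 - q ^ (4 * i + 4) * u ≠ 0) (M : ℕ) (hM : M ≤ m) :
    (∏ i ∈ Finset.range M, ((1 - q ^ (4 * i + 4)) ^ 2 - q ^ (4 * i + 4) * u)) *
        paramSum (m + 1) q u (q ^ (4 * M + 1)) =
      (1 - q) * ∏ i ∈ Finset.range M, ((1 - q ^ (4 * i + 3)) * (1 - q ^ (4 * i + 5))) := by
  have hq' : ∀ j, 0 < j → 1 - q ^ j ≠ 0 := fun j hj => sub_ne_zero.2 (hq j hj).symm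
  induction M with
  | zero =>
    have hsum : ∀ k ∈ Finset.range (m + 1), k ≠ 0 → coeffTerm q k *
        ∏ i ∈ Finset.range k, (ratioNum q u q i / ratioDen q u q i) = 0 := fun k _ hk => by
      rw [Finset.prod_eq_zero (Finset.mem_range.2 (Nat.pos_of_ne_zero hk)), mul_zero]
      simp [ratioNum]
    rw [mul_zero, zero_add, pow_one, paramSum, ratioSum,
      Finset.sum_eq_single_of_mem 0 (by simp) hsum]
    simp [coeffTerm]
  | succ M ih =>
    have h := paramSum_recurrence_of_eq_zero q u (q ^ (4 * M + 1)) (m := m) (j := M)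
      (fun i _ => hq' _ (by omega)) hu
      (fun i _ => by rw [← pow_add]; exact hq' _ (by omega)) (by omega) (by simp [ratioNum])
    have ih := ih (by omega)
    simp only [← pow_add] at h
    rw [show 4 + (4 * M + 1) = 4 * (M + 1) + 1 by ring, show 3 + (4 * M + 1) = 4 * M + 4 by ring,
      show 2 + (4 * M + 1) = 4 * M + 3 by ring, show 4 * (M + 1) + 1 = 4 * M + 5 by ring] at h
    rw [Finset.prod_range_succ, Finset.prod_range_succ, mul_assoc,
      show 4 * (M + 1) + 1 = 4 * M + 5 by ring, h]
    linear_combination (1 - q ^ (4 * M + 3)) * (1 - q ^ (4 * M + 5)) * ih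

/-- Vanishing at `w = 1` when `u = x + 1/x - 2` with `x = q^n`. -/
theorem paramSum_one_eq_zero {K : Type*} [Field K] (q u : K) (n : ℕ) (hn : n % 4 = 3)
    (hq0 : q ≠ 0) (hq : ∀ j, 0 < j → q ^ j ≠ 1) (hu : q ^ n * u = (1 - q ^ n) ^ 2) :
    paramSum n q u 1 = 0 := by
  have hq' : ∀ j, 0 < j → 1 - q ^ j ≠ 0 := fun j hj => sub_ne_zero.2 (hq j hj).symm
  have hinj : ∀ a b : ℕ, a ≠ b → q ^ a - q ^ b ≠ 0 := by
    intro a b hab h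
    rcases Nat.lt_or_gt_of_ne hab with h' | h'
    · refine hq' (b - a) (by omega) ((mul_eq_zero.1 ?_).resolve_left (pow_ne_zero a hq0))
      rw [mul_sub, ← pow_add, Nat.add_sub_cancel' h'.le, mul_one, h]
    · refine hq' (a - b) (by omega) ((mul_eq_zero.1 ?_).resolve_left (pow_ne_zero b hq0))
      rw [mul_sub, ← pow_add, Nat.add_sub_cancel' h'.le, mul_one, ← neg_sub, h, neg_zero]
  have hd : ∀ i < n - 1, (1 - q ^ (4 * i + 4)) ^ 2 - q ^ (4 * i + 4) * u ≠ 0 := by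
    intro i _ h
    have : (q ^ n - q ^ (4 * i + 4)) * (1 - q ^ (4 * i + 4 + n)) = 0 := by
      rw [pow_add _ _ n]
      linear_combination q ^ n * h + q ^ (4 * i + 4) * hu
    exact mul_ne_zero (hinj _ _ (by omega)) (hq' _ (by omega)) this
  have hrec : ∀ l, ((1 - q ^ (l + 3)) ^ 2 - q ^ (l + 3) * u) * paramSum n q u (q ^ (l + 4)) =
      (1 - q ^ (l + 2)) * (1 - q ^ (l + 4)) * paramSum n q u (q ^ l) := by
    intro l
    have h := paramSum_recurrence_of_eq_zero q u (q ^ l) (m := n - 1) (j := (n - 1) / 2)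
      (fun i _ => hq' _ (by omega)) hd
      (fun i _ => by rw [← pow_add]; exact hq' _ (by omega)) (by omega) (by
        rw [ratioNum, show 2 * ((n - 1) / 2) + 1 = n by omega, hu]
        ring)
    rw [Nat.sub_add_cancel (by omega)] at h
    simpa only [← pow_add, add_comm _ l] using h
  have hz : ∀ j, 4 * j + 3 ≤ n → paramSum n q u (q ^ (n - 3 - 4 * j)) = 0 := by
    intro j
    induction j with
    | zero =>
      intro _
      have h := hrec (n - 3)
      rw [Nat.sub_add_cancel (by omega), hu, sub_self, zero_mul] at h
      exact (mul_eq_zero.1 h.symm).resolve_left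
        (mul_ne_zero (hq' _ (by omega)) (hq' _ (by omega)))
    | succ j ih =>
      intro hj
      have h := hrec (n - 3 - 4 * (j + 1))
      rw [show n - 3 - 4 * (j + 1) + 4 = n - 3 - 4 * j by omega, ih (by omega), mul_zero] at h
      exact (mul_eq_zero.1 h.symm).resolve_left
        (mul_ne_zero (hq' _ (by omega)) (hq' _ (by omega)))
  have h := hz ((n - 3) / 4) (by omega)
  rwa [show n - 3 - 4 * ((n - 3) / 4) = 0 by omega, pow_zero] at h

theorem IsPrimitiveRoot.prod_range_sub_pow_mul {R : Type*} [CommRing R] [IsDomain R] {ζ : R}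
    {n : ℕ} (h : IsPrimitiveRoot ζ n) (hn : 0 < n) (x y : R) :
    ∏ i ∈ Finset.range n, (x - ζ ^ i * y) = x ^ n - y ^ n := by
  rw [h.pow_sub_pow_eq_prod_sub_mul x y hn]
  refine Finset.prod_nbij (ζ ^ ·) (fun i _ => ?_) (fun i hi j hj hij => ?_) (fun μ hμ => ?_)
    fun _ _ => rfl
  · rw [Polynomial.mem_nthRootsFinset hn, pow_right_comm, h.pow_eq_one, one_pow]
  · exact h.pow_inj (by simpa using hi) (by simpa using hj) hij
  · have : NeZero n := ⟨hn.ne'⟩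
    obtain ⟨i, hi, rfl⟩ := h.eq_pow_of_pow_eq_one ((Polynomial.mem_nthRootsFinset hn _).1 hμ)
    exact ⟨i, by simpa using hi, rfl⟩

/-- Vanishing at a primitive `n`-th root of unity, `n` odd, where `u = x + 1/x - 2`. -/
theorem paramSum_eq_zero_of_isPrimitiveRoot {K : Type*} [Field K] {ζ : K} {n : ℕ}
    (hζ : IsPrimitiveRoot ζ n) (hn : Odd n) {x u w : K} (hxn : x ^ n ≠ 1)
    (hxu : x * u = (x - 1) ^ 2) (hw : w ≠ 0) (hwn : w ^ n ≠ 1) :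
    paramSum n ζ u w = 0 := by
  have hn0 : 0 < n := hn.pos
  have hpow : ∀ j : ℕ, (ζ ^ j) ^ n = 1 := fun j => by rw [pow_right_comm, hζ.pow_eq_one, one_pow]
  have hcop : ∀ j : ℕ, n.Coprime j → ∀ i, 0 < i → i < n → ζ ^ (j * i) ≠ 1 :=
    fun j hj i hi hin h => by
      rw [hζ.pow_eq_one_iff_dvd] at h
      exact absurd (Nat.le_of_dvd hi (hj.dvd_of_dvd_mul_left h)) (by omega)
  have h2 : n.Coprime 2 := hn.coprime_two_right
  have h4 : n.Coprime 4 := h2.pow_right 2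
  have h1w : ∀ j : ℕ, 1 - ζ ^ j * w ≠ 0 := fun j h => hwn <| by
    rw [← one_mul (w ^ n), ← hpow j, ← mul_pow, ← sub_eq_zero.1 h, one_pow, hpow]
  have h1x : ∀ j : ℕ, 1 - ζ ^ j * x ≠ 0 := fun j h => hxn <| by
    rw [← one_mul (x ^ n), ← hpow j, ← mul_pow, ← sub_eq_zero.1 h, one_pow, hpow]
  have h1x' : ∀ j : ℕ, x - ζ ^ j ≠ 0 := fun j h => hxn <| by
    rw [sub_eq_zero.1 h, hpow]
  have hq : ∀ i < n - 1, 1 - ζ ^ (4 * i + 4) ≠ 0 := fun i hi =>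
    sub_ne_zero.2 (hcop 4 h4 (i + 1) (by omega) (by omega)).symm
  have hu : ∀ i < n - 1, (1 - ζ ^ (4 * i + 4)) ^ 2 - ζ ^ (4 * i + 4) * u ≠ 0 := fun i _ h => by
    refine mul_ne_zero (h1x (4 * i + 4)) (h1x' (4 * i + 4)) ?_
    linear_combination x * h + ζ ^ (4 * i + 4) * hxu
  obtain ⟨N, hN⟩ := hn
  rcases Nat.eq_zero_or_pos N with rfl | hN0
  · obtain rfl : n = 1 := by omega
    have : ζ = 1 := by simpa using hζ.pow_eq_one
    simp [paramSum, ratioSum, coeffTerm, this]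
  have hrec : ∀ j, ((1 - (ζ ^ 4) ^ j * (ζ ^ 3 * w * x)) * (x - (ζ ^ 4) ^ j * (ζ ^ 3 * w))) *
      paramSum n ζ u ((ζ ^ 4) ^ (j + 1) * w) =
      (x * ((1 - (ζ ^ 4) ^ j * (ζ ^ 2 * w)) * (1 - (ζ ^ 4) ^ j * (ζ ^ 4 * w)))) *
        paramSum n ζ u ((ζ ^ 4) ^ j * w) := by
    intro j
    have h := paramSum_recurrence_of_eq_zero ζ u ((ζ ^ 4) ^ j * w) (m := n - 1) (j := N) hq hu
      (fun i _ => by rw [← pow_mul, ← mul_assoc, ← pow_add]; exact h1w _) (by omega)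
      (by rw [ratioNum, ← hN, hζ.pow_eq_one]; ring)
    rw [Nat.sub_add_cancel hn0, show ζ ^ 4 * ((ζ ^ 4) ^ j * w) = (ζ ^ 4) ^ (j + 1) * w by ring] at h
    linear_combination x * h +
      ζ ^ 3 * (ζ ^ 4) ^ j * w * paramSum n ζ u ((ζ ^ 4) ^ (j + 1) * w) * hxu
  have hiter : ∀ l, (∏ j ∈ Finset.range l,
      ((1 - (ζ ^ 4) ^ j * (ζ ^ 3 * w * x)) * (x - (ζ ^ 4) ^ j * (ζ ^ 3 * w)))) *
      paramSum n ζ u ((ζ ^ 4) ^ l * w) = (∏ j ∈ Finset.range l,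
      (x * ((1 - (ζ ^ 4) ^ j * (ζ ^ 2 * w)) * (1 - (ζ ^ 4) ^ j * (ζ ^ 4 * w))))) *
        paramSum n ζ u w := by
    intro l
    induction l with
    | zero => simp
    | succ l ih =>
      rw [Finset.prod_range_succ, Finset.prod_range_succ, mul_assoc, hrec]
      linear_combination (x * ((1 - (ζ ^ 4) ^ l * (ζ ^ 2 * w)) *
        (1 - (ζ ^ 4) ^ l * (ζ ^ 4 * w)))) * ih
  have hζ4 : IsPrimitiveRoot (ζ ^ 4) n := hζ.pow_of_coprime 4 h4.symm
  have h := hiter n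
  simp only [Finset.prod_mul_distrib, hζ4.prod_range_sub_pow_mul hn0, Finset.prod_const,
    Finset.card_range, mul_pow, hpow, one_pow, one_mul] at h
  have hne : w ^ n * (x ^ n - 1) ^ 2 ≠ 0 :=
    mul_ne_zero (pow_ne_zero _ hw) (pow_ne_zero _ (sub_ne_zero.2 hxn))
  refine (mul_eq_zero.1 ?_).resolve_left hne
  linear_combination -h

end SpecialValues

section CyclotomicDivisibility

open Polynomial

theorem eval_paramPoly {R : Type*} [CommRing R] (n : ℕ) (q u w : R[X]) (b : R) :
    (paramPoly n q u w).eval b = paramPoly n (q.eval b) (u.eval b) (w.eval b) :=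
  map_paramPoly (evalRingHom b) n q u w

theorem X_pow_ne_one {j : ℕ} (hj : 0 < j) : (X : ℚ[X]) ^ j ≠ 1 := fun h => by
  simpa [hj.ne'] using congrArg natDegree h

theorem cyclotomic_dvd_iff_aeval_eq_zero {n : ℕ} (hn : 0 < n) {ζ : ℂ} (hζ : IsPrimitiveRoot ζ n)
    (p : ℚ[X]) : cyclotomic n ℚ ∣ p ↔ aeval ζ p = 0 := by
  rw [cyclotomic_eq_minpoly_rat hζ hn, minpoly.dvd_iff]

theorem cyclotomic_dvd_one_sub_X_pow_iff {n : ℕ} (hn : 0 < n) (m : ℕ) :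
    cyclotomic n ℚ ∣ 1 - X ^ m ↔ n ∣ m := by
  have hζ := Complex.isPrimitiveRoot_exp n hn.ne'
  rw [cyclotomic_dvd_iff_aeval_eq_zero hn hζ, ← hζ.pow_eq_one_iff_dvd, map_sub, map_pow, aeval_X,
    map_one, sub_eq_zero, eq_comm]

theorem paramPoly_eq_zero_of_isPrimitiveRoot {K : Type*} [Field K] {ζ : K} {n : ℕ}
    (hζ : IsPrimitiveRoot ζ n) (hn : Odd n) {x u w : K} (hxn : x ^ n ≠ 1)
    (hxu : x * u = (x - 1) ^ 2) (hw : w ≠ 0) (hwn : w ^ n ≠ 1) :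
    paramPoly n ζ u w = 0 := by
  have hpow : ∀ j : ℕ, (ζ ^ j) ^ n = 1 := fun j => by rw [pow_right_comm, hζ.pow_eq_one, one_pow]
  have hne : ∀ (j : ℕ) (y : K), y ^ n ≠ 1 → 1 - ζ ^ j * y ≠ 0 := fun j y hy h => hy <| by
    rw [← one_mul (y ^ n), ← hpow j, ← mul_pow, ← sub_eq_zero.1 h, one_pow, hpow]
  have h4 : n.Coprime 4 := hn.coprime_two_right.pow_right 2
  rw [paramPoly, clearedSum_eq]
  · rw [← paramSum, paramSum_eq_zero_of_isPrimitiveRoot hζ hn hxn hxu hw hwn, zero_mul]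
  · intro i hi
    refine ratioDen_ne_zero (fun h => ?_) (fun h => ?_) (hne _ _ hwn)
    · rw [sub_eq_zero, eq_comm, show 4 * i + 4 = 4 * (i + 1) by ring,
        hζ.pow_eq_one_iff_dvd] at h
      exact absurd (Nat.le_of_dvd (by omega) (h4.dvd_of_dvd_mul_left h)) (by omega)
    · refine mul_ne_zero (hne (4 * i + 4) x hxn) (fun h' : x - ζ ^ (4 * i + 4) = 0 => hxn ?_) ?_
      · rw [sub_eq_zero.1 h', hpow]
      · linear_combination x * h + ζ ^ (4 * i + 4) * hxu

theorem paramPoly_C_C_eq_zero {ζ : ℂ} {n : ℕ} (hζ : IsPrimitiveRoot ζ n) (hn : Odd n) :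
    paramPoly n (C (C ζ)) (C X) (X : ℂ[X][X]) = 0 := by
  have hpow : ∀ k : ℕ, ((k : ℂ) + 2) ^ n ≠ 1 := fun k h => by
    have : (k + 2) ^ n = 1 := by exact_mod_cast h
    have := (Nat.pow_eq_one.1 this).resolve_right hn.pos.ne'
    omega
  have hne : ∀ k : ℕ, (k : ℂ) + 2 ≠ 0 := fun k => by exact_mod_cast (by omega : k + 2 ≠ 0)
  refine eq_zero_of_infinite_isRoot _ (Set.infinite_of_injective_forall_mem
    (f := fun k : ℕ => (C ((k : ℂ) + 2) : ℂ[X])) (fun a b h => by simpa using h) fun k => ?_)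
  rw [Set.mem_ofPred_eq, IsRoot.def, eval_paramPoly]
  simp only [eval_C, eval_X]
  refine eq_zero_of_infinite_isRoot _ (Set.infinite_of_injective_forall_mem
    (f := fun l : ℕ => ((l : ℂ) + 1) ^ 2 / (l + 2)) (fun a b h => ?_) fun l => ?_)
  · have h' := (div_eq_div_iff (hne a) (hne b)).1 h
    have h'' : (a + 1) ^ 2 * (b + 2) = (b + 1) ^ 2 * (a + 2) := by exact_mod_cast h'
    zify at h'' ⊢
    have h3 : ((a : ℤ) - b) * ((a + 2) * (b + 2) - 1) = 0 := by linear_combination h''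
    rcases mul_eq_zero.1 h3 with h4 | h4
    · linarith
    · nlinarith
  · rw [Set.mem_ofPred_eq, IsRoot.def, eval_paramPoly]
    simp only [eval_C, eval_X]
    refine paramPoly_eq_zero_of_isPrimitiveRoot hζ hn (hpow l) ?_ (hne k) (hpow k)
    have := hne l
    field_simp
    ring

theorem C_C_cyclotomic_dvd_paramPoly {n : ℕ} (hn : Odd n) :
    C (C (cyclotomic n ℚ)) ∣ paramPoly n (C (C X)) (C X) (X : ℚ[X][X][X]) := by
  have hζ := Complex.isPrimitiveRoot_exp n hn.pos.ne'
  refine (C_dvd_iff_dvd_coeff _ _).2 fun i => (C_dvd_iff_dvd_coeff _ _).2 fun j => ?_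
  rw [cyclotomic_dvd_iff_aeval_eq_zero hn.pos hζ]
  have h := paramPoly_C_C_eq_zero hζ hn
  have h' := map_paramPoly (mapRingHom (mapRingHom
    (aeval (R := ℚ) (Complex.exp (2 * Real.pi * Complex.I / n))).toRingHom)) n (C (C X)) (C X)
    (X : ℚ[X][X][X])
  simp only [coe_mapRingHom, map_C, map_X, AlgHom.toRingHom_eq_coe, RingHom.coe_coe, aeval_X] at h'
  rw [h] at h'
  simpa using congrArg (fun p => (p.coeff i).coeff j) h'

theorem paramPoly_zero_one_eq_zero {ζ : ℂ} {n : ℕ} (hζ : IsPrimitiveRoot ζ n) (hn : Odd n) :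
    paramPoly n ζ 0 1 = 0 := by
  have h := congrArg (fun p => (p.eval 1).eval 0) (paramPoly_C_C_eq_zero hζ hn)
  simpa [eval_paramPoly] using h

theorem prod_dvd_paramPoly {R : Type*} [CommRing R] [IsDomain R] (q u : R) (n : ℕ) (hn : 0 < n)
    (hq : ∀ j, 0 < j → q ^ j ≠ 1)
    (hu : ∀ i < n - 1, (1 - q ^ (4 * i + 4)) ^ 2 - q ^ (4 * i + 4) * u ≠ 0) {M : ℕ}
    (hM : M ≤ n - 1) :
    ∏ i ∈ Finset.range M, ((1 - q ^ (4 * i + 3)) * (1 - q ^ (4 * i + 5))) ∣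
      paramPoly n q u (q ^ (4 * M + 1)) := by
  set f := algebraMap R (FractionRing R)
  have hf : Function.Injective f := IsFractionRing.injective R (FractionRing R)
  have hq' : ∀ j, 0 < j → f q ^ j ≠ 1 := fun j hj h => hq j hj (hf (by simpa using h))
  have hu' : ∀ i < n - 1, (1 - f q ^ (4 * i + 4)) ^ 2 - f q ^ (4 * i + 4) * f u ≠ 0 :=
    fun i hi h => hu i hi (hf (by simpa using h))
  have h1 : ∀ j, 0 < j → 1 - f q ^ j ≠ 0 := fun j hj => sub_ne_zero.2 (hq' j hj).symm
  have hD : ∀ i < n - 1, ratioDen (f q) (f u) (f q ^ (4 * M + 1)) i ≠ 0 := fun i hi =>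
    ratioDen_ne_zero (h1 _ (by omega)) (hu' i hi) (by rw [← pow_add]; exact h1 _ (by omega))
  have hs := paramSum_pow_four_mul_add_one (f q) (f u) (n - 1) hq' hu' M hM
  rw [Nat.sub_add_cancel hn] at hs
  have hE : ∏ i ∈ Finset.range M, ((1 - q ^ (4 * i + 4)) ^ 2 - q ^ (4 * i + 4) * u) ≠ 0 :=
    Finset.prod_ne_zero_iff.2 fun i hi => hu i (by have := Finset.mem_range.1 hi; omega)
  obtain ⟨c, hc⟩ : ∏ i ∈ Finset.range M, ((1 - q ^ (4 * i + 4)) ^ 2 - q ^ (4 * i + 4) * u) ∣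
      ∏ i ∈ Finset.range (n - 1), ratioDen q u (q ^ (4 * M + 1)) i := by
    rw [← Finset.prod_range_mul_prod_Ico _ hM]
    refine Dvd.dvd.mul_right (Finset.prod_dvd_prod_of_dvd _ _ fun i _ => ?_) _
    exact Dvd.dvd.mul_right (Dvd.intro_left _ rfl) _
  refine ⟨c * (1 - q), mul_left_cancel₀ hE (hf ?_)⟩
  have hp := clearedSum_eq n (coeffTerm (f q)) (ratioNum (f q) (f u) (f q ^ (4 * M + 1)))
    (ratioDen (f q) (f u) (f q ^ (4 * M + 1))) hD
  rw [← paramPoly, ← paramSum] at hp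
  have hc' := congrArg f hc
  simp only [map_mul, map_prod, ratioDen, map_sub, map_one, map_pow, map_paramPoly] at hc' hp hs ⊢
  rw [hp, hc']
  linear_combination (f c * ∏ i ∈ Finset.range M,
    ((1 - f q ^ (4 * i + 4)) ^ 2 - f q ^ (4 * i + 4) * f u)) * hs

theorem sq_dvd_eval_of_sq_dvd_eval {R : Type*} [CommRing R] [IsDomain R] {c a b : R} {p : R[X]}
    (hc : c ≠ 0) (hp : C c ∣ p) (hb : c ^ 2 ∣ p.eval b) (hab : c ∣ a - b) : c ^ 2 ∣ p.eval a := by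
  obtain ⟨g, rfl⟩ := hp
  rw [eval_mul, eval_C, sq] at hb ⊢
  refine mul_dvd_mul_left c ((dvd_iff_dvd_of_dvd_sub ?_).2 ((mul_dvd_mul_iff_left hc).1 hb))
  exact hab.trans (sub_dvd_eval_sub a b g)

theorem C_cyclotomic_sq_dvd_paramPoly {n : ℕ} (h4 : n % 4 = 3) :
    C (cyclotomic n ℚ) ^ 2 ∣ paramPoly n (C X) X (1 : ℚ[X][X]) := by
  have hn : Odd n := Nat.odd_iff.2 (by omega)
  have hone : ∀ m, n ∣ m → C (cyclotomic n ℚ) ∣ 1 - (C X : ℚ[X][X]) ^ m := fun m hm => by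
    simpa using _root_.map_dvd C ((cyclotomic_dvd_one_sub_X_pow_iff hn.pos m).2 hm)
  have h := sq_dvd_eval_of_sq_dvd_eval (a := 1) (b := C X ^ (3 * n))
    (C_ne_zero.2 (cyclotomic_ne_zero n ℚ)) (C_C_cyclotomic_dvd_paramPoly hn)
  simp only [eval_paramPoly, eval_C, eval_X] at h
  refine h ?_ (hone _ (Dvd.intro_left _ rfl))
  rw [show 3 * n = 4 * ((3 * n - 1) / 4) + 1 by omega]
  refine dvd_trans ?_ (prod_dvd_paramPoly (C X) X n hn.pos (fun j hj h => ?_)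
    (fun i _ h => ?_) (by omega))
  · rw [sq, Finset.prod_mul_distrib]
    refine mul_dvd_mul ?_ ?_
    · refine dvd_trans (hone (4 * ((n - 3) / 4) + 3) ⟨1, by omega⟩)
        (Finset.dvd_prod_of_mem (fun i => 1 - (C X : ℚ[X][X]) ^ (4 * i + 3)) ?_)
      exact Finset.mem_range.2 (by omega)
    · refine dvd_trans (hone (4 * ((3 * n - 5) / 4) + 5) ⟨3, by omega⟩)
        (Finset.dvd_prod_of_mem (fun i => 1 - (C X : ℚ[X][X]) ^ (4 * i + 5)) ?_)
      exact Finset.mem_range.2 (by omega)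
  · exact X_pow_ne_one hj (C_injective (by simpa using h))
  · have h0 : (1 - (X : ℚ[X]) ^ (4 * i + 4)) ^ 2 = 0 := by simpa using congrArg (eval 0) h
    exact X_pow_ne_one (by omega) (sub_eq_zero.1 (pow_eq_zero_iff two_ne_zero |>.1 h0)).symm

end CyclotomicDivisibility

section Regular

open Polynomial

/-- The rational functions without a pole along the prime `p`. -/
def regularSubring {p : ℚ[X]} (hp : Prime p) : Subring (RatFunc ℚ) where
  carrier := {f | ∃ a b : ℚ[X], ¬ p ∣ b ∧
    f * algebraMap ℚ[X] (RatFunc ℚ) b = algebraMap ℚ[X] (RatFunc ℚ) a}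
  zero_mem' := ⟨0, 1, hp.not_dvd_one, by simp⟩
  one_mem' := ⟨1, 1, hp.not_dvd_one, by simp⟩
  add_mem' := by
    rintro f g ⟨a, b, hb, h⟩ ⟨a', b', hb', h'⟩
    refine ⟨a * b' + a' * b, b * b', hp.not_dvd_mul hb hb', ?_⟩
    simp only [map_add, map_mul, ← h, ← h']
    ring
  mul_mem' := by
    rintro f g ⟨a, b, hb, h⟩ ⟨a', b', hb', h'⟩
    refine ⟨a * a', b * b', hp.not_dvd_mul hb hb', ?_⟩
    simp only [map_mul, ← h, ← h']
    ring
  neg_mem' := by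
    rintro f ⟨a, b, hb, h⟩
    exact ⟨-a, b, hb, by simp [h]⟩

theorem algebraMap_mem_regularSubring {p : ℚ[X]} (hp : Prime p) (a : ℚ[X]) :
    algebraMap ℚ[X] (RatFunc ℚ) a ∈ regularSubring hp :=
  ⟨a, 1, hp.not_dvd_one, by simp⟩

theorem div_mem_regularSubring {p : ℚ[X]} (hp : Prime p) (a : ℚ[X]) {b : ℚ[X]} (hb : ¬ p ∣ b) :
    algebraMap ℚ[X] (RatFunc ℚ) a / algebraMap ℚ[X] (RatFunc ℚ) b ∈ regularSubring hp :=
  ⟨a, b, hb, div_mul_cancel₀ _ <| (map_ne_zero_iff _ (RatFunc.algebraMap_injective ℚ)).2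
    fun h => hb (h ▸ dvd_zero p)⟩

theorem pow_dvd_of_algebraMap_eq {p : ℚ[X]} (hp : Prime p) {m : ℕ} {f : ℚ[X]} {g : RatFunc ℚ}
    (hg : g ∈ regularSubring hp)
    (h : algebraMap ℚ[X] (RatFunc ℚ) f = algebraMap ℚ[X] (RatFunc ℚ) p ^ m * g) : p ^ m ∣ f := by
  obtain ⟨a, b, hb, h'⟩ := hg
  refine hp.pow_dvd_of_dvd_mul_right m hb ⟨a, RatFunc.algebraMap_injective ℚ ?_⟩
  simp only [map_mul, map_pow, h, ← h']
  ring

theorem pow_dvd_num_of_eq {p : ℚ[X]} (hp : Prime p) {m : ℕ} {f g : RatFunc ℚ}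
    (hg : g ∈ regularSubring hp) (h : f = algebraMap ℚ[X] (RatFunc ℚ) p ^ m * g) :
    p ^ m ∣ f.num := by
  refine pow_dvd_of_algebraMap_eq hp (g := g * algebraMap ℚ[X] (RatFunc ℚ) f.denom)
    (mul_mem hg (algebraMap_mem_regularSubring hp _)) ?_
  rw [← mul_assoc, ← h]
  exact (div_eq_iff (by simpa using f.denom_ne_zero)).1 f.num_div_denom

/-- A rational function vanishing to order `m` along `p`, at which a polynomial with polynomial
coefficients vanishes, forces the constant coefficient to vanish to order `m`. -/
theorem pow_dvd_coeff_zero_of_eval₂_eq_zero {p : ℚ[X]} (hp : Prime p) {m : ℕ} {g : RatFunc ℚ}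
    (hg : g ∈ regularSubring hp) {f : ℚ[X][X]}
    (hf : f.eval₂ (algebraMap ℚ[X] (RatFunc ℚ)) (algebraMap ℚ[X] (RatFunc ℚ) p ^ m * g) = 0) :
    p ^ m ∣ f.coeff 0 := by
  have hu : algebraMap ℚ[X] (RatFunc ℚ) p ^ m * g ∈ regularSubring hp :=
    mul_mem (pow_mem (algebraMap_mem_regularSubring hp _) _) hg
  have he : f.divX.eval₂ (algebraMap ℚ[X] (RatFunc ℚ)) (algebraMap ℚ[X] (RatFunc ℚ) p ^ m * g) ∈
      regularSubring hp := by
    rw [eval₂_eq_sum_range]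
    exact sum_mem fun i _ => mul_mem (algebraMap_mem_regularSubring hp _) (pow_mem hu _)
  refine pow_dvd_of_algebraMap_eq hp (neg_mem (mul_mem he hg)) ?_
  rw [← divX_mul_X_add f, eval₂_add, eval₂_mul, eval₂_X, eval₂_C] at hf
  linear_combination hf

end Regular

section Divisibility

open Polynomial

theorem prime_cyclotomic_rat {n : ℕ} (hn : 0 < n) : Prime (cyclotomic n ℚ) :=
  (cyclotomic.irreducible_rat hn).prime

theorem RatFunc.X_pow_ne_one {j : ℕ} (hj : 0 < j) : (RatFunc.X : RatFunc ℚ) ^ j ≠ 1 := fun h =>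
  _root_.X_pow_ne_one hj <| RatFunc.algebraMap_injective ℚ (by simpa using h)

theorem cyclotomic_pow_four_dvd_paramPoly {n : ℕ} (h4 : n % 4 = 3) :
    cyclotomic n ℚ ^ 4 ∣ paramPoly n (X : ℚ[X]) 0 1 := by
  have hn : 0 < n := by omega
  have hp := prime_cyclotomic_rat hn
  set x : RatFunc ℚ := RatFunc.X
  have hx0 : x ≠ 0 := RatFunc.X_ne_zero
  have hx : ∀ j, 0 < j → 1 - x ^ j ≠ 0 := fun j hj =>
    sub_ne_zero.2 (RatFunc.X_pow_ne_one hj).symm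
  have hinj : ∀ a b : ℕ, a < b → x ^ a - x ^ b ≠ 0 := fun a b h => by
    have := mul_ne_zero (pow_ne_zero a hx0) (hx (b - a) (by omega))
    rwa [mul_sub, ← pow_add, Nat.add_sub_cancel' h.le, mul_one] at this
  have hinj' : ∀ a b : ℕ, a ≠ b → x ^ a - x ^ b ≠ 0 := fun a b h => by
    rcases Nat.lt_or_gt_of_ne h with h | h
    · exact hinj a b h
    · rw [← neg_sub]
      exact neg_ne_zero.2 (hinj b a h)
  have hu0 : x ^ n * ((1 - x ^ n) ^ 2 / x ^ n) = (1 - x ^ n) ^ 2 :=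
    mul_div_cancel₀ _ (pow_ne_zero n hx0)
  have h0 : paramPoly n x ((1 - x ^ n) ^ 2 / x ^ n) 1 = 0 := by
    rw [paramPoly, clearedSum_eq, ← paramSum,
      paramSum_one_eq_zero x _ n h4 hx0 (fun j hj => RatFunc.X_pow_ne_one hj) hu0, zero_mul]
    refine fun i hi => ratioDen_ne_zero (hx _ (by omega)) (fun h => ?_)
      (by rw [mul_one]; exact hx _ (by omega))
    refine mul_ne_zero (hinj' n (4 * i + 4) (by omega)) (hx (n + (4 * i + 4)) (by omega)) ?_
    linear_combination x ^ n * h + x ^ (4 * i + 4) * hu0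
  obtain ⟨f, hf⟩ := C_cyclotomic_sq_dvd_paramPoly h4
  obtain ⟨c, hc⟩ := (cyclotomic_dvd_one_sub_X_pow_iff hn n).2 dvd_rfl
  have hXn : ¬ cyclotomic n ℚ ∣ X ^ n := fun h =>
    hp.not_dvd_one (by simpa using dvd_add (Dvd.intro _ hc.symm) h)
  have key := pow_dvd_coeff_zero_of_eval₂_eq_zero hp (m := 2) (f := f)
    (div_mem_regularSubring hp (c ^ 2) hXn) (by
      have hu : algebraMap ℚ[X] (RatFunc ℚ) (cyclotomic n ℚ) ^ 2 *
          (algebraMap ℚ[X] (RatFunc ℚ) (c ^ 2) / algebraMap ℚ[X] (RatFunc ℚ) (X ^ n)) =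
          (1 - x ^ n) ^ 2 / x ^ n := by
        have hc' := congrArg (algebraMap ℚ[X] (RatFunc ℚ)) hc
        simp only [map_sub, map_one, map_pow, map_mul, RatFunc.algebraMap_X] at hc' ⊢
        rw [hc']
        ring
      rw [hu]
      have h1 := congrArg (eval₂RingHom (algebraMap ℚ[X] (RatFunc ℚ))
        ((1 - x ^ n) ^ 2 / x ^ n)) hf
      rw [map_paramPoly] at h1
      simp only [coe_eval₂RingHom, eval₂_C, eval₂_X, eval₂_one, eval₂_mul, eval₂_pow,
        RatFunc.algebraMap_X] at h1
      rw [h0] at h1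
      refine (mul_eq_zero.1 h1.symm).resolve_left (pow_ne_zero 2 ?_)
      simpa using cyclotomic_ne_zero n ℚ)
  have h1 := congrArg (eval 0) hf
  rw [eval_paramPoly, eval_mul, eval_pow, eval_C, eval_C, eval_X, eval_one,
    ← coeff_zero_eq_eval_zero f] at h1
  rw [h1, show 4 = 2 + 2 from rfl, pow_add]
  exact mul_dvd_mul_left _ key

theorem ratioDen_X_not_dvd {d : ℕ} (hd : Odd d) {i : ℕ} (hi : ¬ d ∣ i + 1) :
    ¬ cyclotomic d ℚ ∣ ratioDen (X : ℚ[X]) 0 1 i := by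
  have hp := prime_cyclotomic_rat hd.pos
  have h2 := hd.coprime_two_right
  have h1 : ¬ cyclotomic d ℚ ∣ 1 - X ^ (4 * i + 4) := fun h => hi <| by
    rw [cyclotomic_dvd_one_sub_X_pow_iff hd.pos, show 4 * i + 4 = 2 ^ 2 * (i + 1) by ring] at h
    exact (h2.pow_right 2).dvd_of_dvd_mul_left h
  have h3 : ¬ cyclotomic d ℚ ∣ 1 - X ^ (2 * i + 2) := fun h => hi <| by
    rw [cyclotomic_dvd_one_sub_X_pow_iff hd.pos, show 2 * i + 2 = 2 * (i + 1) by ring] at h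
    exact h2.dvd_of_dvd_mul_left h
  rw [ratioDen, mul_zero, sub_zero, mul_one]
  exact hp.not_dvd_mul (hp.not_dvd_mul h1 fun h => h1 (hp.dvd_of_dvd_pow h)) h3

/-- The sum at `u = 0`, `w = 1`, as a rational function. -/
theorem paramSum_X_eq (n : ℕ) :
    paramSum n (RatFunc.X : RatFunc ℚ) 0 1 = ratioSum n
      (algebraMap ℚ[X] (RatFunc ℚ) ∘ coeffTerm X) (algebraMap ℚ[X] (RatFunc ℚ) ∘ ratioNum X 0 1)
      (algebraMap ℚ[X] (RatFunc ℚ) ∘ ratioDen X 0 1) := by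
  simp [paramSum, ratioSum, coeffTerm, ratioNum, ratioDen]

/-- A sum whose cleared form is divisible by `p ^ m` vanishes to order `m` along `p`. -/
theorem exists_ratioSum_eq {p : ℚ[X]} (hp : Prime p) {n m : ℕ} {c N D : ℕ → ℚ[X]}
    (hD : ∀ i < n - 1, ¬ p ∣ D i) (h : p ^ m ∣ clearedSum n c N D) :
    ∃ g ∈ regularSubring hp, ratioSum n (algebraMap ℚ[X] (RatFunc ℚ) ∘ c)
      (algebraMap ℚ[X] (RatFunc ℚ) ∘ N) (algebraMap ℚ[X] (RatFunc ℚ) ∘ D) =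
        algebraMap ℚ[X] (RatFunc ℚ) p ^ m * g := by
  obtain ⟨a, ha⟩ := h
  have hprod : ¬ p ∣ ∏ i ∈ Finset.range (n - 1), D i := fun h => by
    obtain ⟨i, hi, h⟩ := hp.exists_mem_finset_dvd h
    exact hD i (Finset.mem_range.1 hi) h
  have hne : ∀ b : ℚ[X], ¬ p ∣ b → algebraMap ℚ[X] (RatFunc ℚ) b ≠ 0 := fun b hb =>
    (map_ne_zero_iff _ (RatFunc.algebraMap_injective ℚ)).2 fun h => hb (h ▸ dvd_zero p)
  refine ⟨_, div_mem_regularSubring hp a hprod, ?_⟩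
  have h1 := clearedSum_eq n (algebraMap ℚ[X] (RatFunc ℚ) ∘ c)
    (algebraMap ℚ[X] (RatFunc ℚ) ∘ N) (algebraMap ℚ[X] (RatFunc ℚ) ∘ D)
    (fun i hi => hne _ (hD i hi))
  rw [← map_clearedSum, ha, map_mul, map_pow] at h1
  rw [← mul_div_assoc, eq_div_iff (hne _ hprod), h1, map_prod]
  rfl

end Divisibility

section Blocks

open Polynomial

theorem ratioSum_add {K : Type*} [Field K] (a b : ℕ) (c N D : ℕ → K) :
    ratioSum (a + b) c N D = ratioSum a c N D + (∏ i ∈ Finset.range a, (N i / D i)) *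
      ratioSum b (fun k => c (a + k)) (fun i => N (a + i)) (fun i => D (a + i)) := by
  simp only [ratioSum, Finset.sum_range_add, Finset.prod_range_add, Finset.mul_sum]
  congr 1
  exact Finset.sum_congr rfl fun _ _ => by ring

theorem one_sub_X_pow_eq_mul {d : ℕ} (hd : 0 < d) {m : ℕ} (hm : 0 < m) (h : d ∣ m) :
    ∃ e : ℚ[X], ¬ cyclotomic d ℚ ∣ e ∧ 1 - X ^ m = cyclotomic d ℚ * e := by
  obtain ⟨e, he⟩ := (cyclotomic_dvd_one_sub_X_pow_iff hd m).2 h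
  refine ⟨e, ?_, he⟩
  rintro ⟨e', rfl⟩
  have hs : Squarefree ((X : ℚ[X]) ^ m - 1) :=
    (X_pow_sub_one_separable_iff.2 (by exact_mod_cast hm.ne')).squarefree
  refine (prime_cyclotomic_rat hd).not_isUnit (hs _ ⟨-e', ?_⟩)
  linear_combination -he

theorem ratioSum_block_eq {d : ℕ} (hd : Odd d) (l : ℕ) :
    ∃ g ∈ regularSubring (prime_cyclotomic_rat hd.pos), ratioSum d
      (fun k => algebraMap ℚ[X] (RatFunc ℚ) (coeffTerm X (d * l + k)))
      (fun i => algebraMap ℚ[X] (RatFunc ℚ) (ratioNum X 0 1 (d * l + i)))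
      (fun i => algebraMap ℚ[X] (RatFunc ℚ) (ratioDen X 0 1 (d * l + i))) =
        algebraMap ℚ[X] (RatFunc ℚ) (cyclotomic d ℚ) ^ 1 * g := by
  refine exists_ratioSum_eq (prime_cyclotomic_rat hd.pos) (n := d)
    (c := fun k => coeffTerm X (d * l + k)) (N := fun i => ratioNum X 0 1 (d * l + i))
    (D := fun i => ratioDen X 0 1 (d * l + i))
    (fun i hi => ratioDen_X_not_dvd hd fun h => ?_) ?_
  · rw [add_assoc, Nat.dvd_add_right (Dvd.intro _ rfl)] at h
    exact absurd (Nat.le_of_dvd (by omega) h) (by omega)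
  · have hζ := Complex.isPrimitiveRoot_exp d hd.pos.ne'
    have h0 := paramPoly_zero_one_eq_zero hζ hd
    rw [pow_one, cyclotomic_dvd_iff_aeval_eq_zero hd.pos hζ]
    generalize Complex.exp (2 * Real.pi * Complex.I / d) = ζ at *
    have hadd : ∀ a b, ζ ^ (d * a + b) = ζ ^ b := fun a b => by
      rw [pow_add, pow_mul, hζ.pow_eq_one, one_pow, one_mul]
    refine (map_clearedSum (aeval (R := ℚ) ζ).toRingHom d _ _ _).trans ((Eq.trans ?_ h0))
    have e1 : ∀ k, (d * l + k) ^ 2 + (d * l + k) = d * (l * (d * l + 2 * k + 1)) + (k ^ 2 + k) :=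
      fun k => by ring
    have e2 : ∀ a b k, a * (d * l + k) + b = d * (a * l) + (a * k + b) := fun a b k => by ring
    rw [paramPoly]
    congr 1 <;> ext k <;> simp [coeffTerm, ratioNum, ratioDen, e1, e2, hadd]

theorem prod_block_mem {d : ℕ} (hd : Odd d) (l : ℕ) :
    ∏ i ∈ Finset.range d, (algebraMap ℚ[X] (RatFunc ℚ) (ratioNum X 0 1 (d * l + i)) /
      algebraMap ℚ[X] (RatFunc ℚ) (ratioDen X 0 1 (d * l + i))) ∈
        regularSubring (prime_cyclotomic_rat hd.pos) := by
  have hp := prime_cyclotomic_rat hd.pos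
  obtain ⟨M, hM⟩ := id hd
  obtain ⟨a, ha⟩ : cyclotomic d ℚ ^ 4 ∣ ∏ i ∈ Finset.range d, ratioNum X 0 1 (d * l + i) := by
    obtain ⟨j, b, hj, hjb⟩ : ∃ j b, j < d ∧ 4 * j + 1 = d * b := by
      rcases Nat.even_or_odd M with ⟨t, ht⟩ | ⟨t, ht⟩
      · exact ⟨t, 1, by omega, by omega⟩
      · exact ⟨3 * t + 2, 3, by omega, by omega⟩
    simp only [ratioNum, mul_zero, sub_zero, ← pow_succ']
    rw [Finset.prod_mul_distrib, Finset.prod_pow, pow_succ]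
    refine mul_dvd_mul (pow_dvd_pow_of_dvd (dvd_trans
      ((cyclotomic_dvd_one_sub_X_pow_iff hd.pos (2 * (d * l + M) + 1)).2 ⟨2 * l + 1, ?_⟩)
      (Finset.dvd_prod_of_mem (fun i => 1 - (X : ℚ[X]) ^ (2 * (d * l + i) + 1))
        (Finset.mem_range.2 (by omega)))) 3) (dvd_trans
      ((cyclotomic_dvd_one_sub_X_pow_iff hd.pos (4 * (d * l + j) + 1)).2 ⟨4 * l + b, ?_⟩)
      (Finset.dvd_prod_of_mem (fun i => 1 - (X : ℚ[X]) ^ (4 * (d * l + i) + 1))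
        (Finset.mem_range.2 hj)))
    · linear_combination -hM
    · linear_combination hjb
  obtain ⟨e, he, hD⟩ : ∃ e, ¬ cyclotomic d ℚ ∣ e ∧
      ∏ i ∈ Finset.range d, ratioDen X 0 1 (d * l + i) = cyclotomic d ℚ ^ 4 * e := by
    have hi : d * l + (d - 1) + 1 = d * (l + 1) := by
      rw [add_assoc, Nat.sub_add_cancel hd.pos]; ring
    obtain ⟨e₁, he₁, h₁⟩ := one_sub_X_pow_eq_mul hd.pos (m := 4 * (d * l + (d - 1)) + 4)
      (by omega) ⟨4 * (l + 1), by linear_combination 4 * hi⟩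
    obtain ⟨e₂, he₂, h₂⟩ := one_sub_X_pow_eq_mul hd.pos (m := 2 * (d * l + (d - 1)) + 2)
      (by omega) ⟨2 * (l + 1), by linear_combination 2 * hi⟩
    refine ⟨(∏ i ∈ Finset.range (d - 1), ratioDen X 0 1 (d * l + i)) * (e₁ ^ 3 * e₂),
      hp.not_dvd_mul (fun h => ?_) (hp.not_dvd_mul (fun h => he₁ (hp.dvd_of_dvd_pow h)) he₂), ?_⟩
    · obtain ⟨i, hi, h⟩ := hp.exists_mem_finset_dvd h
      refine ratioDen_X_not_dvd hd (fun h' => ?_) h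
      rw [add_assoc, Nat.dvd_add_right (Dvd.intro _ rfl)] at h'
      have := Finset.mem_range.1 hi
      exact absurd (Nat.le_of_dvd (by omega) h') (by omega)
    · obtain ⟨t, rfl⟩ : ∃ t, d = t + 1 := ⟨d - 1, by omega⟩
      rw [Finset.prod_range_succ]
      simp only [Nat.add_sub_cancel] at h₁ h₂ ⊢
      rw [ratioDen.eq_def X 0 1 ((t + 1) * l + t), mul_zero, sub_zero, mul_one, h₁, h₂]
      ring
  rw [Finset.prod_div_distrib, ← map_prod, ← map_prod, ha, hD, map_mul, map_mul,
    mul_div_mul_left]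
  · exact div_mem_regularSubring hp a he
  · simpa using cyclotomic_ne_zero d ℚ

theorem prod_blocks_mem {d : ℕ} (hd : Odd d) (l : ℕ) :
    ∏ i ∈ Finset.range (d * l), (algebraMap ℚ[X] (RatFunc ℚ) (ratioNum X 0 1 i) /
      algebraMap ℚ[X] (RatFunc ℚ) (ratioDen X 0 1 i)) ∈
        regularSubring (prime_cyclotomic_rat hd.pos) := by
  induction l with
  | zero => simp
  | succ l ih =>
    rw [Nat.mul_succ, Finset.prod_range_add]
    exact mul_mem ih (prod_block_mem hd l)

theorem exists_paramSum_mul_eq {d : ℕ} (hd : Odd d) (l : ℕ) :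
    ∃ g ∈ regularSubring (prime_cyclotomic_rat hd.pos),
      paramSum (d * l) (RatFunc.X : RatFunc ℚ) 0 1 =
        algebraMap ℚ[X] (RatFunc ℚ) (cyclotomic d ℚ) ^ 1 * g := by
  simp only [paramSum_X_eq]
  induction l with
  | zero => exact ⟨0, zero_mem _, by simp [ratioSum]⟩
  | succ l ih =>
    obtain ⟨g, hg, h⟩ := ih
    obtain ⟨g', hg', h'⟩ := ratioSum_block_eq hd l
    refine ⟨_, add_mem hg (mul_mem (prod_blocks_mem hd l) hg'), ?_⟩
    rw [Nat.mul_succ, ratioSum_add, h]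
    simp only [Function.comp_apply, h']
    ring

theorem exists_paramSum_eq {n : ℕ} (hn : Odd n) (h4 : n % 4 = 3) :
    ∃ g ∈ regularSubring (prime_cyclotomic_rat hn.pos),
      paramSum n (RatFunc.X : RatFunc ℚ) 0 1 =
        algebraMap ℚ[X] (RatFunc ℚ) (cyclotomic n ℚ) ^ 4 * g := by
  rw [paramSum_X_eq]
  refine exists_ratioSum_eq _ (fun i hi => ratioDen_X_not_dvd hn fun h => ?_)
    (cyclotomic_pow_four_dvd_paramPoly h4)
  exact absurd (Nat.le_of_dvd (by omega) h) (by omega)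

theorem one_sub_mul_sum_eq_paramSum (n : ℕ) :
    (1 - RatFunc.X) * (∑ k ∈ Finset.range n,
          qint (RatFunc.X : RatFunc ℚ) (6 * k + 1) *
            qPoch RatFunc.X (RatFunc.X ^ 2) k ^ 3 *
            qPoch RatFunc.X (RatFunc.X ^ 4) k /
            (qPoch (RatFunc.X ^ 2) (RatFunc.X ^ 2) k *
              qPoch (RatFunc.X ^ 4) (RatFunc.X ^ 4) k ^ 3) *
            RatFunc.X ^ (k ^ 2 + k)) = paramSum n (RatFunc.X : RatFunc ℚ) 0 1 := by
  rw [Finset.mul_sum, paramSum, ratioSum]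
  refine Finset.sum_congr rfl fun k _ => ?_
  have e : ∀ (a b i : ℕ), (RatFunc.X : RatFunc ℚ) ^ (a * i + b) =
      RatFunc.X ^ b * (RatFunc.X ^ a) ^ i := fun a b i => by ring
  simp only [coeffTerm, ratioNum, ratioDen, qPoch, qint, mul_zero, sub_zero, mul_one, e 2, e 4,
    Finset.prod_div_distrib, Finset.prod_mul_distrib, Finset.prod_pow, ← mul_neg_geom_sum]
  ring_nf

theorem cyclotomic_pow_dvd_num {d : ℕ} (hd : Odd d) (hd1 : d ≠ 1) {m : ℕ} {f g : RatFunc ℚ}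
    (hg : g ∈ regularSubring (prime_cyclotomic_rat hd.pos))
    (h : (1 - RatFunc.X) * f = algebraMap ℚ[X] (RatFunc ℚ) (cyclotomic d ℚ) ^ m * g) :
    cyclotomic d ℚ ^ m ∣ f.num := by
  have h1 : ¬ cyclotomic d ℚ ∣ 1 - X := fun h => hd1 <| by
    simpa using (cyclotomic_dvd_one_sub_X_pow_iff hd.pos 1).1 (by simpa using h)
  refine pow_dvd_num_of_eq (prime_cyclotomic_rat hd.pos)
    (mul_mem hg (div_mem_regularSubring _ 1 h1)) ?_
  have hX : (1 - RatFunc.X : RatFunc ℚ) ≠ 0 :=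
    sub_ne_zero.2 fun h => RatFunc.X_pow_ne_one one_pos (by rw [pow_one, h])
  rw [← mul_assoc, ← h, map_sub, map_one, RatFunc.algebraMap_X]
  field_simp

end Blocks

theorem stmt_6 (n : ℕ) (hn : 0 < n) (h4 : n % 4 = 3) :
    ((∑ i ∈ Finset.range n, (Polynomial.X : Polynomial ℚ) ^ i) *
        Polynomial.cyclotomic n ℚ ^ 3) ∣
      (∑ k ∈ Finset.range n,
          qint (RatFunc.X : RatFunc ℚ) (6 * k + 1) *
            qPoch RatFunc.X (RatFunc.X ^ 2) k ^ 3 *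
            qPoch RatFunc.X (RatFunc.X ^ 4) k /
            (qPoch (RatFunc.X ^ 2) (RatFunc.X ^ 2) k *
              qPoch (RatFunc.X ^ 4) (RatFunc.X ^ 4) k ^ 3) *
            RatFunc.X ^ (k ^ 2 + k)).num := by
  have hodd : Odd n := Nat.odd_iff.2 (by omega)
  have hsum := one_sub_mul_sum_eq_paramSum n
  generalize (∑ k ∈ Finset.range n, (_ : RatFunc ℚ)) = f at hsum ⊢
  have hmem : n ∈ n.divisors.erase 1 := by simp [hn.ne']; omega
  rw [← Polynomial.prod_cyclotomic_eq_geom_sum hn, ← Finset.mul_prod_erase _ _ hmem, mul_right_comm,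
    ← pow_succ']
  refine IsCoprime.mul_dvd (IsCoprime.prod_right fun d hd => IsCoprime.pow_left
    (Polynomial.cyclotomic.isCoprime_rat (Finset.ne_of_mem_erase hd).symm)) ?_
    (Finset.prod_dvd_of_coprime
      (fun a _ b _ hab => Polynomial.cyclotomic.isCoprime_rat hab) fun d hd => ?_)
  · obtain ⟨g, hg, h⟩ := exists_paramSum_eq hodd h4
    exact cyclotomic_pow_dvd_num hodd (by omega) hg (hsum.trans h)
  · have hd' := Finset.mem_of_mem_erase hd
    obtain ⟨l, hl⟩ := Nat.dvd_of_mem_divisors (Finset.mem_of_mem_erase hd')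
    have hdo : Odd d := (Nat.odd_mul.1 (hl ▸ hodd)).1
    obtain ⟨g, hg, h⟩ := exists_paramSum_mul_eq hdo l
    rw [← pow_one (Polynomial.cyclotomic d ℚ)]
    exact cyclotomic_pow_dvd_num hdo (Finset.ne_of_mem_erase hd') hg (hsum.trans (hl ▸ h))
end
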